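/- arXiv:math/0508647 — 7 statements merged into one kernel-verified Lean document; each statement's English description precedes it below -/
import Mathlib

section
/- Let X be a connected cyclically 4-connected cubic simple graph of order n. Then the maximum size of a cyclically stable subset of V(X) equals ⌊(3n−2)/4⌋. -/
/-- An edge set `F` of a graph `X` is cycle-separating if deleting `F` disconnects `X`
and at least two of the resulting connected components contain cycles. -/
def CycleSeparating {V : Type*} (X : SimpleGraph V) (F : Set (Sym2 V)) : Prop :=
  ¬ (X.deleteEdges F).Connected ∧
    ∃ (u v : V) (p : (X.deleteEdges F).Walk u u) (q : (X.deleteEdges F).Walk v v),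
      p.IsCycle ∧ q.IsCycle ∧ ¬ (X.deleteEdges F).Reachable u v

/-- A connected graph `X` is cyclically `k`-connected if no set of fewer than `k` edges
is cycle-separating in `X`. -/
def CyclicallyConnected {V : Type*} (X : SimpleGraph V) (k : ℕ) : Prop :=
  ∀ F : Finset (Sym2 V), ↑F ⊆ X.edgeSet → CycleSeparating X ↑F → k ≤ F.card

open Module in
theorem finite_setOf_finrank_ker_lt {K U U' : Type*} [Field K] [AddCommGroup U] [Module K U]
    [FiniteDimensional K U] [AddCommGroup U'] [Module K U'] (f g : U →ₗ[K] U') :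
    {t : K | finrank K (LinearMap.ker f) < finrank K (LinearMap.ker (f + t • g))}.Finite := by
  obtain ⟨C, hC⟩ := Submodule.exists_isCompl (LinearMap.ker f)
  have hinj : LinearMap.ker (f.domRestrict C) = ⊥ := by
    rw [LinearMap.ker_eq_bot']
    intro z hz
    have h1 : (z : U) ∈ LinearMap.ker f ⊓ C := ⟨hz, z.2⟩
    rw [hC.inf_eq_bot] at h1
    exact Subtype.ext h1
  obtain ⟨h, hh⟩ := LinearMap.exists_leftInverse_of_injective _ hinj
  have hh' : ∀ z : C, h (f z) = z := fun z => LinearMap.congr_fun hh z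
  refine ((Module.End.finite_hasEigenvalue (h ∘ₗ g.domRestrict C)).preimage
    (f := fun t : K => -t⁻¹) ?_).subset ?_
  · intro s _ t _ hst
    simpa using hst
  · intro t ht
    by_contra hne
    rw [Set.mem_ofPred_eq] at ht
    refine absurd ht (not_lt.mpr ?_)
    have hdisj : LinearMap.ker (f + t • g) ⊓ C = ⊥ := by
      rw [eq_bot_iff]
      rintro z ⟨hz, hzC⟩
      rw [SetLike.mem_coe, LinearMap.mem_ker] at hz
      by_contra hz0
      apply hne
      have key := congrArg h hz
      simp only [LinearMap.add_apply, LinearMap.smul_apply, map_add, map_smul, map_zero] at key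
      have h2 := hh' ⟨z, hzC⟩
      simp only at h2
      rw [h2] at key
      have ht0 : t ≠ 0 := by
        rintro rfl
        rw [zero_smul, add_zero] at key
        exact hz0 (congrArg Subtype.val key)
      refine Module.End.hasEigenvalue_of_hasEigenvector (x := (⟨z, hzC⟩ : C))
        (Module.End.hasEigenvector_iff.mpr ⟨Module.End.mem_eigenspace_iff.mpr ?_, ?_⟩)
      · change h (g z) = -t⁻¹ • (⟨z, hzC⟩ : C)
        rw [eq_neg_of_add_eq_zero_left key, smul_neg, neg_smul, neg_neg, smul_smul,
          inv_mul_cancel₀ ht0, one_smul]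
      · exact fun h0 => hz0 (congrArg Subtype.val h0)
    have e1 := Submodule.finrank_sup_add_finrank_inf_eq (LinearMap.ker (f + t • g)) C
    rw [hdisj, finrank_bot, add_zero] at e1
    have e2 := Submodule.finrank_add_eq_of_isCompl hC
    have e3 := Submodule.finrank_le (LinearMap.ker (f + t • g) ⊔ C)
    omega

/-- The radical of the restriction of a bilinear form to a subspace. -/
def formRadical {K M : Type*} [Field K] [AddCommGroup M] [Module K M]
    (B : M →ₗ[K] M →ₗ[K] K) (W : Submodule K M) : Submodule K M :=
  (LinearMap.ker (B.domRestrict₁₂ W W)).map W.subtype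

theorem mem_formRadical {K M : Type*} [Field K] [AddCommGroup M] [Module K M]
    {B : M →ₗ[K] M →ₗ[K] K} {W : Submodule K M} {z : M} :
    z ∈ formRadical B W ↔ z ∈ W ∧ ∀ w ∈ W, B z w = 0 := by
  simp only [formRadical, Submodule.mem_map, LinearMap.mem_ker, Submodule.subtype_apply,
    Subtype.exists, exists_and_right, exists_eq_right, LinearMap.ext_iff, Subtype.forall]
  constructor
  · rintro ⟨h, h2⟩
    exact ⟨h, fun w hw => h2 w hw⟩
  · rintro ⟨h, h2⟩
    exact ⟨h, fun w hw => h2 w hw⟩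

open Module in
theorem finite_setOf_finrank_formRadical_lt {K M : Type*} [Field K] [AddCommGroup M] [Module K M]
    [FiniteDimensional K M] (B C : M →ₗ[K] M →ₗ[K] K) (W : Submodule K M) :
    {t : K | finrank K (formRadical B W) < finrank K (formRadical (B + t • C) W)}.Finite := by
  refine (finite_setOf_finrank_ker_lt (B.domRestrict₁₂ W W) (C.domRestrict₁₂ W W)).subset ?_
  intro t ht
  rw [Set.mem_ofPred_eq, formRadical, formRadical, Submodule.finrank_map_subtype_eq,
    Submodule.finrank_map_subtype_eq] at ht
  exact ht

/-- The alternating form `a ∧ b` attached to two linear functionals. -/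
def wedgeForm {K M : Type*} [Field K] [AddCommGroup M] [Module K M]
    (a b : Module.Dual K M) : M →ₗ[K] M →ₗ[K] K :=
  a.smulRight b - b.smulRight a

@[simp]
theorem wedgeForm_apply {K M : Type*} [Field K] [AddCommGroup M] [Module K M]
    (a b : Module.Dual K M) (z w : M) : wedgeForm a b z w = a z * b w - b z * a w := by
  simp [wedgeForm]

/-- The weighted sum of the forms `a i ∧ b i`. -/
def wedgeSum {K M ι : Type*} [Field K] [AddCommGroup M] [Module K M] [Fintype ι]
    (a b : ι → Module.Dual K M) (x : ι → K) : M →ₗ[K] M →ₗ[K] K :=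
  ∑ i, x i • wedgeForm (a i) (b i)

theorem wedgeSum_apply {K M ι : Type*} [Field K] [AddCommGroup M] [Module K M] [Fintype ι]
    (a b : ι → Module.Dual K M) (x : ι → K) (z w : M) :
    wedgeSum a b x z w = ∑ i, x i * (a i z * b i w - b i z * a i w) := by
  simp [wedgeSum, LinearMap.sum_apply]

theorem wedgeSum_swap {K M ι : Type*} [Field K] [AddCommGroup M] [Module K M] [Fintype ι]
    (a b : ι → Module.Dual K M) (x : ι → K) (z w : M) :
    wedgeSum a b x z w = - wedgeSum a b x w z := by
  rw [wedgeSum_apply, wedgeSum_apply, ← Finset.sum_neg_distrib]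
  exact Finset.sum_congr rfl fun i _ => by ring

theorem wedgeSum_self {K M ι : Type*} [Field K] [AddCommGroup M] [Module K M] [Fintype ι]
    (a b : ι → Module.Dual K M) (x : ι → K) (z : M) :
    wedgeSum a b x z z = 0 := by
  rw [wedgeSum_apply]
  exact Finset.sum_eq_zero fun i _ => by ring

open Module in
theorem finrank_formRadical_add_wedgeForm_lt {K M : Type*} [Field K] [AddCommGroup M] [Module K M]
    [FiniteDimensional K M] (B : M →ₗ[K] M →ₗ[K] K) (hB : ∀ z w, B z w = - B w z)
    (W : Submodule K M) (a b : Dual K M) {r r' : M}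
    (hr : r ∈ formRadical B W) (hr' : r' ∈ formRadical B W) (h : wedgeForm a b r r' ≠ 0)
    {t : K} (ht : t ≠ 0) :
    finrank K (formRadical (B + t • wedgeForm a b) W) < finrank K (formRadical B W) := by
  have hvan : ∀ z ∈ formRadical (B + t • wedgeForm a b) W, a z = 0 ∧ b z = 0 := by
    intro z hz
    obtain ⟨hzW, hz⟩ := mem_formRadical.mp hz
    have key : ∀ s ∈ formRadical B W, a z * b s - b z * a s = 0 := by
      intro s hs
      obtain ⟨hsW, hs⟩ := mem_formRadical.mp hs
      have h1 := hz s hsW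
      rw [LinearMap.add_apply, LinearMap.add_apply, hB z s, hs z hzW] at h1
      simpa [ht] using h1
    have k1 := key r hr
    have k2 := key r' hr'
    rw [wedgeForm_apply] at h
    constructor
    · refine (mul_eq_zero.mp (?_ : a z * (a r * b r' - b r * a r') = 0)).resolve_right h
      linear_combination a r * k2 - a r' * k1
    · refine (mul_eq_zero.mp (?_ : b z * (a r * b r' - b r * a r') = 0)).resolve_right h
      linear_combination b r * k2 - b r' * k1
  refine Submodule.finrank_lt_finrank_of_lt (lt_of_le_of_ne ?_ ?_)
  · intro z hz
    obtain ⟨ha, hb⟩ := hvan z hz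
    obtain ⟨hzW, hz⟩ := mem_formRadical.mp hz
    refine mem_formRadical.mpr ⟨hzW, fun w hw => ?_⟩
    simpa [ha, hb] using hz w hw
  · intro heq
    obtain ⟨ha, hb⟩ := hvan r (heq ▸ hr)
    exact h (by simp [ha, hb])

open Module in
/-- Generic weights: the weights can be chosen so that, for each of finitely many subspaces, the
individual forms `a i ∧ b i` vanish on the radical of their weighted sum. -/
theorem exists_weights_forall_wedgeForm_eq_zero {K M ι κ : Type*} [Field K] [Infinite K]
    [AddCommGroup M] [Module K M] [FiniteDimensional K M] [Fintype ι] [Finite κ]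
    (a b : ι → Dual K M) (W : κ → Submodule K M) :
    ∃ x : ι → K, ∀ k i, ∀ r ∈ formRadical (wedgeSum a b x) (W k),
      ∀ r' ∈ formRadical (wedgeSum a b x) (W k), wedgeForm (a i) (b i) r r' = 0 := by
  classical
  have := Fintype.ofFinite κ
  let F : (ι → K) → ℕ := fun x => ∑ k, finrank K (formRadical (wedgeSum a b x) (W k))
  obtain ⟨x, hx⟩ : ∃ x, ∀ y, F x ≤ F y := ⟨Function.argmin F, fun y => Function.argmin_le F y⟩
  refine ⟨x, fun k i r hr r' hr' => ?_⟩
  by_contra hne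
  let bad : Set K := insert 0 (⋃ j, {t : K | finrank K (formRadical (wedgeSum a b x) (W j)) <
    finrank K (formRadical (wedgeSum a b x + t • wedgeForm (a i) (b i)) (W j))})
  have hbad : bad.Finite := (Set.finite_iUnion fun j =>
    finite_setOf_finrank_formRadical_lt _ _ _).insert 0
  obtain ⟨t, ht⟩ := hbad.infinite_compl.nonempty
  simp only [bad, Set.mem_compl_iff, Set.mem_insert_iff, Set.mem_iUnion, Set.mem_ofPred_eq, not_or,
    not_exists, not_lt] at ht
  have hsum : wedgeSum a b (x + Pi.single i t) =
      wedgeSum a b x + t • wedgeForm (a i) (b i) := by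
    simp only [wedgeSum, Pi.add_apply, add_smul, Finset.sum_add_distrib]
    congr 1
    rw [Finset.sum_eq_single i]
    · simp
    · intro j _ hj
      simp [Pi.single_eq_of_ne hj]
    · simp
  have hF : F (x + Pi.single i t) = ∑ j, finrank K
      (formRadical (wedgeSum a b x + t • wedgeForm (a i) (b i)) (W j)) :=
    Finset.sum_congr rfl fun j _ => by rw [hsum]
  refine absurd (hx (x + Pi.single i t)) (not_le.mpr ?_)
  rw [hF]
  exact Finset.sum_lt_sum (fun j _ => ht.2 j) ⟨k, Finset.mem_univ k,
    finrank_formRadical_add_wedgeForm_lt _ (wedgeSum_swap a b x) _ _ _ hr hr' hne ht.1⟩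

open Module in
theorem finrank_formRadical_lt_of_hyperplane {K M : Type*} [Field K] [AddCommGroup M] [Module K M]
    [FiniteDimensional K M] (B : M →ₗ[K] M →ₗ[K] K) (hB : ∀ z w, B z w = - B w z)
    (hB0 : ∀ z, B z z = 0) (W : Submodule K M) (e : Dual K M)
    (he : ∀ r ∈ formRadical B W, e r = 0) (he' : ∃ w ∈ W, e w ≠ 0) :
    finrank K (formRadical B W) < finrank K (formRadical B (W ⊓ LinearMap.ker e)) := by
  have hmem : e.domRestrict W ∈ LinearMap.range (B.domRestrict₁₂ W W).dualMap := by
    rw [LinearMap.range_dualMap_eq_dualAnnihilator_ker, Submodule.mem_dualAnnihilator]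
    intro w hw
    exact he _ (Submodule.mem_map_of_mem hw)
  obtain ⟨φ, hφ⟩ := hmem
  obtain ⟨u, rfl⟩ := (Module.evalEquiv K W).surjective φ
  have hu : ∀ w ∈ W, B w u = e w := fun w hw => LinearMap.congr_fun hφ ⟨w, hw⟩
  refine Submodule.finrank_lt_finrank_of_lt (lt_of_le_of_ne ?_ ?_)
  · intro z hz
    have h0 := he z hz
    obtain ⟨hzW, hz⟩ := mem_formRadical.mp hz
    exact mem_formRadical.mpr ⟨⟨hzW, h0⟩, fun w hw => hz w hw.1⟩
  · intro heq
    have hu0 : e u = 0 := by rw [← hu u u.2, hB0]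
    have hur : (u : M) ∈ formRadical B (W ⊓ LinearMap.ker e) := by
      refine mem_formRadical.mpr ⟨⟨u.2, hu0⟩, fun w hw => ?_⟩
      rw [hB, hu w hw.1, LinearMap.mem_ker.mp hw.2, neg_zero]
    rw [← heq, mem_formRadical] at hur
    obtain ⟨w, hw, hne⟩ := he'
    exact hne (by rw [← hu w hw, hB, hur.2 w hw, neg_zero])

open Module in
/-- If a weighted sum of forms `a i ∧ b i` is nondegenerate, then the functionals belonging to at
most half the dimension many indices already separate points. -/
theorem exists_finset_separating {K ι : Type*} [Field K] [CharZero K] [Fintype ι] (d : ℕ) :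
    ∀ {W : Type*} [AddCommGroup W] [Module K W] [FiniteDimensional K W]
      (a b : ι → Dual K W) (x : ι → K), finrank K W = d →
      (∀ z, (∀ w, wedgeSum a b x z w = 0) → z = 0) →
      ∃ T : Finset ι, 2 * T.card ≤ d ∧ ∀ z, (∀ i ∈ T, a i z = 0 ∧ b i z = 0) → z = 0 := by
  classical
  induction d using Nat.strong_induction_on with
  | _ d ih =>
  intro W _ _ _ a b x hd hnd
  rcases Nat.eq_zero_or_pos d with rfl | hpos
  · have := finrank_zero_iff.mp hd
    exact ⟨∅, by simp, fun z _ => Subsingleton.elim _ _⟩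
  have hinj : Function.Injective (wedgeSum a b x) := by
    rw [← LinearMap.ker_eq_bot, LinearMap.ker_eq_bot']
    exact fun z hz => hnd z fun w => LinearMap.congr_fun hz w
  have hsurj : Function.Surjective (wedgeSum a b x) :=
    (LinearMap.injective_iff_surjective_of_finrank_eq_finrank
      (Subspace.dual_finrank_eq (K := K) (V := W)).symm).mp hinj
  choose sharp hsharp using hsurj
  have hs : ∀ (φ : Dual K W) w, wedgeSum a b x (sharp φ) w = φ w := fun φ w => by rw [hsharp]
  have hid : LinearMap.id (R := K) (M := W) =
      ∑ i, x i • ((a i).smulRight (sharp (b i)) - (b i).smulRight (sharp (a i))) := by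
    ext u
    apply hinj
    ext w
    simp only [LinearMap.id_apply, LinearMap.sum_apply, map_sum, LinearMap.smul_apply,
      LinearMap.sub_apply, LinearMap.smulRight_apply, map_smul, map_sub, hs, smul_eq_mul,
      wedgeSum_apply a b x u w]
  obtain ⟨i, hi⟩ : ∃ i, a i (sharp (b i)) ≠ b i (sharp (a i)) := by
    by_contra! hall
    have htr := congrArg (LinearMap.trace K W) hid
    rw [LinearMap.trace_id] at htr
    simp only [map_sum, map_smul, map_sub, LinearMap.trace_smulRight, hall, sub_self, smul_zero,
      Finset.sum_const_zero, hd, Nat.cast_eq_zero] at htr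
    omega
  have hanti : a i (sharp (b i)) = - b i (sharp (a i)) := by
    rw [← hs (a i), ← hs (b i), wedgeSum_swap]
  have haa : a i (sharp (a i)) = 0 := by rw [← hs, wedgeSum_self]
  have hbb : b i (sharp (b i)) = 0 := by rw [← hs, wedgeSum_self]
  have hb0 : b i (sharp (a i)) ≠ 0 := fun h0 => hi (by rw [hanti, h0, neg_zero])
  have ha0 : a i (sharp (b i)) ≠ 0 := fun h0 => hb0 (by rw [hanti] at h0; simpa using h0)
  let W' : Submodule K W := LinearMap.ker (a i) ⊓ LinearMap.ker (b i)
  have hlt1 : finrank K W' < finrank K (LinearMap.ker (a i)) := by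
    refine Submodule.finrank_lt_finrank_of_lt (lt_of_le_of_ne inf_le_left fun heq => ?_)
    have : sharp (a i) ∈ W' := by rw [heq]; exact haa
    exact hb0 this.2
  have hlt2 : finrank K (LinearMap.ker (a i)) < finrank K W := by
    refine Submodule.finrank_lt fun heq => ?_
    have : sharp (b i) ∈ LinearMap.ker (a i) := by rw [heq]; trivial
    exact ha0 this
  obtain ⟨T, hT, hsep⟩ := ih (finrank K W') (by omega) (W := W')
    (fun j => (a j).domRestrict W') (fun j => (b j).domRestrict W') x rfl (by
      intro z hz
      refine Subtype.ext (hnd z fun w => ?_)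
      have hw : w - (a i w / a i (sharp (b i))) • sharp (b i)
          - (b i w / b i (sharp (a i))) • sharp (a i) ∈ W' := by
        constructor
        · simp [haa, ha0]
        · simp [hbb, hb0]
      have h1 := hz ⟨_, hw⟩
      simp only [wedgeSum_apply, LinearMap.domRestrict_apply] at h1
      rw [← wedgeSum_apply a b x, map_sub, map_sub, map_smul, map_smul, wedgeSum_swap a b x z
        (sharp (b i)), wedgeSum_swap a b x z (sharp (a i)), hs, hs,
        LinearMap.mem_ker.mp z.2.1, LinearMap.mem_ker.mp z.2.2] at h1
      simpa using h1)
  refine ⟨insert i T, ?_, fun z hz => ?_⟩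
  · have := Finset.card_insert_le i T
    omega
  · have hzi := hz i (Finset.mem_insert_self i T)
    exact congrArg Subtype.val (hsep ⟨z, hzi⟩ fun j hj => hz j (Finset.mem_insert_of_mem hj))

/-- The antisymmetric rational functions on ordered pairs supported on the edges of `H`. -/
def flowSpace {V : Type*} (H : SimpleGraph V) : Submodule ℚ (V → V → ℚ) where
  carrier := {z | (∀ u v, z u v = - z v u) ∧ ∀ u v, ¬ H.Adj u v → z u v = 0}
  zero_mem' := ⟨fun _ _ => by simp, fun _ _ _ => rfl⟩
  add_mem' := fun {y z} hy hz => ⟨fun u v => by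
    simp only [Pi.add_apply]; rw [hy.1, hz.1]; ring,
    fun u v h => by simp [hy.2 u v h, hz.2 u v h]⟩
  smul_mem' := fun c z hz => ⟨fun u v => by
    simp only [Pi.smul_apply, smul_eq_mul]; rw [hz.1]; ring,
    fun u v h => by simp [hz.2 u v h]⟩

theorem flowSpace_mono {V : Type*} {G H : SimpleGraph V} (h : G ≤ H) :
    flowSpace G ≤ flowSpace H :=
  fun _ hz => ⟨hz.1, fun u v huv => hz.2 u v fun hG => huv (h hG)⟩

/-- The net flow out of each vertex. -/
def divergence (V : Type*) [Fintype V] : (V → V → ℚ) →ₗ[ℚ] (V → ℚ) where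
  toFun z v := ∑ y, z v y
  map_add' y z := by ext v; simp [Finset.sum_add_distrib]
  map_smul' c z := by ext v; simp [Finset.mul_sum]

@[simp]
theorem divergence_apply {V : Type*} [Fintype V] (z : V → V → ℚ) (v : V) :
    divergence V z v = ∑ y, z v y := rfl

/-- The cycle space of `H`: flows with zero divergence. -/
def circulations {V : Type*} [Fintype V] (H : SimpleGraph V) : Submodule ℚ (V → V → ℚ) :=
  flowSpace H ⊓ LinearMap.ker (divergence V)

theorem mem_circulations {V : Type*} [Fintype V] {H : SimpleGraph V} {z : V → V → ℚ} :
    z ∈ circulations H ↔ z ∈ flowSpace H ∧ ∀ v, ∑ y, z v y = 0 := by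
  simp [circulations, funext_iff]

theorem circulations_mono {V : Type*} [Fintype V] {G H : SimpleGraph V} (h : G ≤ H) :
    circulations G ≤ circulations H :=
  inf_le_inf_right _ (flowSpace_mono h)

theorem exists_flow_of_adj {V : Type*} [Fintype V] [DecidableEq V] {H : SimpleGraph V} {u v : V}
    (h : H.Adj u v) : ∃ z ∈ flowSpace H, z u v = 1 ∧
      divergence V z = Pi.single u 1 - Pi.single v 1 := by
  refine ⟨fun x y => (if x = u ∧ y = v then 1 else 0) - (if x = v ∧ y = u then 1 else 0),
    ⟨fun x y => ?_, fun x y hxy => ?_⟩, ?_, ?_⟩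
  · simp only [neg_sub, and_comm]
  · have h1 : ¬ (x = u ∧ y = v) := fun hc => hxy (by rw [hc.1, hc.2]; exact h)
    have h2 : ¬ (x = v ∧ y = u) := fun hc => hxy (by rw [hc.1, hc.2]; exact h.symm)
    simp only [if_neg h1, if_neg h2, sub_zero]
  · simp [h.ne]
  · ext x
    simp only [divergence_apply, Finset.sum_sub_distrib, Pi.sub_apply, Pi.single_apply, ite_and]
    congr 1 <;> split_ifs <;> simp

theorem exists_flow_of_reachable {V : Type*} [Fintype V] [DecidableEq V] {H : SimpleGraph V}
    {u v : V} (h : H.Reachable u v) : ∃ z ∈ flowSpace H,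
      divergence V z = Pi.single u 1 - Pi.single v 1 := by
  obtain ⟨p⟩ := h
  induction p with
  | nil => exact ⟨0, zero_mem _, by simp⟩
  | cons hadj _ ih =>
    obtain ⟨z, hz, hd⟩ := ih
    obtain ⟨y, hy, -, hd'⟩ := exists_flow_of_adj hadj
    exact ⟨y + z, add_mem hy hz, by rw [map_add, hd, hd']; abel⟩

theorem isAcyclic_of_circulations_eq_bot {V : Type*} [Fintype V] {H : SimpleGraph V}
    (h : circulations H = ⊥) : H.IsAcyclic := by
  classical
  rw [SimpleGraph.isAcyclic_iff_forall_adj_isBridge]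
  intro u v huv
  rw [SimpleGraph.isBridge_iff]
  intro hr
  obtain ⟨z, hz, hd⟩ := exists_flow_of_reachable hr
  obtain ⟨y, hy, hy1, hd'⟩ := exists_flow_of_adj huv
  have hmem : z - y ∈ circulations H := by
    refine ⟨sub_mem (flowSpace_mono (SimpleGraph.deleteEdges_le _) hz) hy, ?_⟩
    rw [SetLike.mem_coe, LinearMap.mem_ker, map_sub, hd, hd', sub_self]
  rw [h, Submodule.mem_bot, sub_eq_zero] at hmem
  have := hz.2 u v (by simp)
  rw [hmem, hy1] at this
  exact one_ne_zero this

theorem exists_isCycle_of_circulation_ne_zero {V : Type*} [Fintype V] {H : SimpleGraph V}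
    {z : V → V → ℚ} (hz : z ∈ circulations H) {u v : V} (huv : z u v ≠ 0) :
    ∃ (w : V) (p : H.Walk w w), p.IsCycle ∧ s(u, v) ∈ p.edges := by
  classical
  have hadj : H.Adj u v := by
    by_contra hn
    exact huv (hz.1.2 u v hn)
  by_contra! hcyc
  have hb := (SimpleGraph.isBridge_iff_forall_cycle_notMem (G := H) (e := s(u, v)) hadj).mpr
    fun w p hp => hcyc w p hp
  rw [SimpleGraph.isBridge_iff] at hb
  obtain ⟨hflow, hdiv⟩ := mem_circulations.mp hz
  let S : Finset V := {x | (H.deleteEdges {s(u, v)}).Reachable u x}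
  have hu : u ∈ S := by simp [S]
  have hv : v ∉ S := by simpa [S] using hb
  have hcross : ∀ x ∈ S, ∀ y ∉ S, z x y ≠ 0 → x = u ∧ y = v := by
    intro x hx y hy hxy
    have hadj' : H.Adj x y := by
      by_contra hn
      exact hxy (hflow.2 x y hn)
    have hx' : (H.deleteEdges {s(u, v)}).Reachable u x := by simpa [S] using hx
    have hy' : ¬ (H.deleteEdges {s(u, v)}).Reachable u y := by simpa [S] using hy
    have he : s(x, y) = s(u, v) := by
      by_contra hne
      refine hy' (hx'.trans (SimpleGraph.Adj.reachable ?_))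
      rw [SimpleGraph.deleteEdges_adj]
      exact ⟨hadj', hne⟩
    rcases Sym2.eq_iff.mp he with h | ⟨rfl, rfl⟩
    · exact h
    · exact absurd hx hv
  have hin : ∑ x ∈ S, ∑ y ∈ S, z x y = 0 := by
    have h1 : ∑ x ∈ S, ∑ y ∈ S, z x y = - ∑ x ∈ S, ∑ y ∈ S, z x y := by
      conv_lhs => rw [Finset.sum_comm]
      simp only [← Finset.sum_neg_distrib]
      exact Finset.sum_congr rfl fun x _ => Finset.sum_congr rfl fun y _ => hflow.1 y x
    linarith
  have hout : ∑ x ∈ S, ∑ y ∈ Sᶜ, z x y = z u v := by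
    rw [Finset.sum_eq_single u, Finset.sum_eq_single v]
    · intro y hy hyv
      by_contra hne
      exact hyv (hcross u hu y (Finset.mem_compl.mp hy) hne).2
    · exact fun h => absurd (Finset.mem_compl.mpr hv) h
    · intro x hx hxu
      refine Finset.sum_eq_zero fun y hy => ?_
      by_contra hne
      exact hxu (hcross x hx y (Finset.mem_compl.mp hy) hne).1
    · exact fun h => absurd hu h
  have htot : ∑ x ∈ S, ∑ y, z x y = 0 := Finset.sum_eq_zero fun x _ => hdiv x
  simp only [← Finset.sum_add_sum_compl S, Finset.sum_add_distrib] at htot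
  rw [hin, hout, zero_add] at htot
  exact huv htot

open Module in
theorem finrank_flowSpace {V : Type*} [Fintype V] (H : SimpleGraph V) [Fintype H.edgeSet] :
    finrank ℚ (flowSpace H) = H.edgeFinset.card := by
  classical
  have hout : ∀ e : Sym2 V, s(e.out.1, e.out.2) = e := fun e => Quot.out_eq e
  let f : flowSpace H →ₗ[ℚ] (H.edgeSet → ℚ) :=
    { toFun := fun z e => z.1 e.1.out.1 e.1.out.2
      map_add' := fun _ _ => rfl
      map_smul' := fun _ _ => rfl }
  have hinj : Function.Injective f := by
    rw [← LinearMap.ker_eq_bot, LinearMap.ker_eq_bot']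
    intro z hz
    ext u v
    by_cases huv : H.Adj u v
    · have h1 : z.1 (s(u, v)).out.1 (s(u, v)).out.2 = 0 := congrFun hz ⟨s(u, v), huv⟩
      rcases Sym2.eq_iff.mp (hout s(u, v)) with ⟨h2, h3⟩ | ⟨h2, h3⟩
      · rw [h2, h3] at h1
        exact h1
      · rw [h2, h3] at h1
        rw [z.2.1, h1]
        simp
    · exact z.2.2 u v huv
  have hsurj : Function.Surjective f := by
    intro g
    let g' : Sym2 V → ℚ := fun e => if h : e ∈ H.edgeSet then g ⟨e, h⟩ else 0
    refine ⟨⟨fun u v => if (s(u, v)).out = (u, v) then g' s(u, v) else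
      if (s(u, v)).out = (v, u) then - g' s(u, v) else 0, fun u v => ?_, fun u v huv => ?_⟩, ?_⟩
    · simp only [Sym2.eq_swap (a := v) (b := u)]
      by_cases hne : u = v
      · subst hne
        have hg : g' s(u, u) = 0 := dif_neg (by simp)
        simp only [hg, neg_zero, ite_self]
      · have : (u, v) ≠ (v, u) := fun h => hne (Prod.ext_iff.mp h).1
        split_ifs <;> simp_all
    · have hg : g' s(u, v) = 0 := dif_neg huv
      simp only [hg, neg_zero, ite_self]
    · ext e
      change (if (s(e.1.out.1, e.1.out.2)).out = (e.1.out.1, e.1.out.2) then _ else _) = _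
      rw [hout, if_pos rfl]
      exact dif_pos e.2
  rw [(LinearEquiv.ofBijective f ⟨hinj, hsurj⟩).finrank_eq, Module.finrank_fintype_fun_eq_card,
    SimpleGraph.edgeFinset_card]

open Module in
theorem finrank_circulations_add_finrank_range {V : Type*} [Fintype V] (H : SimpleGraph V)
    [Fintype H.edgeSet] :
    finrank ℚ ((flowSpace H).map (divergence V)) + finrank ℚ (circulations H) =
      H.edgeFinset.card := by
  have h := LinearMap.finrank_range_add_finrank_ker ((divergence V).domRestrict (flowSpace H))
  rw [finrank_flowSpace, LinearMap.range_domRestrict, LinearMap.ker_domRestrict] at h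
  rw [← h]
  congr 1
  rw [circulations, ← Submodule.finrank_map_subtype_eq, Submodule.map_comap_subtype]

open Module in
theorem card_edgeFinset_lt_finrank_circulations_add_card {V : Type*} [Fintype V] [Nonempty V]
    (H : SimpleGraph V) [Fintype H.edgeSet] :
    H.edgeFinset.card < finrank ℚ (circulations H) + Fintype.card V := by
  classical
  have hlt : finrank ℚ ((flowSpace H).map (divergence V)) < finrank ℚ (V → ℚ) := by
    refine Submodule.finrank_lt fun htop => ?_
    obtain ⟨v⟩ := ‹Nonempty V›
    have hmem : Pi.single v (1 : ℚ) ∈ (flowSpace H).map (divergence V) := by rw [htop]; trivial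
    obtain ⟨z, hz, hzv⟩ := hmem
    have h1 : ∑ x, divergence V z x = 1 := by rw [hzv]; simp
    have h2 : ∑ x, ∑ y, z x y = - ∑ x, ∑ y, z x y := by
      conv_lhs => rw [Finset.sum_comm]
      simp only [← Finset.sum_neg_distrib]
      exact Finset.sum_congr rfl fun x _ => Finset.sum_congr rfl fun y _ => hz.1 y x
    simp only [divergence_apply] at h1
    linarith
  rw [Module.finrank_fintype_fun_eq_card] at hlt
  have := finrank_circulations_add_finrank_range H
  omega

open Module in
theorem finrank_circulations_add_card_le {V : Type*} [Fintype V]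
    (H : SimpleGraph V) [Fintype H.edgeSet] :
    finrank ℚ (circulations H) + Fintype.card V ≤
      H.edgeFinset.card + Nat.card H.ConnectedComponent := by
  classical
  have := Fintype.ofFinite H.ConnectedComponent
  let D := Submodule.span ℚ (Set.range fun c : H.ConnectedComponent =>
    (Pi.single (Quot.out c) 1 : V → ℚ))
  have htop : (flowSpace H).map (divergence V) ⊔ D = ⊤ := by
    rw [eq_top_iff, ← (Pi.basisFun ℚ V).span_eq, Submodule.span_le]
    rintro _ ⟨v, rfl⟩
    rw [Pi.basisFun_apply, SetLike.mem_coe]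
    have hr : H.Reachable v (Quot.out (H.connectedComponentMk v)) :=
      SimpleGraph.ConnectedComponent.exact (Quot.out_eq (H.connectedComponentMk v)).symm
    obtain ⟨z, hz, hd⟩ := exists_flow_of_reachable hr
    rw [← sub_add_cancel (Pi.single v 1 : V → ℚ)
      (Pi.single (Quot.out (H.connectedComponentMk v)) 1 : V → ℚ), ← hd]
    exact Submodule.add_mem_sup (Submodule.mem_map_of_mem hz)
      (Submodule.subset_span ⟨H.connectedComponentMk v, rfl⟩)
  have hD : finrank ℚ D ≤ Nat.card H.ConnectedComponent := by
    rw [Nat.card_eq_fintype_card]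
    exact finrank_range_le_card _
  have h1 := Submodule.finrank_add_le_finrank_add_finrank ((flowSpace H).map (divergence V)) D
  rw [htop, finrank_top, Module.finrank_fintype_fun_eq_card] at h1
  have := finrank_circulations_add_finrank_range H
  omega

/-- In a cyclically `k`-connected graph `X`, at least `k` edges leave a component of a subgraph `H`
that contains a cycle, provided another component of `H` contains one as well. -/
theorem SimpleGraph.ConnectedComponent.le_sum_card_of_cyclicallyConnected {V : Type*} [Fintype V]
    {X H : SimpleGraph V} [DecidableRel X.Adj] [DecidableEq H.ConnectedComponent]
    (hHX : H ≤ X) {k : ℕ} (hk : CyclicallyConnected X k)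
    {C D : H.ConnectedComponent} (hCD : C ≠ D)
    (hC : ∃ (w : V) (p : H.Walk w w), p.IsCycle ∧ H.connectedComponentMk w = C)
    (hD : ∃ (w : V) (p : H.Walk w w), p.IsCycle ∧ H.connectedComponentMk w = D) :
    k ≤ ∑ u with H.connectedComponentMk u = C,
      ((X.neighborFinset u).filter fun v => H.connectedComponentMk v ≠ C).card := by
  classical
  let P : Finset (Σ _ : V, V) := (Finset.univ.filter fun u => H.connectedComponentMk u = C).sigma
    fun u => (X.neighborFinset u).filter fun v => H.connectedComponentMk v ≠ C
  let F : Finset (Sym2 V) := P.image fun e => s(e.1, e.2)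
  have hF : ∀ e, e ∈ F ↔ ∃ u v, H.connectedComponentMk u = C ∧ H.connectedComponentMk v ≠ C ∧
      X.Adj u v ∧ s(u, v) = e := by
    intro e
    simp only [F, P, Finset.mem_image, Finset.mem_sigma, Finset.mem_filter, Finset.mem_univ,
      true_and, SimpleGraph.mem_neighborFinset, Sigma.exists]
    grind
  rw [← Finset.card_sigma]
  refine le_trans (hk F ?_ ?_) Finset.card_image_le
  · intro e he
    obtain ⟨u, v, -, -, hadj, rfl⟩ := (hF e).mp he
    exact hadj
  have hle : H ≤ X.deleteEdges F := by
    intro a b hab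
    rw [SimpleGraph.deleteEdges_adj]
    refine ⟨hHX hab, fun he => ?_⟩
    obtain ⟨u, v, hu, hv, -, he⟩ := (hF _).mp he
    have huv : H.Adj u v := by
      rw [← SimpleGraph.mem_edgeSet, he]
      exact hab
    exact hv ((SimpleGraph.ConnectedComponent.sound huv.reachable).symm.trans hu)
  have hreach : ∀ {a b}, (X.deleteEdges F).Reachable a b → H.connectedComponentMk a = C →
      H.connectedComponentMk b = C := by
    rintro a b ⟨p⟩ ha
    induction p with
    | nil => exact ha
    | cons hadj _ ih =>
      refine ih ?_
      by_contra hne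
      rw [SimpleGraph.deleteEdges_adj] at hadj
      exact hadj.2 ((hF _).mpr ⟨_, _, ha, hne, hadj.1, rfl⟩)
  obtain ⟨u, p, hp, hu⟩ := hC
  obtain ⟨v, q, hq, hv⟩ := hD
  have hnr : ¬ (X.deleteEdges F).Reachable u v := fun h => hCD ((hreach h hu).symm.trans hv)
  exact ⟨fun hcon => hnr (hcon.preconnected u v), u, v, p.mapLe hle, q.mapLe hle, hp.mapLe hle,
    hq.mapLe hle, hnr⟩

/-- A component is nontrivial when it contains an edge. -/
def SimpleGraph.ConnectedComponent.HasEdge {V : Type*} {H : SimpleGraph V}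
    (C : H.ConnectedComponent) : Prop :=
  ∃ u v, H.Adj u v ∧ H.connectedComponentMk u = C

theorem two_mul_card_components_add_sum_degree_le {V : Type*} [Fintype V]
    {X H : SimpleGraph V} [DecidableRel X.Adj] [DecidableRel H.Adj]
    (hHX : H ≤ X) (hcubic : ∀ v, X.degree v = 3) (hc4c : CyclicallyConnected X 4)
    (hcyc : ∀ u v, H.Adj u v → ∃ (w : V) (p : H.Walk w w), p.IsCycle ∧ s(u, v) ∈ p.edges) :
    2 * Nat.card {C : H.ConnectedComponent // C.HasEdge} + 2 * Nat.card H.ConnectedComponent +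
      ∑ v, H.degree v ≤ 3 * Fintype.card V + 4 := by
  classical
  have := Fintype.ofFinite H.ConnectedComponent
  have hcyc' : ∀ C : H.ConnectedComponent, C.HasEdge →
      ∃ (w : V) (p : H.Walk w w), p.IsCycle ∧ H.connectedComponentMk w = C := by
    rintro C ⟨u, v, huv, hu⟩
    obtain ⟨w, p, hp, he⟩ := hcyc u v huv
    refine ⟨w, p, hp, ?_⟩
    rw [← hu]
    exact SimpleGraph.ConnectedComponent.sound
      (p.takeUntil u (p.fst_mem_support_of_mem_edges he)).reachable
  have key : ∀ C : H.ConnectedComponent,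
      (if C.HasEdge then 2 else 0) + 2 + ∑ v with H.connectedComponentMk v = C, H.degree v ≤
      (∑ v with H.connectedComponentMk v = C, 3) +
        4 * (if C.HasEdge ∧ ∀ D : H.ConnectedComponent, D.HasEdge → D = C then 1 else 0) := by
    intro C
    have hdeg : ∀ v, H.degree v ≤ 3 := fun v => hcubic v ▸ SimpleGraph.degree_le_of_le hHX
    have hsum : ∑ v with H.connectedComponentMk v = C, H.degree v ≤
      ∑ v with H.connectedComponentMk v = C, 3 := Finset.sum_le_sum fun v _ => hdeg v
    by_cases hC : C.HasEdge
    · by_cases hD : ∀ D : H.ConnectedComponent, D.HasEdge → D = C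
      · rw [if_pos hC, if_pos ⟨hC, hD⟩]
        omega
      · rw [if_pos hC, if_neg fun h => hD h.2]
        push Not at hD
        obtain ⟨D, hD, hDC⟩ := hD
        have h4 := SimpleGraph.ConnectedComponent.le_sum_card_of_cyclicallyConnected hHX hc4c
          hDC.symm (hcyc' C hC) (hcyc' D hD)
        have h5 : ∑ v with H.connectedComponentMk v = C, (H.degree v +
            ((X.neighborFinset v).filter fun w => H.connectedComponentMk w ≠ C).card) ≤
            ∑ v with H.connectedComponentMk v = C, 3 := by
          refine Finset.sum_le_sum fun v hv => ?_
          rw [Finset.mem_filter] at hv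
          rw [← hcubic v, ← SimpleGraph.card_neighborFinset_eq_degree,
            ← SimpleGraph.card_neighborFinset_eq_degree, ← Finset.card_union_of_disjoint]
          · refine Finset.card_le_card (Finset.union_subset (fun w hw => ?_)
              (Finset.filter_subset _ _))
            rw [SimpleGraph.mem_neighborFinset] at hw ⊢
            exact hHX hw
          · rw [Finset.disjoint_left]
            intro w hw hw'
            rw [SimpleGraph.mem_neighborFinset] at hw
            exact (Finset.mem_filter.mp hw').2
              ((SimpleGraph.ConnectedComponent.sound hw.reachable).symm.trans hv.2)
        rw [Finset.sum_add_distrib] at h5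
        omega
    · rw [if_neg hC, if_neg fun h => hC h.1]
      have h0 : ∑ v with H.connectedComponentMk v = C, H.degree v = 0 := by
        refine Finset.sum_eq_zero fun v hv => ?_
        by_contra hne
        obtain ⟨w, hw⟩ := (H.degree_pos_iff_exists_adj v).mp (Nat.pos_of_ne_zero hne)
        exact hC ⟨v, w, hw, (Finset.mem_filter.mp hv).2⟩
      have hpos : 0 < (Finset.univ.filter fun v => H.connectedComponentMk v = C).card := by
        obtain ⟨v, hv⟩ := Quot.exists_rep C
        exact Finset.card_pos.mpr ⟨v, Finset.mem_filter.mpr ⟨Finset.mem_univ _, hv⟩⟩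
      rw [h0, Finset.sum_const, smul_eq_mul]
      omega
  have huniq : ∑ C : H.ConnectedComponent,
      (if C.HasEdge ∧ ∀ D : H.ConnectedComponent, D.HasEdge → D = C then 1 else 0) ≤ 1 := by
    rw [← Finset.card_filter, Finset.card_le_one]
    intro C hC D hD
    rw [Finset.mem_filter] at hC hD
    exact hD.2.2 C hC.2.1
  have htot := Finset.sum_le_sum fun C (_ : C ∈ Finset.univ) => key C
  have hfib : ∀ f : V → ℕ,
      ∑ C, ∑ v with H.connectedComponentMk v = C, f v = ∑ v, f v := fun f => by
    convert Finset.sum_fiberwise Finset.univ H.connectedComponentMk f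
  rw [Finset.sum_add_distrib, Finset.sum_add_distrib, Finset.sum_add_distrib,
    hfib fun v => H.degree v, hfib fun _ => 3, ← Finset.mul_sum] at htot
  have hE : ∑ C : H.ConnectedComponent, (if C.HasEdge then 2 else 0) =
      2 * Nat.card {C : H.ConnectedComponent // C.HasEdge} := by
    rw [Nat.card_eq_fintype_card, Fintype.card_subtype, Finset.card_filter, Finset.mul_sum]
    exact Finset.sum_congr rfl fun C _ => by split_ifs <;> rfl
  rw [hE] at htot
  simp only [Finset.sum_const, Finset.card_univ, smul_eq_mul] at htot
  rw [Nat.card_eq_fintype_card (α := H.ConnectedComponent)]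
  omega

open Module in
theorem finrank_le_card_hasEdge {V : Type*} [Fintype V] {H : SimpleGraph V}
    (R : Submodule ℚ (V → V → ℚ)) (hR : R ≤ circulations H)
    (hpar : ∀ r ∈ R, ∀ r' ∈ R, ∀ v y y', r v y * r' v y' = r v y' * r' v y)
    (hne : ∀ u v, H.Adj u v → ∃ r ∈ R, r u v ≠ 0) :
    finrank ℚ R ≤ Nat.card {C : H.ConnectedComponent // C.HasEdge} := by
  classical
  have := Fintype.ofFinite {C : H.ConnectedComponent // C.HasEdge}
  choose s t hst hs using fun C : {C : H.ConnectedComponent // C.HasEdge} => C.2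
  let f : R →ₗ[ℚ] ({C : H.ConnectedComponent // C.HasEdge} → ℚ) :=
    { toFun := fun r C => r.1 (s C) (t C)
      map_add' := fun _ _ => rfl
      map_smul' := fun _ _ => rfl }
  have hstar : ∀ r ∈ R, ∀ v y, H.Adj v y → r v y = 0 → ∀ y', r v y' = 0 := by
    intro r hr v y hvy h0 y'
    obtain ⟨r', hr', h1⟩ := hne v y hvy
    have h2 := hpar r hr r' hr' v y y'
    rw [h0, zero_mul] at h2
    exact (mul_eq_zero.mp h2.symm).resolve_right h1
  have hprop : ∀ r ∈ R, ∀ {u v}, H.Reachable u v → (∀ y, r u y = 0) → ∀ y, r v y = 0 := by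
    rintro r hr u v ⟨p⟩ hu
    induction p with
    | nil => exact hu
    | cons hadj _ ih =>
      refine ih (hstar r hr _ _ hadj.symm ?_)
      rw [(hR hr).1.1, hu, neg_zero]
  have hinj : Function.Injective f := by
    rw [← LinearMap.ker_eq_bot, LinearMap.ker_eq_bot']
    intro r hr
    ext u v
    by_cases huv : H.Adj u v
    · let C : {C : H.ConnectedComponent // C.HasEdge} :=
        ⟨H.connectedComponentMk u, u, v, huv, rfl⟩
      exact hprop r r.2 (SimpleGraph.ConnectedComponent.exact (hs C))
        (hstar r r.2 _ _ (hst C) (congrFun hr C)) v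
    · exact (hR r.2).1.2 u v huv
  have := LinearMap.finrank_le_finrank_of_injective hinj
  rwa [Module.finrank_fintype_fun_eq_card, ← Nat.card_eq_fintype_card] at this

/-- The functional reading off the flow along the ordered pair `(u, v)`. -/
def edgeFlow {V : Type*} (u v : V) : Module.Dual ℚ (V → V → ℚ) :=
  LinearMap.proj v ∘ₗ LinearMap.proj u

@[simp]
theorem edgeFlow_apply {V : Type*} (u v : V) (z : V → V → ℚ) : edgeFlow u v z = z u v := rfl

theorem circulations_deleteEdges_singleton {V : Type*} [Fintype V] (H : SimpleGraph V) (u v : V) :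
    circulations (H.deleteEdges {s(u, v)}) = circulations H ⊓ LinearMap.ker (edgeFlow u v) := by
  ext z
  constructor
  · intro hz
    exact ⟨circulations_mono (SimpleGraph.deleteEdges_le _) hz, hz.1.2 u v (by simp)⟩
  · rintro ⟨hz, h0⟩
    rw [SetLike.mem_coe, LinearMap.mem_ker, edgeFlow_apply] at h0
    refine ⟨⟨hz.1.1, fun a b hab => ?_⟩, hz.2⟩
    by_cases hH : H.Adj a b
    · rw [SimpleGraph.deleteEdges_adj, not_and, not_not] at hab
      rcases Sym2.eq_iff.mp (hab hH) with ⟨rfl, rfl⟩ | ⟨rfl, rfl⟩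
      · exact h0
      · rw [hz.1.1, h0, neg_zero]
    · exact hz.1.2 a b hH

open Module in
theorem finrank_le_finrank_inf_ker_add_one {K M : Type*} [Field K] [AddCommGroup M] [Module K M]
    [FiniteDimensional K M] (W : Submodule K M) (e : Dual K M) :
    finrank K W ≤ finrank K (W ⊓ LinearMap.ker e : Submodule K M) + 1 := by
  have h := LinearMap.finrank_range_add_finrank_ker (e.domRestrict W)
  have h1 := Submodule.finrank_le (LinearMap.range (e.domRestrict W))
  rw [LinearMap.ker_domRestrict, ← Submodule.finrank_map_subtype_eq,
    Submodule.map_comap_subtype] at h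
  rw [finrank_self] at h1
  omega

/-- The neighbours of each vertex `v` can be listed as `p v`, `q v`, `r v`; circulations sum to zero
over them and vanish elsewhere. -/
theorem exists_neighbor_enumeration {V : Type*} [Fintype V] [DecidableEq V] {X : SimpleGraph V}
    [DecidableRel X.Adj] (hcubic : ∀ v, X.degree v = 3) :
    ∃ p q r : V → V, ∀ z ∈ circulations X, ∀ v, z v (p v) + z v (q v) + z v (r v) = 0 ∧
      ∀ y, y ≠ p v → y ≠ q v → y ≠ r v → z v y = 0 := by
  choose p q r hpq hpr hqr h using fun v => Finset.card_eq_three.mp (hcubic v)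
  refine ⟨p, q, r, fun z hz v => ?_⟩
  have hnb : ∀ y, X.Adj v y ↔ y = p v ∨ y = q v ∨ y = r v := by
    intro y
    rw [← SimpleGraph.mem_neighborFinset, h v]
    simp
  have hout : ∀ y, y ≠ p v → y ≠ q v → y ≠ r v → z v y = 0 := fun y h1 h2 h3 =>
    hz.1.2 v y (by rw [hnb]; tauto)
  refine ⟨?_, hout⟩
  have hsum := (mem_circulations.mp hz).2 v
  rw [← Finset.sum_subset (Finset.subset_univ {p v, q v, r v})] at hsum
  · rwa [Finset.sum_insert (by simp [hpq v, hpr v]), Finset.sum_pair (hqr v), ← add_assoc] at hsum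
  · intro y _ hy
    simp only [Finset.mem_insert, Finset.mem_singleton, not_or] at hy
    exact hout y hy.1 hy.2.1 hy.2.2

open Module in
theorem exists_weights_finrank_formRadical_le_one {V : Type*} [Fintype V]
    {X : SimpleGraph V} [DecidableRel X.Adj] (hconn : X.Connected)
    (hcubic : ∀ v, X.degree v = 3) (hc4c : CyclicallyConnected X 4) (p q r : V → V)
    (hpqr : ∀ z ∈ circulations X, ∀ v, z v (p v) + z v (q v) + z v (r v) = 0 ∧
      ∀ y, y ≠ p v → y ≠ q v → y ≠ r v → z v y = 0) :
    ∃ x : V → ℚ, finrank ℚ (formRadical (wedgeSum (fun v => edgeFlow v (p v))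
      (fun v => edgeFlow v (q v)) x) (circulations X)) ≤ 1 := by
  classical
  have := hconn.nonempty
  obtain ⟨x, hx⟩ := exists_weights_forall_wedgeForm_eq_zero (fun v => edgeFlow v (p v))
    (fun v => edgeFlow v (q v)) (fun H : SimpleGraph V => circulations H)
  refine ⟨x, ?_⟩
  set B := wedgeSum (fun v => edgeFlow v (p v)) (fun v => edgeFlow v (q v)) x with hBdef
  have hB : ∀ z w, B z w = - B w z := wedgeSum_swap _ _ x
  have hB0 : ∀ z, B z z = 0 := wedgeSum_self _ _ x
  let Φ : SimpleGraph V → ℕ := fun H =>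
    finrank ℚ (formRadical B (circulations H)) + finrank ℚ (circulations H)
  obtain ⟨H, ⟨hHX, hΦ⟩, hmin⟩ := (Set.toFinite {H : SimpleGraph V | H ≤ X ∧ Φ X ≤ Φ H}).exists_minimal
    ⟨X, le_rfl, le_rfl⟩
  have hle : formRadical B (circulations H) ≤ circulations H :=
    fun z hz => (mem_formRadical.mp hz).1
  have hne : ∀ u v, H.Adj u v → ∃ z ∈ formRadical B (circulations H), z u v ≠ 0 := by
    intro u v huv
    by_contra! hzero
    have hΦ' : Φ H ≤ Φ (H.deleteEdges {s(u, v)}) := by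
      simp only [Φ]
      rw [circulations_deleteEdges_singleton]
      by_cases hw : ∃ w ∈ circulations H, edgeFlow u v w ≠ 0
      · have h1 := finrank_formRadical_lt_of_hyperplane B hB hB0 _ _ hzero hw
        have h2 := finrank_le_finrank_inf_ker_add_one (circulations H) (edgeFlow u v)
        omega
      · push Not at hw
        rw [inf_eq_left.mpr fun w hw' => hw w hw']
    have h1 := hmin ⟨(SimpleGraph.deleteEdges_le _).trans hHX, hΦ.trans hΦ'⟩
      (SimpleGraph.deleteEdges_le _) huv
    simp at h1
  have hpar : ∀ z ∈ formRadical B (circulations H), ∀ z' ∈ formRadical B (circulations H),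
      ∀ v y y', z v y * z' v y' = z v y' * z' v y := by
    intro z hz z' hz' v y y'
    have h1 := hx H v z hz z' hz'
    simp only [wedgeForm_apply, edgeFlow_apply] at h1
    obtain ⟨h2, h3⟩ := hpqr z (circulations_mono hHX (hle hz)) v
    obtain ⟨h4, h5⟩ := hpqr z' (circulations_mono hHX (hle hz')) v
    have h6 : z v (p v) * z' v (r v) = z v (r v) * z' v (p v) := by
      linear_combination z v (p v) * h4 - z' v (p v) * h2 - h1
    have h7 : z v (q v) * z' v (r v) = z v (r v) * z' v (q v) := by
      linear_combination z v (q v) * h4 - z' v (q v) * h2 + h1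
    have hcase : ∀ y, y = p v ∨ y = q v ∨ y = r v ∨ (z v y = 0 ∧ z' v y = 0) := by
      intro y
      have := h3 y
      have := h5 y
      tauto
    rcases hcase y with rfl | rfl | rfl | ⟨e1, e2⟩ <;>
      rcases hcase y' with rfl | rfl | rfl | ⟨e3, e4⟩ <;> first | linarith | simp [*]
  have hb := finrank_le_card_hasEdge _ hle hpar hne
  have hcount := two_mul_card_components_add_sum_degree_le hHX hcubic hc4c fun u v huv => by
    obtain ⟨z, hz, hzuv⟩ := hne u v huv
    exact exists_isCycle_of_circulation_ne_zero (hle hz) hzuv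
  have h1 := finrank_circulations_add_card_le H
  have h2 := card_edgeFinset_lt_finrank_circulations_add_card X
  have h3 := H.sum_degrees_eq_twice_card_edges
  have h4 := X.sum_degrees_eq_twice_card_edges
  simp only [hcubic, Finset.sum_const, Finset.card_univ, smul_eq_mul] at h4
  simp only [Φ] at hΦ
  omega

open Module in
/-- In a connected cyclically 4-connected cubic graph on `n` vertices there are at most
`(n + 4) / 4` vertices meeting the support of every nonzero circulation. -/
theorem exists_finset_meeting_circulations {V : Type*} [Fintype V]
    {X : SimpleGraph V} [DecidableRel X.Adj] (hconn : X.Connected)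
    (hcubic : ∀ v, X.degree v = 3) (hc4c : CyclicallyConnected X 4) :
    ∃ T : Finset V, 4 * T.card ≤ Fintype.card V + 4 ∧
      ∀ z ∈ circulations X, (∀ v ∈ T, ∀ y, z v y = 0) → z = 0 := by
  classical
  have := hconn.nonempty
  obtain ⟨p, q, r, hpqr⟩ := exists_neighbor_enumeration hcubic
  obtain ⟨x, hx⟩ := exists_weights_finrank_formRadical_le_one hconn hcubic hc4c p q r hpqr
  set B := wedgeSum (fun v => edgeFlow v (p v)) (fun v => edgeFlow v (q v)) x with hBdef
  have hB : ∀ z w, B z w = - B w z := wedgeSum_swap _ _ x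
  have hsep : ∀ W ≤ circulations X, formRadical B W = ⊥ → ∃ T : Finset V,
      2 * T.card ≤ finrank ℚ W ∧ ∀ z ∈ W, (∀ v ∈ T, ∀ y, z v y = 0) → z = 0 := by
    intro W hW hrad
    obtain ⟨T, hT, h⟩ := exists_finset_separating (finrank ℚ W) (W := W)
      (fun v => (edgeFlow v (p v)).domRestrict W) (fun v => (edgeFlow v (q v)).domRestrict W) x rfl
      (by
        intro z hz
        have hmem : (z : V → V → ℚ) ∈ formRadical B W := by
          refine mem_formRadical.mpr ⟨z.2, fun w hw => ?_⟩
          have := hz ⟨w, hw⟩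
          rw [wedgeSum_apply] at this
          rw [hBdef, wedgeSum_apply]
          exact this
        rw [hrad] at hmem
        exact Subtype.ext hmem)
    exact ⟨T, hT, fun z hz hzT => congrArg Subtype.val
      (h ⟨z, hz⟩ fun v hv => ⟨hzT v hv _, hzT v hv _⟩)⟩
  have hdim : 2 * finrank ℚ (circulations X) ≤ Fintype.card V + 2 := by
    have h1 := finrank_circulations_add_card_le X
    have h2 := X.sum_degrees_eq_twice_card_edges
    simp only [hcubic, Finset.sum_const, Finset.card_univ, smul_eq_mul] at h2
    have h3 : Nat.card X.ConnectedComponent ≤ 1 := by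
      have := hconn.preconnected.subsingleton_connectedComponent
      exact Finite.card_le_one_iff_subsingleton.mpr this
    omega
  by_cases hbot : formRadical B (circulations X) = ⊥
  · obtain ⟨T, hT, h⟩ := hsep _ le_rfl hbot
    exact ⟨T, by omega, h⟩
  obtain ⟨s, hs, hs0⟩ := Submodule.exists_mem_ne_zero_of_ne_bot hbot
  obtain ⟨v, y, hvy⟩ : ∃ v y, s v y ≠ 0 := by
    by_contra! hall
    exact hs0 (funext fun v => funext fun y => hall v y)
  obtain ⟨hsX, hsB⟩ := mem_formRadical.mp hs
  have hspan : ∀ z ∈ formRadical B (circulations X), z v y = 0 → z = 0 := by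
    intro z hz h0
    have h1 := finrank_le_one_iff.mp hx
    obtain ⟨g, hg⟩ := h1
    obtain ⟨c, hc⟩ := hg ⟨s, hs⟩
    obtain ⟨d, hd⟩ := hg ⟨z, hz⟩
    have hc' : c • (g : V → V → ℚ) = s := congrArg Subtype.val hc
    have hd' : d • (g : V → V → ℚ) = z := congrArg Subtype.val hd
    rw [← hc'] at hvy
    rw [← hd'] at h0 ⊢
    simp only [Pi.smul_apply, smul_eq_mul, ne_eq, mul_eq_zero, not_or] at hvy h0
    rw [h0.resolve_right hvy.2, zero_smul]
  have hrad : formRadical B (circulations X ⊓ LinearMap.ker (edgeFlow v y)) = ⊥ := by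
    rw [Submodule.eq_bot_iff]
    intro z hz
    obtain ⟨⟨hzX, hz0⟩, hzB⟩ := mem_formRadical.mp hz
    refine hspan z (mem_formRadical.mpr ⟨hzX, fun w hw => ?_⟩) hz0
    have h1 := hzB (w - (w v y / s v y) • s) ⟨sub_mem hw (Submodule.smul_mem _ _ hsX), by
      simp [hvy]⟩
    rw [map_sub, map_smul, hB z s, hsB z hzX, neg_zero, smul_zero, sub_zero] at h1
    exact h1
  obtain ⟨T, hT, h⟩ := hsep _ inf_le_left hrad
  have hlt : finrank ℚ (circulations X ⊓ LinearMap.ker (edgeFlow v y) : Submodule ℚ _) <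
      finrank ℚ (circulations X) := by
    refine Submodule.finrank_lt_finrank_of_lt (lt_of_le_of_ne inf_le_left fun heq => hvy ?_)
    rw [← heq] at hsX
    exact hsX.2
  refine ⟨insert v T, ?_, fun z hz hzT => h z ⟨hz, hzT v (Finset.mem_insert_self v T) y⟩
    fun w hw => hzT w (Finset.mem_insert_of_mem hw)⟩
  have := Finset.card_insert_le v T
  omega

theorem isAcyclic_induce_of_meeting_circulations {V : Type*} [Fintype V] {X : SimpleGraph V}
    {S : Set V} (h : ∀ z ∈ circulations X, (∀ v ∉ S, ∀ y, z v y = 0) → z = 0) :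
    (X.induce S).IsAcyclic := by
  have hac : (X.induce S).spanningCoe.IsAcyclic := by
    refine isAcyclic_of_circulations_eq_bot ((Submodule.eq_bot_iff _).mpr fun z hz => ?_)
    refine h z (circulations_mono (X.spanningCoe_induce_le S) hz) fun v hv y =>
      hz.1.2 v y fun hadj => ?_
    simp only [SimpleGraph.map_adj] at hadj
    obtain ⟨a, b, -, rfl, -⟩ := hadj
    exact hv a.2
  exact hac.of_map (Function.Embedding.subtype _)

theorem card_edgeFinset_lt_of_isAcyclic {V : Type*} [Fintype V] [Nonempty V] {H : SimpleGraph V}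
    [Fintype H.edgeSet] (h : H.IsAcyclic) : H.edgeFinset.card < Fintype.card V := by
  classical
  obtain ⟨F, hHF, -, hF⟩ :=
    (SimpleGraph.connected_top (V := V)).exists_isTree_le_of_le_of_isAcyclic le_top h
  rw [← hF.card_edgeFinset]
  exact Nat.lt_succ_of_le (Finset.card_le_card (SimpleGraph.edgeFinset_mono hHF))

theorem card_le_of_isAcyclic_induce {V : Type*} [Fintype V] {X : SimpleGraph V}
    [DecidableRel X.Adj] (hcubic : ∀ v, X.degree v = 3) {S : Finset V}
    (h : (X.induce (S : Set V)).IsAcyclic) : S.card ≤ (3 * Fintype.card V - 2) / 4 := by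
  classical
  rcases S.eq_empty_or_nonempty with rfl | ⟨v, hv⟩
  · simp
  have : Nonempty (S : Set V) := ⟨⟨v, hv⟩⟩
  have h1 := card_edgeFinset_lt_of_isAcyclic h
  have h2 := (X.induce (S : Set V)).sum_degrees_eq_twice_card_edges
  have h3 : ∑ u : (S : Set V), (X.induce (S : Set V)).degree u =
      ∑ u ∈ S, ((X.neighborFinset u).filter (· ∈ S)).card := by
    rw [← Finset.sum_coe_sort S]
    refine Finset.sum_congr rfl fun u _ => ?_
    rw [← SimpleGraph.card_neighborFinset_eq_degree, ← Finset.card_map (Function.Embedding.subtype _)]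
    congr 1
    ext w
    simp
  have h4 : ∀ u, ((X.neighborFinset u).filter (· ∈ S)).card +
      ((X.neighborFinset u).filter (· ∉ S)).card = 3 := fun u => by
    rw [Finset.card_filter_add_card_filter_not, SimpleGraph.card_neighborFinset_eq_degree, hcubic]
  have h5 : ∑ u ∈ S, ((X.neighborFinset u).filter (· ∉ S)).card =
      ∑ u ∈ Sᶜ, ((X.neighborFinset u).filter (· ∈ S)).card := by
    have := Finset.sum_card_bipartiteAbove_eq_sum_card_bipartiteBelow (s := S) (t := Sᶜ) X.Adj
    convert this using 3
    · ext w; simp [Finset.bipartiteAbove, and_comm]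
    · ext w; simp [Finset.bipartiteBelow, and_comm, X.adj_comm]
  have h6 : ∑ u ∈ Sᶜ, ((X.neighborFinset u).filter (· ∈ S)).card ≤ Sᶜ.card * 3 :=
    Finset.sum_le_card_nsmul _ _ _ fun u _ => by have := h4 u; omega
  have h7 := Finset.sum_congr (rfl : S = S) fun u _ => h4 u
  rw [Finset.sum_add_distrib, Finset.sum_const, smul_eq_mul] at h7
  have h8 := S.card_add_card_compl
  have h9 : Fintype.card (S : Set V) = S.card := by simp
  omega

/-- Payan–Sakarovitch: the maximum size of a cyclically stable vertex subset of a
connected cyclically 4-connected cubic simple graph on `n` vertices is `⌊(3n-2)/4⌋`. -/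
theorem stmt9 {V : Type*} [Fintype V] (X : SimpleGraph V) [DecidableRel X.Adj]
    (hconn : X.Connected) (hcubic : ∀ v : V, X.degree v = 3)
    (hc4c : CyclicallyConnected X 4) :
    IsGreatest {k : ℕ | ∃ S : Finset V, (X.induce (↑S : Set V)).IsAcyclic ∧ S.card = k}
      ((3 * Fintype.card V - 2) / 4) := by
  classical
  refine ⟨?_, ?_⟩
  · obtain ⟨T, hT, hmeet⟩ := exists_finset_meeting_circulations hconn hcubic hc4c
    have hn : 4 ≤ Fintype.card V := by
      obtain ⟨v⟩ := hconn.nonempty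
      have := X.degree_lt_card_verts v
      rw [hcubic] at this
      exact this
    obtain ⟨T', hTT', hT'⟩ := Finset.exists_superset_card_eq (s := T)
      (n := Fintype.card V - (3 * Fintype.card V - 2) / 4) (by omega) (by omega)
    refine ⟨T'ᶜ, isAcyclic_induce_of_meeting_circulations fun z hz hzS => ?_, ?_⟩
    · exact hmeet z hz fun v hv y => hzS v (by simpa using hTT' hv) y
    · rw [Finset.card_compl, hT']
      omega
  · rintro k ⟨S, hS, rfl⟩
    exact card_le_of_isAcyclic_induce hcubic hS
end

section
/- Let X be a connected cubic vertex-transitive simple graph with girth g. Then every cycle-separating edge set of X has at least g edges; moreover, if g is strictly less than the Betti number |E(X)| − |V(X)| + 1 of X, then X has a cycle-separating edge set of exactly g edges. -/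
namespace SimpleGraph

section EdgeCount

variable {V : Type*} (X : SimpleGraph V) [DecidableRel X.Adj]

/-- The number of ordered adjacent pairs in `S × T`. -/
def edgeCount (S T : Finset V) : ℤ :=
  ∑ v ∈ S, ∑ w ∈ T, if X.Adj v w then 1 else 0

lemma edgeCount_comm (S T : Finset V) : X.edgeCount S T = X.edgeCount T S := by
  unfold edgeCount
  rw [Finset.sum_comm]
  simp only [X.adj_comm]

lemma edgeCount_mono {S S' T T' : Finset V} (hS : S ⊆ S') (hT : T ⊆ T') :
    X.edgeCount S T ≤ X.edgeCount S' T' := by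
  unfold edgeCount
  refine (Finset.sum_le_sum fun v _ => Finset.sum_le_sum_of_subset_of_nonneg hT ?_).trans
    (Finset.sum_le_sum_of_subset_of_nonneg hS ?_)
  · intros; split_ifs <;> simp
  · intros; exact Finset.sum_nonneg fun _ _ => by split_ifs <;> simp

lemma edgeCount_nonneg (S T : Finset V) : 0 ≤ X.edgeCount S T :=
  Finset.sum_nonneg fun _ _ => Finset.sum_nonneg fun _ _ => by split_ifs <;> simp

lemma edgeCount_singleton_singleton {v w : V} (h : X.Adj v w) : X.edgeCount {v} {w} = 1 := by
  simp only [edgeCount, Finset.sum_singleton, if_pos h]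

lemma edgeCount_eq_sum (S T : Finset V) : X.edgeCount S T = ∑ v ∈ S, X.edgeCount {v} T := by
  simp [edgeCount]

lemma edgeCount_singleton (v : V) (T : Finset V) :
    X.edgeCount {v} T = (T.filter (X.Adj v)).card := by
  simp [edgeCount]

lemma one_le_edgeCount {S T : Finset V} {v w : V} (hv : v ∈ S) (hw : w ∈ T) (h : X.Adj v w) :
    1 ≤ X.edgeCount S T := by
  rw [← X.edgeCount_singleton_singleton h]
  exact X.edgeCount_mono (by simpa) (by simpa)

lemma exists_adj_of_edgeCount_pos {S T : Finset V} (h : 0 < X.edgeCount S T) :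
    ∃ v ∈ S, ∃ w ∈ T, X.Adj v w := by
  by_contra! hn
  refine h.ne' (Finset.sum_eq_zero fun v hv => Finset.sum_eq_zero fun w hw => ?_)
  simp [hn v hv w hw]

lemma edgeCount_univ [Fintype V] (hX : ∀ v, X.degree v = 3) (S : Finset V) :
    X.edgeCount S Finset.univ = 3 * S.card := by
  rw [edgeCount_eq_sum]
  simp only [edgeCount_singleton, ← neighborFinset_eq_filter, card_neighborFinset_eq_degree, hX]
  simp [mul_comm]

lemma edgeCount_map (φ : X ≃g X) (S T : Finset V) :
    X.edgeCount (S.map φ.toEquiv.toEmbedding) (T.map φ.toEquiv.toEmbedding) = X.edgeCount S T := by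
  simp only [edgeCount, Finset.sum_map]
  exact Finset.sum_congr rfl fun v _ => Finset.sum_congr rfl fun w _ =>
    if_congr φ.map_adj_iff rfl rfl

variable [DecidableEq V]

lemma edgeCount_union_left {S S' : Finset V} (h : Disjoint S S') (T : Finset V) :
    X.edgeCount (S ∪ S') T = X.edgeCount S T + X.edgeCount S' T :=
  Finset.sum_union h

lemma edgeCount_union_right {T T' : Finset V} (h : Disjoint T T') (S : Finset V) :
    X.edgeCount S (T ∪ T') = X.edgeCount S T + X.edgeCount S T' := by
  rw [edgeCount_comm, edgeCount_union_left X h, X.edgeCount_comm T, X.edgeCount_comm T']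

lemma two_le_edgeCount {S T : Finset V} {v v' w w' : V} (hv : v ∈ S) (hv' : v' ∈ S) (hne : v ≠ v')
    (hw : w ∈ T) (hw' : w' ∈ T) (h : X.Adj v w) (h' : X.Adj v' w') :
    2 ≤ X.edgeCount S T := by
  have h₁ : X.edgeCount ({v} ∪ {v'}) T ≤ X.edgeCount S T :=
    X.edgeCount_mono (by simp [Finset.subset_iff, hv, hv']) subset_rfl
  rw [edgeCount_union_left X (by simpa)] at h₁
  have h₂ := X.one_le_edgeCount (Finset.mem_singleton_self v) hw h
  have h₃ := X.one_le_edgeCount (Finset.mem_singleton_self v') hw' h'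
  lia

variable [Fintype V]

/-- The number of edges leaving `S`. -/
def cutSize (S : Finset V) : ℤ := X.edgeCount S Sᶜ

lemma cutSize_nonneg (S : Finset V) : 0 ≤ X.cutSize S := X.edgeCount_nonneg _ _

lemma cutSize_compl (S : Finset V) : X.cutSize Sᶜ = X.cutSize S := by
  rw [cutSize, cutSize, compl_compl, edgeCount_comm]

lemma edgeCount_self_add_cutSize (S : Finset V) :
    X.edgeCount S S + X.cutSize S = X.edgeCount S Finset.univ := by
  rw [cutSize, ← edgeCount_union_right X disjoint_compl_right, Finset.union_compl]

lemma cutSize_union {S T : Finset V} (h : Disjoint S T) :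
    X.cutSize (S ∪ T) = X.cutSize S + X.cutSize T - 2 * X.edgeCount S T := by
  have h₁ := X.edgeCount_self_add_cutSize (S ∪ T)
  have h₂ := X.edgeCount_self_add_cutSize S
  have h₃ := X.edgeCount_self_add_cutSize T
  simp only [edgeCount_union_left X h, edgeCount_union_right X h] at h₁
  rw [X.edgeCount_comm T S] at h₁
  lia

lemma cutSize_singleton (hX : ∀ v, X.degree v = 3) (v : V) : X.cutSize {v} = 3 := by
  have h := X.edgeCount_self_add_cutSize {v}
  rw [edgeCount_univ X hX] at h
  have h₀ : X.edgeCount {v} {v} = 0 := by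
    simp only [edgeCount, Finset.sum_singleton, if_neg (X.loopless.irrefl v)]
  simpa [h₀] using h

/-- Submodularity of the cut function, for `S ∩ T` and the complement of `S ∪ T`. -/
lemma cutSize_inter_add_cutSize_union_compl_le (S T : Finset V) :
    X.cutSize (S ∩ T) + X.cutSize (S ∪ T)ᶜ ≤ X.cutSize S + X.cutSize T := by
  have hS := X.cutSize_union (Finset.disjoint_sdiff_inter S T)
  have hT := X.cutSize_union (Finset.disjoint_sdiff_inter T S)
  rw [Finset.sdiff_union_inter] at hS hT
  have d : Disjoint (S \ T) (T \ S) := disjoint_sdiff_sdiff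
  have d' : Disjoint ((S \ T) ∪ (T \ S)) (S ∩ T) := by
    rw [Finset.disjoint_left]; grind
  have hU := X.cutSize_union d'
  rw [X.cutSize_union d, X.edgeCount_union_left d,
    show ((S \ T) ∪ (T \ S)) ∪ (S ∩ T) = S ∪ T by grind] at hU
  rw [cutSize_compl, hS, hT, hU, Finset.inter_comm T S]
  have := X.edgeCount_nonneg (S \ T) (T \ S)
  lia

/-- Posimodularity of the cut function. -/
lemma cutSize_sdiff_add_cutSize_sdiff_le (S T : Finset V) :
    X.cutSize (S \ T) + X.cutSize (T \ S) ≤ X.cutSize S + X.cutSize T := by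
  have h := X.cutSize_inter_add_cutSize_union_compl_le S Tᶜ
  rwa [X.cutSize_compl T, ← Finset.sdiff_eq_inter_compl,
    Finset.compl_union, compl_compl, Finset.inter_comm Sᶜ, ← Finset.sdiff_eq_inter_compl] at h

lemma cutSize_map (φ : X ≃g X) (S : Finset V) :
    X.cutSize (S.map φ.toEquiv.toEmbedding) = X.cutSize S := by
  have h := X.edgeCount_map φ S Sᶜ
  rw [cutSize, cutSize, ← h]
  congr 1
  ext v
  obtain ⟨w, rfl⟩ := φ.surjective v
  simp

end EdgeCount

section HasCycleIn

variable {V : Type*}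

/-- `f` lists the vertices of a cycle of length `n` of `X` in cyclic order. -/
structure IsCyclicList (X : SimpleGraph V) {n : ℕ} (f : ZMod n → V) : Prop where
  three_le : 3 ≤ n
  injective : Function.Injective f
  adj : ∀ i, X.Adj (f i) (f (i + 1))

/-- The graph `X` has a cycle all of whose vertices lie in `S`. -/
def HasCycleIn (X : SimpleGraph V) (S : Finset V) : Prop :=
  ∃ (n : ℕ) (f : ZMod n → V), X.IsCyclicList f ∧ ∀ i, f i ∈ S

variable {X : SimpleGraph V}

lemma HasCycleIn.mono {S T : Finset V} (h : X.HasCycleIn S) (hST : S ⊆ T) : X.HasCycleIn T := by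
  obtain ⟨n, f, hf, hS⟩ := h
  exact ⟨n, f, hf, fun i => hST (hS i)⟩

lemma Walk.IsCycle.exists_isCyclicList {u : V} {p : X.Walk u u} (hp : p.IsCycle) :
    ∃ f : ZMod p.length → V, X.IsCyclicList f ∧ ∀ i, f i ∈ p.support := by
  have h3 := hp.three_le_length
  have : NeZero p.length := ⟨by lia⟩
  have : Fact (1 < p.length) := ⟨by lia⟩
  refine ⟨fun i => p.getVert i.val, ⟨h3, fun i j hij => ?_, fun i => ?_⟩,
    fun i => p.getVert_mem_support _⟩
  · have hi := i.val_lt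
    have hj := j.val_lt
    exact ZMod.val_injective _ (hp.getVert_injOn' (by simp; lia) (by simp; lia) hij)
  · have hi := i.val_lt
    have h := p.adj_getVert_succ hi
    rcases (show i.val + 1 < p.length ∨ i.val + 1 = p.length by lia) with hlt | heq
    · rwa [ZMod.val_add_of_lt (by rwa [ZMod.val_one]), ZMod.val_one]
    · have h0 : i + 1 = 0 := by
        rw [← ZMod.natCast_zmod_val i, ← Nat.cast_one, ← Nat.cast_add, heq, ZMod.natCast_self]
      rw [heq, p.getVert_length] at h
      simpa [h0] using h

lemma IsCyclicList.exists_isCycle {n : ℕ} {f : ZMod n → V} (hf : X.IsCyclicList f) :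
    ∃ (i : ZMod n) (p : X.Walk (f i) (f i)), p.IsCycle ∧ p.length = n := by
  have h3 := hf.three_le
  obtain ⟨m, hm⟩ : ∃ m, n = m + 3 := ⟨n - 3, by lia⟩
  subst hm
  have hadj : ∀ i j : ZMod (m + 3), (cycleGraph (m + 3)).Adj i j → X.Adj (f i) (f j) := by
    intro i j hij
    rcases cycleGraph_adj.mp hij with h | h
    · have := hf.adj j
      rw [show j + 1 = i from (sub_eq_iff_eq_add'.mp h).symm] at this
      exact this.symm
    · have := hf.adj i
      rwa [show i + 1 = j from (sub_eq_iff_eq_add'.mp h).symm] at this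
  let φ : cycleGraph (m + 3) →g X := ⟨f, fun {i j} h => hadj i j h⟩
  obtain ⟨v, p, hp, hl⟩ := (cycleGraph_isContained_iff (by lia)).mp
    (IsContained.refl (cycleGraph (m + 3)))
  exact ⟨v, p.map φ, hp.map hf.injective, by simpa using hl⟩

/-- A cycle inside `S` survives in a subgraph that has all edges inside `S`. -/
lemma HasCycleIn.exists_isCycle {H : SimpleGraph V} {S : Finset V} (h : X.HasCycleIn S)
    (hH : ∀ v ∈ S, ∀ w ∈ S, X.Adj v w → H.Adj v w) :
    ∃ v ∈ S, ∃ p : H.Walk v v, p.IsCycle := by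
  obtain ⟨n, f, hf, hS⟩ := h
  have hf' : H.IsCyclicList f :=
    ⟨hf.three_le, hf.injective, fun i => hH _ (hS i) _ (hS _) (hf.adj i)⟩
  obtain ⟨i, p, hp, -⟩ := hf'.exists_isCycle
  exact ⟨f i, hS i, p, hp⟩

lemma HasCycleIn.le_card {g : ℕ} (hg : X.egirth = g) {S : Finset V} (h : X.HasCycleIn S) :
    g ≤ S.card := by
  obtain ⟨n, f, hf, hS⟩ := h
  have : NeZero n := ⟨by have := hf.three_le; lia⟩
  obtain ⟨i, p, hp, hl⟩ := hf.exists_isCycle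
  have h₁ := egirth_le_length hp
  rw [hg, hl] at h₁
  have h₂ := Finset.card_le_card_of_injOn (s := Finset.univ) (t := S) f (by simpa using hS)
    hf.injective.injOn
  rw [Finset.card_univ, ZMod.card] at h₂
  exact (Nat.cast_le.mp h₁).trans h₂

lemma edgeCount_self_le_of_not_hasCycleIn [DecidableRel X.Adj] {S : Finset V}
    (h : ¬ X.HasCycleIn S) (hS : S.Nonempty) : X.edgeCount S S ≤ 2 * S.card - 2 := by
  classical
  have hac : (X.induce (S : Set V)).IsAcyclic := by
    intro v p hp
    obtain ⟨f, hf, -⟩ := hp.exists_isCyclicList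
    exact h ⟨_, fun i => f i, ⟨hf.three_le, Subtype.val_injective.comp hf.injective, hf.adj⟩,
      fun i => (f i).2⟩
  have : Nonempty (S : Set V) := hS.to_subtype
  obtain ⟨T, hle, -, hT⟩ := connected_top.exists_isTree_le_of_le_of_isAcyclic le_top hac
  have h₁ := hT.card_edgeFinset
  have h₂ := Finset.card_le_card (edgeFinset_mono hle)
  have h₃ := (X.induce (S : Set V)).sum_degrees_eq_twice_card_edges
  have h₄ : X.edgeCount S S = ((∑ v, (X.induce (S : Set V)).degree v : ℕ) : ℤ) := by
    rw [edgeCount, ← Finset.sum_coe_sort]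
    push_cast
    refine Finset.sum_congr rfl fun v _ => ?_
    rw [← Finset.sum_coe_sort, ← card_neighborFinset_eq_degree, neighborFinset_eq_filter]
    simp
  have h₅ : Fintype.card (S : Set V) = S.card := by simp
  lia

lemma card_add_two_le_cutSize [Fintype V] [DecidableEq V] [DecidableRel X.Adj]
    (hX : ∀ v, X.degree v = 3) {S : Finset V}
    (h : ¬ X.HasCycleIn S) (hS : S.Nonempty) : (S.card : ℤ) + 2 ≤ X.cutSize S := by
  have h₁ := edgeCount_self_le_of_not_hasCycleIn h hS
  have h₂ := X.edgeCount_self_add_cutSize S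
  rw [X.edgeCount_univ hX] at h₂
  lia

lemma HasCycleIn.map (φ : X ≃g X) {S : Finset V} (h : X.HasCycleIn S) :
    X.HasCycleIn (S.map φ.toEquiv.toEmbedding) := by
  obtain ⟨n, f, hf, hS⟩ := h
  exact ⟨n, φ ∘ f, ⟨hf.three_le, φ.injective.comp hf.injective,
    fun i => φ.map_adj_iff.mpr (hf.adj i)⟩, fun i => Finset.mem_map_of_mem _ (hS i)⟩

end HasCycleIn

section Growth

variable {V : Type*} [Fintype V] [DecidableEq V] {X : SimpleGraph V} [DecidableRel X.Adj]

lemma cutSize_union_singleton (hX : ∀ v, X.degree v = 3) {S : Finset V} {w : V} (hw : w ∉ S) :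
    X.cutSize (S ∪ {w}) = X.cutSize S + 3 - 2 * X.edgeCount S {w} := by
  rw [X.cutSize_union (by simpa), X.cutSize_singleton hX]

lemma hasCycleIn_of_cutSize_le (hX : ∀ v, X.degree v = 3) {S : Finset V} (hS : S.Nonempty)
    (h : X.cutSize S ≤ S.card + 1) : X.HasCycleIn S := by
  by_contra hn
  have := card_add_two_le_cutSize hX hn hS
  lia

/-- If more than half of the edges leaving `T` lead to `C`, then so it is for a connected
part `K` of `T`. -/
lemma exists_subset_cutSize_le (hX : ∀ v, X.degree v = 3) (C : Finset V) (T : Finset V)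
    (hT : X.cutSize T < 2 * X.edgeCount T C) :
    ∃ K ⊆ T, K.Nonempty ∧ X.cutSize K < 2 * X.edgeCount K C ∧ X.cutSize K ≤ K.card + 2 := by
  induction T using Finset.strongInduction with
  | H T ih =>
  obtain ⟨v, hv⟩ : T.Nonempty := by
    by_contra hne
    rw [Finset.not_nonempty_iff_eq_empty] at hne
    subst hne
    have := X.cutSize_nonneg ∅
    simp [edgeCount] at hT
    lia
  obtain ⟨K, hK, hmax⟩ := Finset.exists_max_image
    (T.powerset.filter fun K => K.Nonempty ∧ X.cutSize K ≤ K.card + 2) Finset.card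
    ⟨{v}, by simp [hv, X.cutSize_singleton hX]⟩
  simp only [Finset.mem_filter, Finset.mem_powerset] at hK hmax
  obtain ⟨hKT, hKne, hKcut⟩ := hK
  have hdisj : Disjoint K (T \ K) := Finset.disjoint_sdiff
  have hunion : K ∪ (T \ K) = T := Finset.union_sdiff_of_subset hKT
  have hzero : X.edgeCount K (T \ K) = 0 := by
    by_contra hne
    have hpos := lt_of_le_of_ne (X.edgeCount_nonneg _ _) (Ne.symm hne)
    obtain ⟨x, hx, w, hw, hxw⟩ := X.exists_adj_of_edgeCount_pos hpos
    rw [Finset.mem_sdiff] at hw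
    have h₁ := cutSize_union_singleton hX hw.2
    have h₂ := X.one_le_edgeCount hx (Finset.mem_singleton_self w) hxw
    have h₃ : (K ∪ {w}).card = K.card + 1 := by
      rw [Finset.card_union_of_disjoint (by simpa using hw.2), Finset.card_singleton]
    have := hmax (K ∪ {w}) ⟨Finset.union_subset hKT (by simpa using hw.1), by simp, by
      rw [h₃]; push_cast; lia⟩
    lia
  have hcut := X.cutSize_union hdisj
  have hedge := X.edgeCount_union_left hdisj C
  rw [hunion] at hcut hedge
  by_cases hK' : X.cutSize K < 2 * X.edgeCount K C
  · exact ⟨K, hKT, hKne, hK', hKcut⟩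
  · obtain ⟨L, hL, h⟩ := ih (T \ K) (Finset.sdiff_ssubset hKT hKne) (by lia)
    exact ⟨L, hL.trans Finset.sdiff_subset, h⟩

end Growth

section Arc

variable {V : Type*} {X : SimpleGraph V} {n : ℕ} {f : ZMod n → V}

lemma IsCyclicList.natCast_injOn (x : ZMod n) (hf : X.IsCyclicList f) {i j : ℕ} (hi : i < n)
    (hj : j < n) (h : f (x + i) = f (x + j)) : i = j := by
  have h₁ := (ZMod.natCast_eq_natCast_iff' _ _ _).mp (add_left_cancel (hf.injective h))
  rwa [Nat.mod_eq_of_lt hi, Nat.mod_eq_of_lt hj] at h₁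

variable [DecidableEq V]

/-- The `s + 1` consecutive vertices `f x, …, f (x + s)` of a cyclic list. -/
def arc (f : ZMod n → V) (x : ZMod n) (s : ℕ) : Finset V :=
  (Finset.range (s + 1)).image fun j => f (x + (j : ℕ))

lemma arc_zero (x : ZMod n) : arc f x 0 = {f x} := by
  simp [arc]

lemma arc_succ (x : ZMod n) (s : ℕ) : arc f x (s + 1) = arc f x s ∪ {f (x + (s + 1 : ℕ))} := by
  rw [arc, Finset.range_add_one, Finset.image_insert, Finset.insert_eq, Finset.union_comm]
  rfl

lemma mem_arc (x : ZMod n) {s j : ℕ} (hj : j ≤ s) : f (x + (j : ℕ)) ∈ arc f x s :=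
  Finset.mem_image_of_mem _ (by simpa [Nat.lt_succ_iff])

lemma arc_subset (x : ZMod n) (s : ℕ) {C : Finset V} (h : ∀ i, f i ∈ C) : arc f x s ⊆ C := by
  intro v hv
  obtain ⟨j, -, rfl⟩ := Finset.mem_image.mp hv
  exact h _

namespace IsCyclicList

lemma notMem_arc (hf : X.IsCyclicList f) (x : ZMod n) {s : ℕ} (hs : s + 1 < n) :
    f (x + (s + 1 : ℕ)) ∉ arc f x s := by
  intro h
  obtain ⟨j, hj, hij⟩ := Finset.mem_image.mp h
  rw [Finset.mem_range] at hj
  have := hf.natCast_injOn x (by lia) hs hij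
  lia

lemma card_arc (hf : X.IsCyclicList f) (x : ZMod n) {s : ℕ} (hs : s < n) :
    (arc f x s).card = s + 1 := by
  rw [arc, Finset.card_image_of_injOn, Finset.card_range]
  intro i hi j hj hij
  simp only [Finset.coe_range, Set.mem_Iio] at hi hj
  exact hf.natCast_injOn x (by lia) (by lia) hij

lemma one_le_edgeCount_arc [DecidableRel X.Adj] (hf : X.IsCyclicList f) (x : ZMod n) (s : ℕ) :
    1 ≤ X.edgeCount (arc f x s) {f (x + (s + 1 : ℕ))} := by
  refine X.one_le_edgeCount (mem_arc x le_rfl) (Finset.mem_singleton_self _) ?_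
  have := hf.adj (x + s)
  rwa [add_assoc, ← Nat.cast_succ] at this

lemma card_image [NeZero n] (hf : X.IsCyclicList f) : (Finset.univ.image f).card = n := by
  rw [Finset.card_image_of_injective _ hf.injective, Finset.card_univ, ZMod.card]

lemma edgeCount_image_left [DecidableRel X.Adj] [NeZero n] (hf : X.IsCyclicList f) (T : Finset V) :
    X.edgeCount (Finset.univ.image f) T = ∑ i, X.edgeCount {f i} T := by
  rw [edgeCount_eq_sum, Finset.sum_image hf.injective.injOn]

lemma two_le_edgeCount_image [DecidableRel X.Adj] [NeZero n] (hf : X.IsCyclicList f) (i : ZMod n) :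
    2 ≤ X.edgeCount {f i} (Finset.univ.image f) := by
  have h3 := hf.three_le
  rw [edgeCount_comm]
  refine X.two_le_edgeCount (v := f (i + 1)) (v' := f (i - 1)) (by simp) (by simp) ?_
    (Finset.mem_singleton_self _) (Finset.mem_singleton_self _) (hf.adj i).symm
    (by simpa using hf.adj (i - 1))
  intro h
  have := hf.natCast_injOn (i - 1) (i := 0) (j := 2) (by lia) (by lia) (by
    rw [show i - 1 + ((2 : ℕ) : ZMod n) = i + 1 by push_cast; ring, h]; simp)
  lia

variable [Fintype V] [DecidableRel X.Adj]

lemma cutSize_arc_le (hX : ∀ v, X.degree v = 3) (hf : X.IsCyclicList f) (x : ZMod n) {s : ℕ}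
    (hs : s < n) : X.cutSize (arc f x s) ≤ s + 3 := by
  induction s with
  | zero => simp [arc_zero, X.cutSize_singleton hX]
  | succ s ih =>
    have h₁ := hf.one_le_edgeCount_arc x s
    have h₂ := cutSize_union_singleton hX (hf.notMem_arc x hs)
    have h₃ := ih (by lia)
    rw [arc_succ, h₂]
    push_cast at h₁ ⊢
    lia

/-- A chord of a cyclic list yields a shorter one. -/
lemma hasCycleIn_arc_of_adj (hX : ∀ v, X.degree v = 3) (hf : X.IsCyclicList f) (x : ZMod n) {s : ℕ}
    (hs : 1 ≤ s) (hsn : s + 1 < n) (h : X.Adj (f x) (f (x + (s + 1 : ℕ)))) :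
    X.HasCycleIn (arc f x (s + 1)) := by
  have hne : (arc f x (s + 1)).Nonempty := ⟨_, mem_arc x le_rfl⟩
  refine hasCycleIn_of_cutSize_le hX hne ?_
  have h₁ := cutSize_union_singleton hX (hf.notMem_arc x hsn)
  have h₂ := hf.cutSize_arc_le hX x (show s < n by lia)
  have h₃ : 2 ≤ X.edgeCount (arc f x s) {f (x + (s + 1 : ℕ))} := by
    have hlast := hf.adj (x + s)
    rw [add_assoc, ← Nat.cast_succ] at hlast
    have hfirst : f x ∈ arc f x s := by simpa using mem_arc (f := f) x (Nat.zero_le s)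
    refine X.two_le_edgeCount hfirst (mem_arc x le_rfl) ?_ (Finset.mem_singleton_self _)
      (Finset.mem_singleton_self _) h hlast
    intro heq
    have := hf.natCast_injOn x (i := 0) (j := s) (by lia) (by lia) (by simpa using heq)
    lia
  rw [hf.card_arc x hsn, arc_succ, h₁]
  push_cast at h₃ ⊢
  lia

/-- A vertex of a cyclic list has at most one neighbour outside. -/
lemma edgeCount_le_one [NeZero n] (hX : ∀ v, X.degree v = 3) (hf : X.IsCyclicList f) (i : ZMod n)
    {K : Finset V} (hK : Disjoint (Finset.univ.image f) K) : X.edgeCount {f i} K ≤ 1 := by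
  have h₁ := hf.two_le_edgeCount_image i
  have h₂ := X.edgeCount_univ hX {f i}
  have h₃ := X.edgeCount_mono (subset_refl {f i})
    (Finset.subset_univ (Finset.univ.image f ∪ K))
  rw [X.edgeCount_union_right hK] at h₃
  simp at h₂
  lia

/-- A shortest cycle inside a set has no chord. -/
lemma cutSize_image [NeZero n] (hX : ∀ v, X.degree v = 3) (hf : X.IsCyclicList f)
    (hmin : ∀ S ⊆ Finset.univ.image f, X.HasCycleIn S → n ≤ S.card) :
    X.cutSize (Finset.univ.image f) = n := by
  have h3 := hf.three_le
  have hle : ∀ i, X.edgeCount {f i} (Finset.univ.image f) = 2 := by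
    refine fun i => le_antisymm ?_ (hf.two_le_edgeCount_image i)
    rw [edgeCount_singleton]
    have hsub : (Finset.univ.image f).filter (X.Adj (f i)) ⊆ {f (i + 1), f (i - 1)} := by
      intro w hw
      obtain ⟨hw, hadj⟩ := Finset.mem_filter.mp hw
      obtain ⟨j, -, rfl⟩ := Finset.mem_image.mp hw
      obtain ⟨t, rfl⟩ : ∃ t, j = i + t := ⟨j - i, by ring⟩
      have ht := t.val_lt
      have hcast := ZMod.natCast_zmod_val t
      by_cases h0 : t.val = 0
      · rw [h0, Nat.cast_zero] at hcast
        rw [← hcast, add_zero] at hadj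
        exact absurd rfl hadj.ne
      by_cases h1 : t.val = 1
      · rw [h1, Nat.cast_one] at hcast
        simp [← hcast]
      by_cases h2 : t.val + 1 = n
      · have : t + 1 = 0 := by rw [← hcast, ← Nat.cast_succ, Nat.succ_eq_add_one, h2]; simp
        rw [eq_neg_of_add_eq_zero_left this]
        simp [sub_eq_add_neg]
      · obtain ⟨s, hs⟩ : ∃ s, t.val = s + 1 := ⟨t.val - 1, by lia⟩
        rw [← hcast, hs] at hadj
        have hc := hf.hasCycleIn_arc_of_adj hX i (s := s) (by lia) (by lia) hadj
        have := hmin _ (arc_subset i _ fun j => by simp) hc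
        rw [hf.card_arc i (by lia)] at this
        lia
    have := (Finset.card_le_card hsub).trans Finset.card_le_two
    exact_mod_cast this
  have h₁ := X.edgeCount_self_add_cutSize (Finset.univ.image f)
  rw [X.edgeCount_univ hX, hf.card_image, hf.edgeCount_image_left] at h₁
  simp only [hle, Finset.sum_const, Finset.card_univ, ZMod.card] at h₁
  simp at h₁
  lia

end IsCyclicList

/-- A shortest cycle inside a set. -/
lemma HasCycleIn.exists_shortest {X : SimpleGraph V} {A : Finset V} (h : X.HasCycleIn A) :
    ∃ (n : ℕ) (f : ZMod n → V), X.IsCyclicList f ∧ (∀ i, f i ∈ A) ∧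
      ∀ S ⊆ A, X.HasCycleIn S → n ≤ S.card := by
  classical
  have hex : ∃ n, ∃ f : ZMod n → V, X.IsCyclicList f ∧ ∀ i, f i ∈ A := h
  obtain ⟨f, hf, hA⟩ := Nat.find_spec hex
  refine ⟨_, f, hf, hA, fun S hS ⟨m, f', hf', hS'⟩ => ?_⟩
  have : NeZero m := ⟨by have := hf'.three_le; lia⟩
  refine (Nat.find_min' hex ⟨f', hf', fun i => hS (hS' i)⟩).trans ?_
  rw [← hf'.card_image]
  exact Finset.card_le_card (Finset.image_subset_iff.mpr fun i _ => hS' i)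

end Arc

section Bounds

variable {V : Type*} [Fintype V] [DecidableEq V] {X : SimpleGraph V} [DecidableRel X.Adj] {g : ℕ}

/-- A set containing two vertices of a short arc, both with neighbours in the connected set `K`,
cannot be small. -/
lemma IsCyclicList.le_card_add_of_adj {n : ℕ} {f : ZMod n → V} (hX : ∀ v, X.degree v = 3)
    (hg : ∀ S, X.HasCycleIn S → g ≤ S.card) (hf : X.IsCyclicList f) {K : Finset V}
    (hdisj : ∀ i, f i ∉ K) (hK : X.cutSize K ≤ K.card + 2) (x : ZMod n) {s : ℕ} (hs : 1 ≤ s)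
    (hsn : s < n) {v w : V} (hv : v ∈ K) (hw : w ∈ K) (hxv : X.Adj (f x) v)
    (hyw : X.Adj (f (x + s)) w) : g ≤ K.card + s + 1 := by
  have hd : Disjoint (arc f x s) K := by
    rw [Finset.disjoint_left]
    intro z hz
    obtain ⟨j, -, rfl⟩ := Finset.mem_image.mp hz
    exact hdisj _
  have hcard : (arc f x s ∪ K).card = s + 1 + K.card := by
    rw [Finset.card_union_of_disjoint hd, hf.card_arc x hsn]
  have h₁ := X.cutSize_union hd
  have h₂ := hf.cutSize_arc_le hX x hsn
  have hfirst : f x ∈ arc f x s := by simpa using mem_arc (f := f) x (Nat.zero_le s)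
  have h₃ : 2 ≤ X.edgeCount (arc f x s) K := by
    refine X.two_le_edgeCount hfirst (mem_arc x le_rfl) ?_ hv hw hxv hyw
    intro heq
    have := hf.natCast_injOn x (i := 0) (j := s) (by lia) hsn (by simpa using heq)
    lia
  have := hg _ (hasCycleIn_of_cutSize_le hX ⟨v, Finset.mem_union_right _ hv⟩
    (by rw [hcard]; push_cast; lia))
  lia

/-- A connected set `K` attached to many vertices of a cycle is large. -/
lemma IsCyclicList.edgeCount_mul_le {n : ℕ} [NeZero n] {f : ZMod n → V}
    (hX : ∀ v, X.degree v = 3) (hg : ∀ S, X.HasCycleIn S → g ≤ S.card) (hf : X.IsCyclicList f)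
    {K : Finset V} (hdisj : Disjoint (Finset.univ.image f) K) (hK : X.cutSize K ≤ K.card + 2)
    {d : ℕ} (hd : K.card + d < g) (hdn : d ≤ n) :
    X.edgeCount (Finset.univ.image f) K * d ≤ n := by
  have hnot : ∀ i, f i ∉ K := fun i => Finset.disjoint_left.mp hdisj (by simp)
  let M : Finset (ZMod n) := Finset.univ.filter fun i => ∃ v ∈ K, X.Adj (f i) v
  have hM : X.edgeCount (Finset.univ.image f) K ≤ M.card := by
    rw [hf.edgeCount_image_left, Finset.card_filter]
    push_cast
    refine Finset.sum_le_sum fun i _ => ?_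
    split_ifs with h
    · exact hf.edgeCount_le_one hX i hdisj
    · by_contra! hpos
      obtain ⟨v, hv, w, hw, hvw⟩ := X.exists_adj_of_edgeCount_pos hpos
      rw [Finset.mem_singleton.mp hv] at hvw
      exact h ⟨w, hw, hvw⟩
  suffices h : M.card * d ≤ n by
    have := mul_le_mul_of_nonneg_right hM (Nat.cast_nonneg (α := ℤ) d)
    exact this.trans (by exact_mod_cast h)
  have key : ∀ x ∈ M, ∀ y ∈ M, ∀ i j : ℕ, i < d → j < i → x + i ≠ y + j := by
    intro x hx y hy i j hi hj h
    obtain ⟨-, v, hv, hxv⟩ := Finset.mem_filter.mp hx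
    obtain ⟨-, w, hw, hyw⟩ := Finset.mem_filter.mp hy
    have hy : y = x + (i - j : ℕ) := by
      rw [Nat.cast_sub hj.le, ← add_sub_assoc, h, add_sub_cancel_right]
    rw [hy] at hyw
    have := hf.le_card_add_of_adj hX hg hnot hK x (by lia) (by lia) hv hw hxv hyw
    lia
  have hinj : Set.InjOn (fun q : ZMod n × ℕ => q.1 + (q.2 : ZMod n)) (M ×ˢ Finset.range d :) := by
    rintro ⟨x, i⟩ hx ⟨y, j⟩ hy h
    simp only [Finset.coe_product, Set.mem_prod, Finset.mem_coe, Finset.mem_range] at hx hy h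
    rcases lt_trichotomy i j with hij | rfl | hij
    · exact absurd h.symm (key y hy.1 x hx.1 j i hy.2 hij)
    · simpa using h
    · exact absurd h (key x hx.1 y hy.1 i j hx.2 hij)
  have := Finset.card_le_card_of_injOn _ (fun _ _ => Finset.mem_univ _) hinj
  rwa [Finset.card_product, Finset.card_range, Finset.card_univ, ZMod.card] at this

/-- A set of vertices that contains a cycle and whose boundary is smaller than the girth has
almost twice as many vertices as boundary edges. -/
lemma HasCycleIn.two_mul_cutSize_le (hX : ∀ v, X.degree v = 3)
    (hg : ∀ S, X.HasCycleIn S → g ≤ S.card) {A : Finset V} (hA : X.HasCycleIn A)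
    (hcut : X.cutSize A < g) : 2 * X.cutSize A ≤ A.card + 3 := by
  by_contra! hlt
  obtain ⟨n, f, hf, hfA, hmin⟩ := hA.exists_shortest
  have : NeZero n := ⟨by have := hf.three_le; lia⟩
  have hCA : Finset.univ.image f ⊆ A := Finset.image_subset_iff.mpr fun i _ => hfA i
  have hC := hf.cutSize_image hX fun S hS => hmin S (hS.trans hCA)
  have hgn : g ≤ n := by
    rw [← hf.card_image]
    exact hg _ ⟨n, f, hf, fun i => by simp⟩
  have hCcard := hf.card_image
  set C := Finset.univ.image f
  have hdisj : Disjoint C (A \ C) := Finset.disjoint_sdiff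
  have h₁ := X.cutSize_union hdisj
  rw [Finset.union_sdiff_of_subset hCA, X.edgeCount_comm] at h₁
  obtain ⟨K, hKT, hKne, hKC, hKcut⟩ := exists_subset_cutSize_le hX C (A \ C) (by lia)
  have hKcard := Finset.card_le_card hKT
  rw [Finset.card_sdiff_of_subset hCA, hCcard] at hKcard
  have hKpos := hKne.card_pos
  have hKac : ¬ X.HasCycleIn K := fun h => by
    have := hg K h
    lia
  have h₂ := card_add_two_le_cutSize hX hKac hKne
  have h₃ := hf.edgeCount_mul_le hX hg (hdisj.mono_right hKT) hKcut (d := g - 1 - K.card)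
    (by lia) (by lia)
  have hnA := Finset.card_le_card hCA
  have h₄ : ((g - 1 - K.card : ℕ) : ℤ) = g - 1 - K.card := by lia
  rw [h₄, X.edgeCount_comm] at h₃
  have h₅ : (0 : ℤ) ≤ (K.card - 1) * (g - 6 - K.card) := mul_nonneg (by lia) (by lia)
  have h₆ : ((K.card : ℤ) + 3) * (g - 1 - K.card) ≤ 2 * X.edgeCount K C * (g - 1 - K.card) :=
    mul_le_mul_of_nonneg_right (by lia) (by lia)
  have h₇ : (n : ℤ) + K.card ≤ A.card := by lia
  nlinarith

end Bounds

section Atoms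

variable {V : Type*} [Fintype V] [DecidableEq V] {X : SimpleGraph V}

/-- Both `S` and its complement contain a cycle. -/
def SeparatesCycles (X : SimpleGraph V) (S : Finset V) : Prop :=
  X.HasCycleIn S ∧ X.HasCycleIn Sᶜ

lemma SeparatesCycles.compl {S : Finset V} (h : X.SeparatesCycles S) : X.SeparatesCycles Sᶜ :=
  ⟨h.2, by simpa using h.1⟩

lemma SeparatesCycles.map {S : Finset V} (φ : X ≃g X) (h : X.SeparatesCycles S) :
    X.SeparatesCycles (S.map φ.toEquiv.toEmbedding) := by
  refine ⟨h.1.map φ, ?_⟩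
  convert h.2.map φ
  ext v
  obtain ⟨w, rfl⟩ := φ.surjective v
  simp

variable [DecidableRel X.Adj] {g : ℕ}

/-- A cyclic atom: a cycle-separating set of minimum boundary and, subject to that, of minimum
cardinality. -/
structure IsCyclicAtom (X : SimpleGraph V) [DecidableRel X.Adj] (A : Finset V) : Prop where
  separates : X.SeparatesCycles A
  cutSize_le : ∀ S, X.SeparatesCycles S → X.cutSize A ≤ X.cutSize S
  card_le : ∀ S, X.SeparatesCycles S → X.cutSize S ≤ X.cutSize A → A.card ≤ S.card

lemma SeparatesCycles.exists_isCyclicAtom {S : Finset V} (h : X.SeparatesCycles S) :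
    ∃ A, X.IsCyclicAtom A := by
  classical
  obtain ⟨B, hB, hBmin⟩ := Finset.exists_min_image
    (Finset.univ.filter fun S => X.SeparatesCycles S) X.cutSize ⟨S, by simpa using h⟩
  simp only [Finset.mem_filter_univ] at hB hBmin
  obtain ⟨A, hA, hAmin⟩ := Finset.exists_min_image
    (Finset.univ.filter fun S => X.SeparatesCycles S ∧ X.cutSize S ≤ X.cutSize B) Finset.card
    ⟨B, by simpa using hB⟩
  simp only [Finset.mem_filter_univ] at hA hAmin
  exact ⟨A, hA.1, fun S hS => hA.2.trans (hBmin S hS), fun S hS hle =>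
    hAmin S ⟨hS, hle.trans hA.2⟩⟩

lemma IsCyclicAtom.map {A : Finset V} (φ : X ≃g X) (h : X.IsCyclicAtom A) :
    X.IsCyclicAtom (A.map φ.toEquiv.toEmbedding) where
  separates := h.separates.map φ
  cutSize_le S hS := by rw [X.cutSize_map]; exact h.cutSize_le S hS
  card_le S hS hle := by
    rw [X.cutSize_map] at hle
    rw [Finset.card_map]
    exact h.card_le S hS hle

lemma IsCyclicAtom.cutSize_eq {A B : Finset V} (hA : X.IsCyclicAtom A) (hB : X.IsCyclicAtom B) :
    X.cutSize A = X.cutSize B :=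
  le_antisymm (hA.cutSize_le B hB.separates) (hB.cutSize_le A hA.separates)

lemma IsCyclicAtom.card_eq {A B : Finset V} (hA : X.IsCyclicAtom A) (hB : X.IsCyclicAtom B) :
    A.card = B.card :=
  le_antisymm (hA.card_le B hB.separates (hB.cutSize_le A hA.separates))
    (hB.card_le A hA.separates (hA.cutSize_le B hB.separates))

lemma IsCyclicAtom.two_mul_card_le {A : Finset V} (hA : X.IsCyclicAtom A) :
    2 * A.card ≤ Fintype.card V := by
  have h := hA.card_le Aᶜ hA.separates.compl (X.cutSize_compl A).le
  have := A.card_add_card_compl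
  lia

lemma IsCyclicAtom.cutSize_lt {A S : Finset V} (hA : X.IsCyclicAtom A) (hS : X.HasCycleIn S)
    (hSA : S ⊂ A) : X.cutSize A < X.cutSize S := by
  by_contra! h
  have hsep : X.SeparatesCycles S :=
    ⟨hS, hA.separates.2.mono (Finset.compl_subset_compl.mpr hSA.subset)⟩
  exact (Finset.card_lt_card hSA).not_ge (hA.card_le S hsep h)

/-- The parts into which two distinct intersecting atoms divide each other are acyclic. -/
lemma IsCyclicAtom.not_hasCycleIn_sdiff (hX : ∀ v, X.degree v = 3)
    (hg : ∀ S, X.HasCycleIn S → g ≤ S.card) {A B : Finset V} (hA : X.IsCyclicAtom A)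
    (hB : X.IsCyclicAtom B) (hcut : X.cutSize A < g) (hAB : (A ∩ B).Nonempty) :
    ¬ X.HasCycleIn (A \ B) := by
  intro h
  have hlt := hA.cutSize_lt h (sdiff_lt_left.mpr (by
    rwa [Finset.not_disjoint_iff_nonempty_inter, Finset.inter_comm]))
  have hsum := X.cutSize_sdiff_add_cutSize_sdiff_le A B
  have hcuteq := hA.cutSize_eq hB
  have hcard : (A \ B).card = (B \ A).card := Finset.card_sdiff_comm (hA.card_eq hB)
  have hgc := hg _ h
  by_cases h' : X.HasCycleIn (B \ A)
  · have := hB.cutSize_lt h' (sdiff_lt_left.mpr (by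
      rwa [Finset.not_disjoint_iff_nonempty_inter]))
    lia
  · have := card_add_two_le_cutSize hX h' (Finset.card_pos.mp (by
      obtain ⟨n, f, -, hf⟩ := h
      have := Finset.card_pos.mpr ⟨_, hf 0⟩
      lia))
    lia

/-- Distinct cyclic atoms with fewer boundary edges than the girth are disjoint. -/
lemma IsCyclicAtom.eq_of_inter_nonempty (hX : ∀ v, X.degree v = 3)
    (hg : ∀ S, X.HasCycleIn S → g ≤ S.card) {A B : Finset V} (hA : X.IsCyclicAtom A)
    (hB : X.IsCyclicAtom B) (hcut : X.cutSize A < g) (hAB : (A ∩ B).Nonempty) : A = B := by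
  by_contra hne
  have hcuteq := hA.cutSize_eq hB
  have hcardeq := hA.card_eq hB
  have hcompl : (A ∩ B).card ≤ (A ∪ B)ᶜ.card := by
    have h₁ := hA.two_mul_card_le
    have h₂ := Finset.card_union_add_card_inter A B
    have h₃ := (A ∪ B).card_add_card_compl
    lia
  have hpos := hAB.card_pos
  have hcne : (A ∪ B)ᶜ.Nonempty := Finset.card_pos.mp (by lia)
  have hsub := X.cutSize_inter_add_cutSize_union_compl_le A B
  have hsepU : X.HasCycleIn (A ∪ B)ᶜ → X.cutSize A ≤ X.cutSize (A ∪ B)ᶜ := fun h =>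
    hA.cutSize_le _ ⟨h, by simpa using hA.separates.1.mono Finset.subset_union_left⟩
  have hnss : ¬ A ⊆ B := fun h => hne (Finset.eq_of_subset_of_card_le h hcardeq.ge)
  have hss : A ∩ B ⊂ A := inf_lt_left.mpr hnss
  have hinter : ¬ X.HasCycleIn (A ∩ B) := by
    intro h
    have h₁ := hA.cutSize_lt h hss
    have h₂ := hg _ h
    by_cases h' : X.HasCycleIn (A ∪ B)ᶜ
    · have := hsepU h'
      lia
    · have := card_add_two_le_cutSize hX h' hcne
      lia
  have hAdiff := card_add_two_le_cutSize hX (hA.not_hasCycleIn_sdiff hX hg hB hcut hAB)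
    (Finset.sdiff_nonempty.mpr hnss)
  have hBdiff := card_add_two_le_cutSize hX (hB.not_hasCycleIn_sdiff hX hg hA (by lia)
    (by rwa [Finset.inter_comm])) (Finset.sdiff_nonempty.mpr fun h =>
      hne (Finset.eq_of_subset_of_card_le h hcardeq.le).symm)
  have hdiff := X.cutSize_sdiff_add_cutSize_sdiff_le A B
  have hcomm : (A \ B).card = (B \ A).card := Finset.card_sdiff_comm hcardeq
  have hint := card_add_two_le_cutSize hX hinter hAB
  have hsum := Finset.card_sdiff_add_card_inter A B
  have hmain := hA.separates.1.two_mul_cutSize_le hX hg hcut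
  by_cases h' : X.HasCycleIn (A ∪ B)ᶜ
  · have := hsepU h'
    lia
  · have := card_add_two_le_cutSize hX h' hcne
    lia

/-- In a connected cubic vertex-transitive graph, a set separating cycles has at least as many
boundary edges as the girth. -/
lemma SeparatesCycles.le_cutSize (hconn : X.Connected) (hX : ∀ v, X.degree v = 3)
    (hvt : ∀ u v : V, ∃ φ : X ≃g X, φ u = v)
    (hg : ∀ S, X.HasCycleIn S → g ≤ S.card) {S : Finset V} (hS : X.SeparatesCycles S) :
    (g : ℤ) ≤ X.cutSize S := by
  obtain ⟨A, hA⟩ := hS.exists_isCyclicAtom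
  refine le_trans ?_ (hA.cutSize_le S hS)
  by_contra! hcut
  have hgA := hg A hA.separates.1
  have hdeg : ∀ u ∈ A, ∀ v ∈ A, X.edgeCount {u} Aᶜ = X.edgeCount {v} Aᶜ := by
    intro u hu v hv
    obtain ⟨φ, rfl⟩ := hvt u v
    have heq := hA.eq_of_inter_nonempty hX hg (hA.map φ) hcut
      ⟨φ u, Finset.mem_inter.mpr ⟨hv, Finset.mem_map_of_mem _ hu⟩⟩
    have hceq : Aᶜ = Aᶜ.map φ.toEquiv.toEmbedding := by
      ext w
      obtain ⟨z, rfl⟩ := φ.surjective w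
      rw [Finset.mem_compl]
      conv_lhs => rw [heq]
      simp
    conv_rhs => rw [hceq]
    rw [← X.edgeCount_map φ {u}]
    simp
  obtain ⟨n, f, -, hf⟩ := hA.separates.1
  obtain ⟨m, f', -, hf'⟩ := hA.separates.2
  have hsum : X.cutSize A = A.card * X.edgeCount {f 0} Aᶜ := by
    rw [cutSize, edgeCount_eq_sum, Finset.sum_congr rfl fun v hv => hdeg v hv (f 0) (hf 0)]
    simp
  rcases (X.edgeCount_nonneg {f 0} Aᶜ).eq_or_lt with h0 | hpos
  · rw [← h0, mul_zero] at hsum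
    obtain ⟨x, y, hxy, hx, hy⟩ : ∃ x y, X.Adj x y ∧ x ∈ A ∧ y ∉ A := by
      obtain ⟨p⟩ := hconn.preconnected (f 0) (f' 0)
      obtain ⟨d, -, hd⟩ := p.exists_boundary_dart (A : Set V) (hf 0)
        (by simpa using hf' 0)
      exact ⟨_, _, d.adj, hd⟩
    have := X.one_le_edgeCount hx (Finset.mem_compl.mpr hy) hxy
    rw [cutSize] at hsum
    lia
  · nlinarith

end Atoms

section CycleSeparating

variable {V : Type*} [Fintype V] [DecidableEq V] {X : SimpleGraph V} [DecidableRel X.Adj]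

/-- The edges leaving `S`. -/
def cutEdges (X : SimpleGraph V) [DecidableRel X.Adj] (S : Finset V) : Finset (Sym2 V) :=
  ((S ×ˢ Sᶜ).filter fun q => X.Adj q.1 q.2).image fun q => s(q.1, q.2)

lemma mk_mem_cutEdges {S : Finset V} {v w : V} (hv : v ∈ S) (hw : w ∉ S) (h : X.Adj v w) :
    s(v, w) ∈ X.cutEdges S :=
  Finset.mem_image.mpr ⟨(v, w), by simp [hv, hw, h], rfl⟩

lemma mem_cutEdges {S : Finset V} {e : Sym2 V} (he : e ∈ X.cutEdges S) :
    ∃ v w, v ∈ S ∧ w ∉ S ∧ X.Adj v w ∧ e = s(v, w) := by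
  obtain ⟨⟨v, w⟩, h, rfl⟩ := Finset.mem_image.mp he
  simp only [Finset.mem_filter, Finset.mem_product, Finset.mem_compl] at h
  exact ⟨v, w, h.1.1, h.1.2, h.2, rfl⟩

lemma cutEdges_subset_edgeSet (S : Finset V) : (X.cutEdges S : Set (Sym2 V)) ⊆ X.edgeSet := by
  intro e he
  obtain ⟨v, w, -, -, h, rfl⟩ := mem_cutEdges (Finset.mem_coe.mp he)
  exact h

lemma card_cutEdges (S : Finset V) : ((X.cutEdges S).card : ℤ) = X.cutSize S := by
  rw [cutEdges, Finset.card_image_of_injOn, Finset.card_filter, Finset.sum_product, cutSize,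
    edgeCount]
  · push_cast
    rfl
  · rintro ⟨v, w⟩ h ⟨v', w'⟩ h' heq
    simp only [Finset.coe_filter, Finset.mem_product, Finset.mem_compl, Set.mem_ofPred_eq] at h h'
    rcases Sym2.eq_iff.mp heq with ⟨rfl, rfl⟩ | ⟨rfl, rfl⟩
    · rfl
    · exact absurd h.1.1 h'.1.2

lemma SeparatesCycles.cycleSeparating {S : Finset V} (hS : X.SeparatesCycles S) :
    CycleSeparating X (X.cutEdges S : Set (Sym2 V)) := by
  have hinside : ∀ v w, X.Adj v w → (v ∈ S ↔ w ∈ S) →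
      (X.deleteEdges (X.cutEdges S : Set (Sym2 V))).Adj v w := by
    intro v w h hiff
    rw [deleteEdges_adj]
    refine ⟨h, fun hmem => ?_⟩
    obtain ⟨a, b, ha, hb, -, heq⟩ := mem_cutEdges (Finset.mem_coe.mp hmem)
    rcases Sym2.eq_iff.mp heq with ⟨rfl, rfl⟩ | ⟨rfl, rfl⟩ <;> tauto
  obtain ⟨u, hu, p, hp⟩ := hS.1.exists_isCycle fun v hv w hw h => hinside v w h (by tauto)
  obtain ⟨v, hv, q, hq⟩ := hS.2.exists_isCycle fun v hv w hw h => hinside v w h (by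
    rw [Finset.mem_compl] at hv hw; tauto)
  have hnot : ¬ (X.deleteEdges (X.cutEdges S : Set (Sym2 V))).Reachable u v := by
    rintro ⟨r⟩
    obtain ⟨d, -, hd, hd'⟩ := r.exists_boundary_dart (S : Set V) hu (by simpa using hv)
    have := d.adj
    rw [deleteEdges_adj] at this
    exact this.2 (mk_mem_cutEdges hd hd' this.1)
  exact ⟨fun h => hnot (h.preconnected u v), u, v, p, q, hp, hq, hnot⟩

lemma _root_.CycleSeparating.exists_separatesCycles {F : Finset (Sym2 V)}
    (hF : CycleSeparating X (F : Set (Sym2 V))) :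
    ∃ S, X.SeparatesCycles S ∧ X.cutEdges S ⊆ F := by
  classical
  obtain ⟨-, u, v, p, q, hp, hq, huv⟩ := hF
  have hcycle : ∀ {a : V} {r : (X.deleteEdges (F : Set (Sym2 V))).Walk a a}, r.IsCycle →
      ∀ T : Finset V, (∀ w, (X.deleteEdges (F : Set (Sym2 V))).Reachable a w → w ∈ T) →
      X.HasCycleIn T := by
    intro a r hr T hT
    obtain ⟨f, hf, hmem⟩ := hr.exists_isCyclicList
    exact ⟨_, f, ⟨hf.three_le, hf.injective, fun i => deleteEdges_le _ (hf.adj i)⟩,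
      fun i => hT _ (r.takeUntil _ (hmem i)).reachable⟩
  refine ⟨Finset.univ.filter fun w => (X.deleteEdges (F : Set (Sym2 V))).Reachable u w,
    ⟨hcycle hp _ fun w hw => by simpa using hw, hcycle hq _ fun w hw => ?_⟩, fun e he => ?_⟩
  · simpa using fun h : (X.deleteEdges (F : Set (Sym2 V))).Reachable u w => huv (h.trans hw.symm)
  · obtain ⟨a, b, ha, hb, hab, rfl⟩ := mem_cutEdges he
    rw [Finset.mem_filter_univ] at ha hb
    by_contra hmem
    exact hb (ha.trans (Adj.reachable (deleteEdges_adj.mpr ⟨hab, hmem⟩)))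

/-- If the Betti number exceeds the girth, then a shortest cycle is disjoint from another cycle. -/
lemma exists_separatesCycles_cutSize_eq (hX : ∀ v, X.degree v = 3) [Fintype X.edgeSet] {g : ℕ}
    (hg : X.egirth = g) (hbetti : g + Fintype.card V ≤ X.edgeFinset.card) :
    ∃ S, X.SeparatesCycles S ∧ X.cutSize S = g := by
  have hle : ∀ S, X.HasCycleIn S → g ≤ S.card := fun S hS => hS.le_card hg
  have hcyc : ¬ X.IsAcyclic := fun h => by
    rw [egirth_eq_top.mpr h] at hg
    exact ENat.top_ne_natCast _ hg
  obtain ⟨u, p, hp, hlen⟩ := exists_egirth_eq_length.mpr hcyc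
  rw [hg, Nat.cast_inj] at hlen
  obtain ⟨f, hf, -⟩ := hp.exists_isCyclicList
  subst hlen
  have : NeZero p.length := ⟨by have := hf.three_le; lia⟩
  have hcut := hf.cutSize_image hX fun S _ => hle S
  refine ⟨Finset.univ.image f, ⟨⟨_, f, hf, fun i => by simp⟩, ?_⟩, hcut⟩
  have hcard := Finset.card_add_card_compl (Finset.univ.image f)
  rw [hf.card_image] at hcard
  have hsum : ∑ v, X.degree v = 2 * X.edgeFinset.card := by
    convert X.sum_degrees_eq_twice_card_edges
  simp only [hX, Finset.sum_const, Finset.card_univ, smul_eq_mul] at hsum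
  have h3 := hf.three_le
  refine hasCycleIn_of_cutSize_le hX (Finset.card_pos.mp (by lia)) ?_
  rw [X.cutSize_compl, hcut]
  lia

end CycleSeparating

end SimpleGraph

/-- Nedela–Škoviera: in a connected cubic vertex-transitive simple graph of girth `g`,
every cycle-separating edge set has at least `g` edges, and if `g` is strictly smaller
than the Betti number `|E(X)| - |V(X)| + 1` then there is a cycle-separating edge set
with exactly `g` edges. (The condition `g < |E| - |V| + 1` is expressed as
`g + |V| ≤ |E|`.) -/
theorem stmt10 {V : Type*} [Fintype V] (X : SimpleGraph V) [DecidableRel X.Adj]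
    (hconn : X.Connected) (hcubic : ∀ v : V, X.degree v = 3)
    (hvt : ∀ u v : V, ∃ φ : X ≃g X, φ u = v)
    (g : ℕ) (hg : X.egirth = g) :
    (∀ F : Finset (Sym2 V), ↑F ⊆ X.edgeSet → CycleSeparating X ↑F → g ≤ F.card) ∧
      (g + Fintype.card V ≤ X.edgeFinset.card →
        ∃ F : Finset (Sym2 V), ↑F ⊆ X.edgeSet ∧ CycleSeparating X ↑F ∧ F.card = g) := by
  classical
  refine ⟨fun F _ hsep => ?_, fun hbetti => ?_⟩
  · obtain ⟨S, hS, hSF⟩ := hsep.exists_separatesCycles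
    have h₁ := hS.le_cutSize hconn hcubic hvt fun T hT => hT.le_card hg
    rw [← SimpleGraph.card_cutEdges] at h₁
    exact (Nat.cast_le.mp h₁).trans (Finset.card_le_card hSF)
  · obtain ⟨S, hS, hcut⟩ := SimpleGraph.exists_separatesCycles_cutSize_eq hcubic hg hbetti
    refine ⟨X.cutEdges S, SimpleGraph.cutEdges_subset_edgeSet S, hS.cycleSeparating, ?_⟩
    rw [← SimpleGraph.card_cutEdges] at hcut
    exact_mod_cast hcut
end

section
/- Let X be a connected cubic arc-transitive simple graph of girth 5. Then X is isomorphic to the Petersen graph GP(5,2) or to the dodecahedron graph GP(10,2). -/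
/-- A graph is arc-transitive if its automorphism group acts transitively on ordered
pairs of adjacent vertices. -/
def ArcTransitive {V : Type*} (X : SimpleGraph V) : Prop :=
  ∀ ⦃u v u' v' : V⦄, X.Adj u v → X.Adj u' v' → ∃ φ : X ≃g X, φ u = u' ∧ φ v = v'

/-- The generalized Petersen graph `GP(n, k)`: the outer vertices are the `(i, false)`
and the inner vertices are the `(i, true)`, `i ∈ ZMod n`, with edges
`uᵢuᵢ₊₁`, `uᵢvᵢ`, `vᵢvᵢ₊ₖ`. -/
def genPetersen (n k : ℕ) : SimpleGraph (ZMod n × Bool) :=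
  SimpleGraph.fromRel (fun x y =>
    (x.2 = false ∧ y.2 = false ∧ y.1 = x.1 + 1) ∨
    (x.2 = false ∧ y.2 = true ∧ x.1 = y.1) ∨
    (x.2 = true ∧ y.2 = true ∧ y.1 = x.1 + (k : ZMod n)))

/-- The three neighbors of a vertex of `genPetersen n k`. -/
def gpNbr (n k : ℕ) : ZMod n × Bool → Fin 3 → ZMod n × Bool
  | (j, false) => ![(j + 1, false), (j - 1, false), (j, true)]
  | (j, true) => ![(j + k, true), (j - k, true), (j, false)]

theorem genPetersen_adj_iff {n k : ℕ} {a b : ZMod n × Bool} :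
    (genPetersen n k).Adj a b ↔ a ≠ b ∧ ∃ t, gpNbr n k a t = b := by
  obtain ⟨i, _ | _⟩ := a <;> obtain ⟨j, _ | _⟩ := b <;>
    simp [genPetersen, gpNbr, Fin.exists_fin_succ, sub_eq_iff_eq_add] <;> grind

theorem exists_gpNbr_symm {n k : ℕ} {a b : ZMod n × Bool} (h : ∃ t, gpNbr n k a t = b) :
    ∃ t, gpNbr n k b t = a := by
  by_cases hab : a = b
  · rwa [hab] at h ⊢
  · exact (genPetersen_adj_iff.1 (genPetersen_adj_iff.2 ⟨hab, h⟩).symm).2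

/-- The edge from `e` to `h` leaves a pentagon through the path `c`, `d`, `e`, in the graph whose
neighbor function is `g`. -/
def BranchingPentagon {α : Type*} (g : α → Fin 3 → α) (c d e h : α) : Prop :=
  ∃ r, g e r ≠ d ∧ g e r ≠ h ∧ ∃ s, g (g e r) s ≠ d ∧ ∃ t, g (g (g e r) s) t = c

instance {α : Type*} [DecidableEq α] (g : α → Fin 3 → α) (c d e h : α) :
    Decidable (BranchingPentagon g c d e h) := by
  unfold BranchingPentagon; infer_instance

/-- There is a non-backtracking walk of length four from `a` to `b` that starts with
`a`, `c`, `d`. -/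
def FourWalk {α : Type*} (g : α → Fin 3 → α) (a c d b : α) : Prop :=
  a ≠ d ∧ ∃ t, g d t ≠ c ∧ ∃ u, g (g d t) u = b

instance {α : Type*} [DecidableEq α] (g : α → Fin 3 → α) (a c d b : α) :
    Decidable (FourWalk g a c d b) := by
  unfold FourWalk; infer_instance

/-- There is a non-backtracking walk `a`, `c`, `d`, `e`, `h`, `b` which leaves a pentagon through
`c`, `d`, `e` at its fifth vertex `h`. -/
def FiveWalk {α : Type*} (g : α → Fin 3 → α) (a c d b : α) : Prop :=
  a ≠ d ∧ ∃ t, g d t ≠ c ∧ ∃ u, g (g d t) u ≠ d ∧ BranchingPentagon g c d (g d t) (g (g d t) u) ∧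
    ∃ z, g (g (g d t) u) z = b

instance {α : Type*} [DecidableEq α] (g : α → Fin 3 → α) (a c d b : α) :
    Decidable (FiveWalk g a c d b) := by
  unfold FiveWalk; infer_instance

theorem petersen_walks : ∀ a b : ZMod 5 × Bool, a = b ∨ (∃ t, gpNbr 5 2 a t = b) ∨
    ∃ c s t, gpNbr 5 2 c s = a ∧ gpNbr 5 2 c t = b := by decide +kernel

theorem dodecahedron_walks : ∀ a b : ZMod 10 × Bool, a = b ∨ (∃ r, gpNbr 10 2 a r = b) ∨
    (∃ c s t, gpNbr 10 2 c s = a ∧ gpNbr 10 2 c t = b) ∨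
    (∃ r s t, gpNbr 10 2 (gpNbr 10 2 (gpNbr 10 2 a r) s) t = b) ∨
    (∃ r s, FourWalk (gpNbr 10 2) a (gpNbr 10 2 a r) (gpNbr 10 2 (gpNbr 10 2 a r) s) b) ∨
    (∃ r s, FiveWalk (gpNbr 10 2) a (gpNbr 10 2 a r) (gpNbr 10 2 (gpNbr 10 2 a r) s) b) := by
  decide +kernel

/-- Adjacency conditions expressing that a graph is cubic without triangles and 4-cycles. -/
structure CubicGirthFive {V : Type*} (X : SimpleGraph V) : Prop where
  exists_third : ∀ {v a b : V}, X.Adj v a → X.Adj v b → a ≠ b →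
    ∃ c, X.Adj v c ∧ c ≠ a ∧ c ≠ b ∧ ∀ d, X.Adj v d → d = a ∨ d = b ∨ d = c
  exists_two : ∀ {v a : V}, X.Adj v a → ∃ b c, X.Adj v b ∧ X.Adj v c ∧ a ≠ b ∧ a ≠ c ∧ b ≠ c
  no_triangle : ∀ {a b c : V}, X.Adj a b → X.Adj b c → ¬ X.Adj c a
  no_square : ∀ {a b c d : V}, X.Adj a b → X.Adj b c → X.Adj c d → X.Adj d a → a ≠ c → b = d

/-- The pairs that complete the path `a`, `v`, `b` to a pentagon. -/
def pentagons {V : Type*} (X : SimpleGraph V) (a v b : V) : Set (V × V) :=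
  {z | X.Adj a z.1 ∧ X.Adj z.1 z.2 ∧ X.Adj z.2 b ∧ z.1 ≠ v ∧ z.2 ≠ v}

/-- A local isomorphism from `genPetersen n k` to a cubic graph. -/
structure LocalCovering {V : Type*} (X : SimpleGraph V) (n k : ℕ) (f : ZMod n × Bool → V) :
    Prop where
  adj : ∀ a t, X.Adj (f a) (f (gpNbr n k a t))
  injective : ∀ a, Function.Injective fun t => f (gpNbr n k a t)

section

variable {V : Type*} {X : SimpleGraph V}

theorem exists_three_neighbors (hcubic : ∀ v : V, Nat.card (X.neighborSet v) = 3) (v : V) :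
    ∃ a b c, a ≠ b ∧ a ≠ c ∧ b ≠ c ∧ ∀ d, X.Adj v d ↔ d = a ∨ d = b ∨ d = c := by
  have h := hcubic v
  rw [Nat.card_coe_set_eq, Set.ncard_eq_three] at h
  obtain ⟨a, b, c, hab, hac, hbc, h⟩ := h
  refine ⟨a, b, c, hab, hac, hbc, fun d => ?_⟩
  rw [← SimpleGraph.mem_neighborSet, h]
  simp

theorem cubicGirthFive (hcubic : ∀ v : V, Nat.card (X.neighborSet v) = 3)
    (hg : X.egirth = 5) : CubicGirthFive X := by
  have hlen := SimpleGraph.le_egirth.1 hg.ge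
  refine ⟨fun {v a b} ha hb hab => ?_, fun {v a} ha => ?_, fun {a b c} h₁ h₂ h₃ => ?_,
    fun {a b c d} h₁ h₂ h₃ h₄ hac => ?_⟩
  · obtain ⟨x, y, z, hxy, hxz, hyz, h⟩ := exists_three_neighbors hcubic v
    have hx := h x
    have hy := h y
    have hz := h z
    grind
  · obtain ⟨x, y, z, hxy, hxz, hyz, h⟩ := exists_three_neighbors hcubic v
    have hx := h x
    have hy := h y
    have hz := h z
    grind
  · have h := hlen a (.cons h₁ (.cons h₂ (.cons h₃ .nil))) (by
      have := h₁.ne; have := h₂.ne; have := h₃.ne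
      simp [SimpleGraph.Walk.cons_isCycle_iff]
      grind)
    norm_num at h
  · by_contra hbd
    have h := hlen a (.cons h₁ (.cons h₂ (.cons h₃ (.cons h₄ .nil)))) (by
      have := h₁.ne; have := h₂.ne; have := h₃.ne; have := h₄.ne
      simp [SimpleGraph.Walk.cons_isCycle_iff]
      grind)
    norm_num at h

theorem exists_pentagon (hg : X.egirth = 5) :
    ∃ u : ZMod 5 → V, (∀ i, X.Adj (u i) (u (i + 1))) ∧ ∀ i, u i ≠ u (i + 2) := by
  have hcyc : ¬ X.IsAcyclic := by
    rw [← SimpleGraph.egirth_eq_top, hg]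
    decide
  obtain ⟨a, w, hw, hl'⟩ := SimpleGraph.exists_egirth_eq_length.2 hcyc
  have hl : w.length = 5 := by
    rw [hg] at hl'
    exact_mod_cast hl'.symm
  clear hl'
  obtain _ | ⟨h₁, w⟩ := w
  · simp at hl
  obtain _ | ⟨h₂, w⟩ := w
  · simp at hl
  obtain _ | ⟨h₃, w⟩ := w
  · simp at hl
  obtain _ | ⟨h₄, w⟩ := w
  · simp at hl
  obtain _ | ⟨h₅, w⟩ := w
  · simp at hl
  obtain _ | ⟨h₆, w⟩ := w
  swap
  · simp at hl
  rename_i b c d e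
  have hn := hw.support_nodup
  simp at hn
  refine ⟨![a, b, c, d, e], fun i => ?_, fun i => ?_⟩
  · fin_cases i
    exacts [h₁, h₂, h₃, h₄, h₅]
  · fin_cases i
    · change a ≠ c; grind
    · change b ≠ d; grind
    · change c ≠ e; grind
    · change d ≠ a; grind
    · change e ≠ b; grind

theorem ncard_pentagons_swap (a v b : V) :
    (pentagons X a v b).ncard = (pentagons X b v a).ncard := by
  rw [← Set.ncard_image_of_injective _ Prod.swap_injective]
  congr 1
  ext ⟨p, q⟩
  simp only [pentagons, Set.mem_image, Set.mem_ofPred_eq, Prod.exists, Prod.swap_prod_mk,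
    Prod.mk.injEq]
  constructor
  · rintro ⟨q, p, h, rfl, rfl⟩
    exact ⟨h.2.2.1.symm, h.2.1.symm, h.1.symm, h.2.2.2.2, h.2.2.2.1⟩
  · rintro h
    exact ⟨q, p, ⟨h.2.2.1.symm, h.2.1.symm, h.1.symm, h.2.2.2.2, h.2.2.2.1⟩, rfl, rfl⟩

theorem ncard_pentagons_map (φ : X ≃g X) (a v b : V) :
    (pentagons X (φ a) (φ v) (φ b)).ncard = (pentagons X a v b).ncard := by
  rw [← Set.ncard_image_of_injective (pentagons X a v b)
    (φ.injective.prodMap φ.injective)]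
  congr 1
  ext ⟨p, q⟩
  obtain ⟨p, rfl⟩ := φ.surjective p
  obtain ⟨q, rfl⟩ := φ.surjective q
  simp [pentagons, φ.map_adj_iff]

namespace CubicGirthFive

variable (hX : CubicGirthFive X)
include hX

theorem eq_of_adj {v a b c d : V} (ha : X.Adj v a) (hb : X.Adj v b) (hc : X.Adj v c)
    (hab : a ≠ b) (hac : a ≠ c) (hbc : b ≠ c) (hd : X.Adj v d) : d = a ∨ d = b ∨ d = c := by
  obtain ⟨e, he, hea, heb, h⟩ := hX.exists_third ha hb hab
  grind

theorem ncard_pentagons_add (hat : ArcTransitive X) {v a b c v' a' b' c' : V}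
    (ha : X.Adj v a) (hb : X.Adj v b) (hc : X.Adj v c) (hab : a ≠ b) (hac : a ≠ c) (hbc : b ≠ c)
    (ha' : X.Adj v' a') (hb' : X.Adj v' b') (hc' : X.Adj v' c') (hab' : a' ≠ b') (hac' : a' ≠ c')
    (hbc' : b' ≠ c') :
    (pentagons X a v b).ncard + (pentagons X a v c).ncard =
      (pentagons X a' v' b').ncard + (pentagons X a' v' c').ncard := by
  obtain ⟨φ, rfl, rfl⟩ := hat ha ha'
  have hφb := hX.eq_of_adj ha' hb' hc' hab' hac' hbc' (φ.map_adj_iff.2 hb)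
  have hφc := hX.eq_of_adj ha' hb' hc' hab' hac' hbc' (φ.map_adj_iff.2 hc)
  have hba := φ.injective.ne hab
  have hca := φ.injective.ne hac
  have hcb := φ.injective.ne hbc
  rw [← ncard_pentagons_map φ a v b, ← ncard_pentagons_map φ a v c]
  rcases hφb with h | h | h
  · exact absurd h.symm hba
  · rcases hφc with h' | h' | h'
    · exact absurd h'.symm hca
    · exact absurd (h.trans h'.symm) hcb
    · rw [h, h']
  · rcases hφc with h' | h' | h'
    · exact absurd h'.symm hca
    · rw [h, h', add_comm]
    · exact absurd (h.trans h'.symm) hcb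

theorem ncard_pentagons_eq (hat : ArcTransitive X) {v a b v' a' b' : V}
    (ha : X.Adj v a) (hb : X.Adj v b) (hab : a ≠ b)
    (ha' : X.Adj v' a') (hb' : X.Adj v' b') (hab' : a' ≠ b') :
    (pentagons X a v b).ncard = (pentagons X a' v' b').ncard := by
  obtain ⟨c, hc, hca, hcb, -⟩ := hX.exists_third ha hb hab
  obtain ⟨c', hc', hca', hcb', -⟩ := hX.exists_third ha' hb' hab'
  have h₁ := hX.ncard_pentagons_add hat ha hb hc hab hca.symm hcb.symm
    ha' hb' hc' hab' hca'.symm hcb'.symm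
  have h₂ := hX.ncard_pentagons_add hat hb ha hc hab.symm hcb.symm hca.symm
    hb' ha' hc' hab'.symm hcb'.symm hca'.symm
  have h₃ := hX.ncard_pentagons_add hat hc ha hb hca hcb hab
    hc' ha' hb' hca' hcb' hab'
  have h₄ := hX.ncard_pentagons_add hat ha hb hc hab hca.symm hcb.symm
    hb ha hc hab.symm hcb.symm hca.symm
  have h₅ := hX.ncard_pentagons_add hat ha hb hc hab hca.symm hcb.symm
    hc ha hb hca hcb hab
  rw [ncard_pentagons_swap b v a, ncard_pentagons_swap b' v' a'] at h₂
  rw [ncard_pentagons_swap c v a, ncard_pentagons_swap c v b, ncard_pentagons_swap c' v' a',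
    ncard_pentagons_swap c' v' b'] at h₃
  rw [ncard_pentagons_swap b v a] at h₄
  rw [ncard_pentagons_swap c v a, ncard_pentagons_swap c v b] at h₅
  omega

theorem finite_pentagons {a v b : V} : (pentagons X a v b).Finite := by
  have hfin : ∀ v, (X.neighborSet v).Finite := fun v => by
    by_cases h : ∃ a, X.Adj v a
    · obtain ⟨a, ha⟩ := h
      obtain ⟨b, c, hb, hc, hab, hac, hbc⟩ := hX.exists_two ha
      exact (Set.toFinite {a, b, c}).subset fun d hd => hX.eq_of_adj ha hb hc hab hac hbc hd
    · exact Set.Finite.subset Set.finite_empty fun d hd => h ⟨d, hd⟩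
  exact ((hfin a).prod (hfin b)).subset fun z hz => ⟨hz.1, hz.2.2.1.symm⟩

theorem surjective_of_localCovering (hconn : X.Connected) {n k : ℕ} {f : ZMod n × Bool → V}
    (hf : LocalCovering X n k f) : Function.Surjective f := by
  intro v
  have h := (SimpleGraph.reachable_iff_reflTransGen _ _).1 (hconn.preconnected (f (0, false)) v)
  induction h with
  | refl => exact ⟨_, rfl⟩
  | tail _ h ih =>
    obtain ⟨a, rfl⟩ := ih
    have hne := fun s t => (hf.injective a).ne (a₁ := s) (a₂ := t)
    rcases hX.eq_of_adj (hf.adj a 0) (hf.adj a 1) (hf.adj a 2) (hne 0 1 (by decide))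
      (hne 0 2 (by decide)) (hne 1 2 (by decide)) h with h | h | h <;> exact ⟨_, h.symm⟩

theorem nonempty_iso (hconn : X.Connected) {n k : ℕ} {f : ZMod n × Bool → V}
    (hf : LocalCovering X n k f) (hinj : Function.Injective f) :
    Nonempty (X ≃g genPetersen n k) := by
  refine ⟨SimpleGraph.Iso.symm
    ⟨Equiv.ofBijective f ⟨hinj, hX.surjective_of_localCovering hconn hf⟩, fun {a b} => ?_⟩⟩
  rw [genPetersen_adj_iff]
  constructor
  · intro h
    refine ⟨fun hab => h.ne (congrArg f hab), ?_⟩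
    have hne := fun s t => (hf.injective a).ne (a₁ := s) (a₂ := t)
    rcases hX.eq_of_adj (hf.adj a 0) (hf.adj a 1) (hf.adj a 2) (hne 0 1 (by decide))
      (hne 0 2 (by decide)) (hne 1 2 (by decide)) h with h | h | h <;>
      exact ⟨_, (hinj h).symm⟩
  · rintro ⟨-, t, rfl⟩
    exact hf.adj a t

end CubicGirthFive

namespace LocalCovering

theorem of_rims {n k : ℕ} {o r : ZMod n → V} (ho : ∀ j, X.Adj (o j) (o (j + 1)))
    (hs : ∀ j, X.Adj (o j) (r j)) (hr : ∀ j, X.Adj (r j) (r (j + k)))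
    (hoo : ∀ j, o (j - 1) ≠ o (j + 1)) (hrr : ∀ j, r (j - k) ≠ r (j + k))
    (hor : ∀ j, o (j + 1) ≠ r j) (hor' : ∀ j, o (j - 1) ≠ r j)
    (hro : ∀ j, r (j + k) ≠ o j) (hro' : ∀ j, r (j - k) ≠ o j) :
    LocalCovering X n k fun z => if z.2 then r z.1 else o z.1 := by
  have ho' : ∀ j, X.Adj (o j) (o (j - 1)) := fun j => by
    simpa using (ho (j - 1)).symm
  have hr' : ∀ j, X.Adj (r j) (r (j - k)) := fun j => by
    simpa using (hr (j - k)).symm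
  constructor
  · rintro ⟨j, _ | _⟩ t <;> fin_cases t
    · exact ho j
    · exact ho' j
    · exact hs j
    · exact hr j
    · exact hr' j
    · exact (hs j).symm
  · rintro ⟨j, _ | _⟩ s t h <;> fin_cases s <;> fin_cases t <;> simp [gpNbr] at h ⊢
    all_goals grind

variable {n k : ℕ} {f : ZMod n × Bool → V} (hf : LocalCovering X n k f)
include hf

theorem eq_of_adj {a b c : ZMod n × Bool} (hb : ∃ t, gpNbr n k a t = b)
    (hc : ∃ t, gpNbr n k a t = c) (h : f b = f c) : b = c := by
  obtain ⟨s, rfl⟩ := hb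
  obtain ⟨t, rfl⟩ := hc
  rw [hf.injective a h]

theorem adj_of_exists {a b : ZMod n × Bool} (h : ∃ t, gpNbr n k a t = b) : X.Adj (f a) (f b) := by
  obtain ⟨t, rfl⟩ := h
  exact hf.adj a t

theorem ne {a b c : ZMod n × Bool} (hac : a ≠ c) (hab : ∃ t, gpNbr n k a t = b)
    (hbc : ∃ t, gpNbr n k b t = c) : f a ≠ f c :=
  fun h => hac (hf.eq_of_adj (exists_gpNbr_symm hab) hbc h)

end LocalCovering

theorem CubicGirthFive.exists_adj_of_one_lt_ncard (hX : CubicGirthFive X) {a v b p : V}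
    (hav : X.Adj a v) (hvb : X.Adj v b) (h : 1 < (pentagons X a v b).ncard)
    (hp : X.Adj a p) (hpv : p ≠ v) :
    ∃ q, X.Adj p q ∧ X.Adj b q ∧ q ≠ v := by
  rw [Set.one_lt_ncard_iff hX.finite_pentagons] at h
  obtain ⟨⟨p₁, q₁⟩, ⟨p₂, q₂⟩, ⟨h₁, h₁', h₁'', hp₁, hq₁⟩, ⟨h₂, h₂', h₂'', hp₂, hq₂⟩, hne⟩ := h
  dsimp only at *
  have hpp : p₁ ≠ p₂ := by
    rintro rfl
    by_cases hpb : p₁ = b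
    · exact hX.no_triangle hav hvb (hpb ▸ h₁.symm)
    · exact hne (by rw [hX.no_square h₁' h₁'' h₂''.symm h₂'.symm hpb])
  rcases hX.eq_of_adj hav h₁ h₂ hp₁.symm hp₂.symm hpp hp with rfl | rfl | rfl
  · exact absurd rfl hpv
  · exact ⟨q₁, h₁', h₁''.symm, hq₁⟩
  · exact ⟨q₂, h₂', h₂''.symm, hq₂⟩

theorem CubicGirthFive.exists_spokes (hX : CubicGirthFive X) {u : ZMod 5 → V}
    (hu : ∀ i, X.Adj (u i) (u (i + 1))) (hu₂ : ∀ i, u i ≠ u (i + 2)) :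
    ∃ w : ZMod 5 → V, ∀ i, X.Adj (u i) (w i) ∧ w i ≠ u (i + 1) ∧ w i ≠ u (i + 4) ∧
      ∀ d, X.Adj (u i) d → d = u (i + 1) ∨ d = u (i + 4) ∨ d = w i := by
  have hu' : ∀ i, X.Adj (u i) (u (i + 4)) := fun i => by
    have h := (hu (i + 4)).symm
    rwa [add_assoc, show (4 + 1 : ZMod 5) = 0 by decide, add_zero] at h
  have hne : ∀ i, u (i + 1) ≠ u (i + 4) := fun i h => by
    have := hu₂ (i + 4)
    rw [add_assoc, show (4 + 2 : ZMod 5) = 1 by decide] at this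
    exact this h.symm
  exact ⟨_, fun i => Classical.choose_spec (hX.exists_third (hu i) (hu' i) (hne i))⟩

theorem nonempty_iso_petersen (hX : CubicGirthFive X) (hconn : X.Connected)
    (hP : ∀ {v a b : V}, X.Adj v a → X.Adj v b → a ≠ b → 1 < (pentagons X a v b).ncard)
    {u : ZMod 5 → V} (hu : ∀ i, X.Adj (u i) (u (i + 1))) (hu₂ : ∀ i, u i ≠ u (i + 2)) :
    Nonempty (X ≃g genPetersen 5 2) := by
  obtain ⟨w, hw⟩ := hX.exists_spokes hu hu₂
  have hww : ∀ i, X.Adj (w i) (w (i + 2)) := fun i => by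
    have h₁ := hu i
    have h₂ := hu (i + 1)
    have h₃ := hu (i + 2)
    have h₄ := hu (i + 3)
    have h₅ := hu (i + 4)
    have hn := hu₂ i
    have hn' := hu₂ (i + 1)
    have hn'' := hu₂ (i + 3)
    have hwi := hw i
    have hwi₂ := hw (i + 2)
    simp only [add_assoc, show (1 + 1 : ZMod 5) = 2 by decide, show (2 + 1 : ZMod 5) = 3 by decide,
      show (3 + 1 : ZMod 5) = 4 by decide, show (4 + 1 : ZMod 5) = 0 by decide,
      show (1 + 2 : ZMod 5) = 3 by decide, show (3 + 2 : ZMod 5) = 0 by decide,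
      show (2 + 4 : ZMod 5) = 1 by decide, add_zero] at *
    obtain ⟨q, hq, hq', hq''⟩ :=
      hX.exists_adj_of_one_lt_ncard h₁ h₂ (hP h₁.symm h₂ hn) hwi.1 hwi.2.1
    rcases hwi₂.2.2.2 q hq' with rfl | rfl | rfl
    · exact absurd (hX.no_square hq h₄ h₅ hwi.1 hwi.2.2.1) hn''
    · exact absurd rfl hq''
    · exact hq
  have hw' := fun i => (hw i).1
  have e₁ : ∀ j : ZMod 5, j - 1 = j + 4 := by decide
  have e₂ : ∀ j : ZMod 5, j - (2 : ℕ) = j + 3 := by decide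
  have hf := LocalCovering.of_rims hu hw' hww
    (fun j h => hu₂ (j - 1) (by rw [h]; congr 1; ring))
    (fun j h => by
      rw [e₂] at h
      refine hX.no_triangle (hu (j + 2)) (?_ : X.Adj _ (w (j + 2))) (hw' (j + 2)).symm
      rw [add_assoc, show (2 + 1 : ZMod 5) = 3 by decide]
      exact h ▸ hw' (j + 3))
    (fun j h => (hw j).2.1 h.symm) (fun j h => (hw j).2.2.1 (by rw [← h, e₁]))
    (fun j h => by
      have h₁ := hu (j + 1)
      rw [add_assoc, show (1 + 1 : ZMod 5) = 2 by decide] at h₁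
      exact hX.no_triangle (hu j) h₁ (h ▸ hw' (j + 2)))
    (fun j h => by
      rw [e₂] at h
      have h₁ := hu (j + 3)
      have h₂ := hu (j + 4)
      simp only [add_assoc, show (3 + 1 : ZMod 5) = 4 by decide,
        show (4 + 1 : ZMod 5) = 0 by decide, add_zero] at h₁ h₂
      exact hX.no_triangle h₁ h₂ (h ▸ (hw' (j + 3)).symm))
  refine hX.nonempty_iso hconn hf fun a b hab => ?_
  rcases petersen_walks a b with h | h | ⟨c, s, t, hca, hcb⟩
  · exact h
  · exact absurd hab (hf.adj_of_exists h).ne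
  · exact hf.eq_of_adj ⟨s, hca⟩ ⟨t, hcb⟩ hab

theorem eq_of_subsingleton_pentagons {a v b p q p' q' : V} (hU : (pentagons X a v b).Subsingleton)
    (h : X.Adj a p ∧ X.Adj p q ∧ X.Adj q b ∧ p ≠ v ∧ q ≠ v)
    (h' : X.Adj a p' ∧ X.Adj p' q' ∧ X.Adj q' b ∧ p' ≠ v ∧ q' ≠ v) : p = p' ∧ q = q' :=
  Prod.ext_iff.1 (hU (show (p, q) ∈ pentagons X a v b from h)
    (show (p', q') ∈ pentagons X a v b from h'))

theorem LocalCovering.injective_dodecahedron (hX : CubicGirthFive X) {f : ZMod 10 × Bool → V}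
    (hf : LocalCovering X 10 2 f) (hU : ∀ {v a b : V}, X.Adj v a → X.Adj v b → a ≠ b →
      (pentagons X a v b).Subsingleton) : Function.Injective f := by
  intro a b hab
  have hadj := hf.adj
  rcases dodecahedron_walks a b with h | h | ⟨c, s, t, hca, hcb⟩ | ⟨r, s, t, rfl⟩ |
    ⟨r, s, had, t, hce, u, rfl⟩ |
    ⟨r, s, had, t, hce, u, hdh, ⟨u', hpd, hph, v, hqd, v', hqc⟩, z, rfl⟩
  · exact h
  · exact absurd hab (hf.adj_of_exists h).ne
  · exact hf.eq_of_adj ⟨s, hca⟩ ⟨t, hcb⟩ hab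
  · exact absurd (hab ▸ hadj _ t) (hX.no_triangle (hadj a r) (hadj _ s))
  · exact absurd (hX.no_square (hadj a r) (hadj _ s) (hadj _ t) (hab ▸ hadj _ u)
      (hf.ne had ⟨r, rfl⟩ ⟨s, rfl⟩)) (hf.ne hce.symm ⟨s, rfl⟩ ⟨t, rfl⟩)
  · have h := eq_of_subsingleton_pentagons
      (hU (hadj _ s).symm (hadj _ t) (hf.ne hce.symm ⟨s, rfl⟩ ⟨t, rfl⟩))
      ⟨(hadj a r).symm, hab ▸ (hadj _ z).symm, (hadj _ u).symm,
        hf.ne had ⟨r, rfl⟩ ⟨s, rfl⟩,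
        hf.ne hdh (exists_gpNbr_symm ⟨u, rfl⟩) (exists_gpNbr_symm ⟨t, rfl⟩)⟩
      ⟨(hqc ▸ hadj _ v').symm, (hadj _ v).symm, (hadj _ u').symm,
        hf.ne hqd ⟨v', hqc⟩ ⟨s, rfl⟩,
        hf.ne hpd (exists_gpNbr_symm ⟨u', rfl⟩) (exists_gpNbr_symm ⟨t, rfl⟩)⟩
    exact absurd (hf.eq_of_adj ⟨u', rfl⟩ ⟨u, rfl⟩ h.2.symm) hph

theorem exists_localCovering_dodecahedron (hX : CubicGirthFive X)
    (hE : ∀ {v a b : V}, X.Adj v a → X.Adj v b → a ≠ b → (pentagons X a v b).Nonempty)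
    (hU : ∀ {v a b : V}, X.Adj v a → X.Adj v b → a ≠ b → (pentagons X a v b).Subsingleton)
    {u : ZMod 5 → V} (hu : ∀ i, X.Adj (u i) (u (i + 1))) (hu₂ : ∀ i, u i ≠ u (i + 2)) :
    ∃ f, LocalCovering X 10 2 f := by
  have hpair : ∀ {v a b p q p' q' : V}, X.Adj v a → X.Adj v b → a ≠ b →
      (X.Adj a p ∧ X.Adj p q ∧ X.Adj q b ∧ p ≠ v ∧ q ≠ v) →
      (X.Adj a p' ∧ X.Adj p' q' ∧ X.Adj q' b ∧ p' ≠ v ∧ q' ≠ v) → p = p' ∧ q = q' :=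
    fun ha hb hab => eq_of_subsingleton_pentagons (hU ha hb hab)
  obtain ⟨w, hw⟩ := hX.exists_spokes hu hu₂
  have huw := fun i => (hw i).1
  have hwu := fun i => (hw i).2.1
  have e₀ : ∀ i : ZMod 5, i + 1 + 4 = i := by decide
  have hwu' : ∀ i, w (i + 1) ≠ u i := fun i h => (hw (i + 1)).2.2.1 (by rw [h, e₀])
  have huu : ∀ i, u i ≠ u (i + 1 + 1) := fun i h => hu₂ i (by rw [h]; congr 1; ring)
  have hun : ∀ i d, X.Adj (u (i + 1)) d → d = u (i + 1 + 1) ∨ d = u i ∨ d = w (i + 1) :=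
    fun i d h => by
      have := (hw (i + 1)).2.2.2 d h
      rwa [e₀] at this
  have hww : ∀ i, w i ≠ w (i + 1) := fun i h =>
    hX.no_triangle (hu i) (huw (i + 1)) (h ▸ (huw i).symm)
  have hx : ∀ i, ∃ x, X.Adj (w i) x ∧ X.Adj x (w (i + 1)) ∧ x ≠ u i ∧ x ≠ u (i + 1) := fun i => by
    obtain ⟨⟨p, q⟩, hp, hpq, hq, hpu, hqu⟩ := hE (huw i) (hu i) (hwu i)
    dsimp only at *
    rcases hun i q hq.symm with rfl | rfl | rfl
    · have h₂ := hu (i + 1 + 1)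
      have h₃ := hu (i + 3)
      have h₄ := hu (i + 4)
      have hne := hu₂ (i + 1)
      have hne' := hu₂ (i + 4)
      simp only [add_assoc, show (1 + 1 : ZMod 5) = 2 by decide,
        show (2 + 1 : ZMod 5) = 3 by decide, show (3 + 1 : ZMod 5) = 4 by decide,
        show (4 + 1 : ZMod 5) = 0 by decide, show (1 + 2 : ZMod 5) = 3 by decide,
        show (4 + 2 : ZMod 5) = 1 by decide, add_zero] at h₂ h₃ h₄ hne hne' hq
      have hui : X.Adj (u (i + 1)) (u (i + 2)) := by
        simpa only [add_assoc, show (1 + 1 : ZMod 5) = 2 by decide] using hu (i + 1)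
      exact absurd (hpair (hu i).symm hui (hu₂ i)
        ⟨huw i, hp, by simpa only [add_assoc, show (1 + 1 : ZMod 5) = 2 by decide] using hpq,
          hwu i, fun h => hX.no_triangle (hu i) (h ▸ hp.symm) (huw i).symm⟩
        ⟨h₄.symm, h₃.symm, h₂.symm, hne', hne.symm⟩).1 (hw i).2.2.1
    · exact absurd rfl hqu
    · exact ⟨p, hp, hpq, hpu, fun h => hX.no_triangle (hu i) (h ▸ hp.symm) (huw i).symm⟩
  choose x hwx hxw hxu hxu' using hx
  have hxx : ∀ i, x i ≠ x (i + 1) := fun i h =>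
    huu i (hpair (huw (i + 1)).symm (hxw i).symm (hxu' i).symm
      ⟨(hu i).symm, huw i, hwx i, (hwu' i).symm, hww i⟩
      ⟨hu (i + 1), huw (i + 1 + 1), h ▸ (hxw (i + 1)).symm, (hwu (i + 1)).symm,
        (hww (i + 1)).symm⟩).1
  have hxx' : ∀ i, ¬ X.Adj (x i) (x (i + 1)) := fun i h =>
    hX.no_triangle (hxw i) (hwx (i + 1)) h.symm
  choose y hxy hyw hyw' hxn using fun i => hX.exists_third (hwx i).symm (hxw i) (hww i)
  have hyy : ∀ i, X.Adj (y i) (y (i + 1)) := fun i => by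
    obtain ⟨⟨p, q⟩, hp, hpq, hq, hpw, hqw⟩ := hE (hxw i).symm (hwx (i + 1)) (hxx i)
    dsimp only at *
    rcases hxn i p hp with rfl | rfl | rfl
    · exact absurd (hpair (hxw i) (hwx i).symm (hww i).symm
        ⟨(huw (i + 1)).symm, (hu i).symm, huw i, (hxu' i).symm, (hxu i).symm⟩
        ⟨hwx (i + 1), hq.symm, hpq.symm, (hxx i).symm,
          fun h => hxx' i (h ▸ hq)⟩).1 (hxu (i + 1)).symm
    · exact absurd rfl hpw
    · rcases hxn (i + 1) q hq.symm with rfl | rfl | rfl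
      · exact absurd rfl hqw
      · exact absurd (hpair (hwx (i + 1)).symm (hxw (i + 1)) (hww (i + 1))
          ⟨(huw (i + 1)).symm, hu (i + 1), huw (i + 1 + 1), (hxu (i + 1)).symm,
            (hxu' (i + 1)).symm⟩
          ⟨(hxw i).symm, hp, hpq, hxx i, fun h => hxx' i (h ▸ hp)⟩).1 (hxu' i).symm
      · exact hpq
  have hyx : ∀ i, y (i + 1) ≠ x i := fun i h => hxx' i (h ▸ (hxy (i + 1)).symm)
  have hyx' : ∀ i, y i ≠ x (i + 1) := fun i h => hxx' i (h ▸ hxy i)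
  have hyne : ∀ i, y i ≠ y (i + 1 + 1) := fun i h =>
    hww (i + 1) (hpair (hyy i).symm (hxy (i + 1)).symm (hyx' i)
      ⟨(hxy i).symm, hxw i, hwx (i + 1), (hyx i).symm, (hyw (i + 1)).symm⟩
      ⟨h ▸ (hxy (i + 1 + 1)).symm, (hwx (i + 1 + 1)).symm, (hxw (i + 1)).symm,
        (hyx' (i + 1)).symm, (hyw' (i + 1)).symm⟩).2
  refine ⟨_, LocalCovering.of_rims
    (o := ![w 0, x 0, w 1, x 1, w 2, x 2, w 3, x 3, w 4, x 4])
    (r := ![u 0, y 0, u 1, y 1, u 2, y 2, u 3, y 3, u 4, y 4])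
    (fun j => ?_) (fun j => ?_) (fun j => ?_) (fun j => ?_) (fun j => ?_) (fun j => ?_)
    (fun j => ?_) (fun j => ?_) (fun j => ?_)⟩
  · fin_cases j
    exacts [hwx 0, hxw 0, hwx 1, hxw 1, hwx 2, hxw 2, hwx 3, hxw 3, hwx 4, hxw 4]
  · fin_cases j
    exacts [(huw 0).symm, hxy 0, (huw 1).symm, hxy 1, (huw 2).symm, hxy 2, (huw 3).symm, hxy 3,
      (huw 4).symm, hxy 4]
  · fin_cases j
    exacts [hu 0, hyy 0, hu 1, hyy 1, hu 2, hyy 2, hu 3, hyy 3, hu 4, hyy 4]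
  · fin_cases j
    exacts [hxx 4, hww 0, hxx 0, hww 1, hxx 1, hww 2, hxx 2, hww 3, hxx 3, hww 4]
  · fin_cases j
    exacts [huu 4, hyne 4, huu 0, hyne 0, huu 1, hyne 1, huu 2, hyne 2, huu 3, hyne 3]
  · fin_cases j
    exacts [hxu 0, (hyw' 0).symm, hxu 1, (hyw' 1).symm, hxu 2, (hyw' 2).symm, hxu 3,
      (hyw' 3).symm, hxu 4, (hyw' 4).symm]
  · fin_cases j
    exacts [hxu' 4, (hyw 0).symm, hxu' 0, (hyw 1).symm, hxu' 1, (hyw 2).symm, hxu' 2,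
      (hyw 3).symm, hxu' 3, (hyw 4).symm]
  · fin_cases j
    exacts [(hwu 0).symm, hyx 0, (hwu 1).symm, hyx 1, (hwu 2).symm, hyx 2, (hwu 3).symm, hyx 3,
      (hwu 4).symm, hyx 4]
  · fin_cases j
    exacts [hwu' 4 |>.symm, hyx' 4, hwu' 0 |>.symm, hyx' 0, hwu' 1 |>.symm, hyx' 1,
      hwu' 2 |>.symm, hyx' 2, hwu' 3 |>.symm, hyx' 3]

theorem CubicGirthFive.nonempty_pentagons (hX : CubicGirthFive X) (hat : ArcTransitive X)
    {u : ZMod 5 → V} (hu : ∀ i, X.Adj (u i) (u (i + 1))) (hu₂ : ∀ i, u i ≠ u (i + 2))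
    {v a b : V} (ha : X.Adj v a) (hb : X.Adj v b) (hab : a ≠ b) :
    (pentagons X a v b).Nonempty := by
  have h : (u 4, u 3) ∈ pentagons X (u 0) (u 1) (u 2) :=
    ⟨(hu 4).symm, (hu 3).symm, (hu 2).symm, hu₂ 4, (hu₂ 1).symm⟩
  rw [← Set.ncard_pos hX.finite_pentagons, hX.ncard_pentagons_eq hat ha hb hab
    (hu 0).symm (hu 1) (hu₂ 0), Set.ncard_pos hX.finite_pentagons]
  exact ⟨_, h⟩

end

/-- A connected cubic arc-transitive simple graph of girth 5 is isomorphic to the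
Petersen graph `GP(5,2)` or to the dodecahedron graph `GP(10,2)`. -/
theorem stmt14 {V : Type*} (X : SimpleGraph V) (hconn : X.Connected)
    (hcubic : ∀ v : V, Nat.card (X.neighborSet v) = 3) (hat : ArcTransitive X)
    (hg : X.egirth = 5) :
    Nonempty (X ≃g genPetersen 5 2) ∨ Nonempty (X ≃g genPetersen 10 2) := by
  have hX := cubicGirthFive hcubic hg
  obtain ⟨u, hu, hu₂⟩ := exists_pentagon hg
  have hE := @hX.nonempty_pentagons _ _ hat _ hu hu₂
  have heq := fun {v a b : V} (ha : X.Adj v a) (hb : X.Adj v b) (hab : a ≠ b) =>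
    hX.ncard_pentagons_eq hat ha hb hab (hu 0).symm (hu 1) (hu₂ 0)
  by_cases h : 1 < (pentagons X (u 0) (u (0 + 1)) (u (0 + 2))).ncard
  · exact .inl (nonempty_iso_petersen hX hconn
      (fun ha hb hab => (heq ha hb hab).symm ▸ h) hu hu₂)
  · have hU : ∀ {v a b : V}, X.Adj v a → X.Adj v b → a ≠ b →
        (pentagons X a v b).Subsingleton := fun {v a b} ha hb hab =>
      have : Finite (pentagons X a v b) := hX.finite_pentagons
      Set.ncard_le_one_iff_subsingleton.1 ((heq ha hb hab).trans_le (not_lt.1 h))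
    obtain ⟨f, hf⟩ := exists_localCovering_dodecahedron hX hE hU hu hu₂
    exact .inr (hX.nonempty_iso hconn hf (hf.injective_dodecahedron hX hU))
end

section
/- Let X be a connected cubic arc-transitive simple graph of girth 5 and order n. Then n is divisible by 5. -/
namespace SimpleGraph

variable {V : Type*} {X : SimpleGraph V}

lemma not_triangle_of_five_le_egirth (hg : 5 ≤ X.egirth) {a b c : V}
    (hab : X.Adj a b) (hbc : X.Adj b c) (hca : X.Adj c a) : False := by
  have h := le_egirth.1 hg a (.cons hab (.cons hbc (.cons hca .nil)))
    (by simp [Walk.cons_isCycle_iff, hab.ne, hab.ne', hbc.ne, hca.ne, hca.ne'])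
  norm_num at h

lemma eq_of_common_neighbors_of_five_le_egirth (hg : 5 ≤ X.egirth) {a b c d : V} (hac : a ≠ c)
    (hab : X.Adj a b) (hbc : X.Adj b c) (hcd : X.Adj c d) (hda : X.Adj d a) : b = d := by
  by_contra hbd
  have h := le_egirth.1 hg a (.cons hab (.cons hbc (.cons hcd (.cons hda .nil))))
    (by simp [Walk.cons_isCycle_iff, hab.ne, hab.ne', hbc.ne, hcd.ne, hda.ne, hda.ne', hac,
          hac.symm, hbd])
  norm_num at h

/-- Closed walks of length five, with a base point and a direction. -/
abbrev ClosedFiveWalk (X : SimpleGraph V) : Type _ :=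
  {f : Fin 5 → V // ∀ i, X.Adj (f i) (f (i + 1))}

namespace ClosedFiveWalk

/-- Move the base point one step along the walk. -/
def rotate (X : SimpleGraph V) : Function.End X.ClosedFiveWalk :=
  fun f => ⟨fun i => f.1 (i + 1), fun i => f.2 (i + 1)⟩

lemma five_dvd_card [Fintype V] (X : SimpleGraph V) : 5 ∣ Nat.card X.ClosedFiveWalk := by
  classical
  have : Fact (Nat.Prime 5) := ⟨by norm_num⟩
  have hpow : rotate X ^ 5 ^ 1 = 1 := by
    funext f
    ext i
    fin_cases i <;> rfl
  have h := Equiv.Perm.card_fixedPoints_modEq hpow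
  have : IsEmpty (Function.fixedPoints (rotate X)) := ⟨fun ⟨f, hf⟩ => by
    have h0 : f.1 (0 + 1) = f.1 0 := congrFun (congrArg Subtype.val hf) 0
    exact (f.2 0).ne h0.symm⟩
  simp only [Fintype.card_eq_nat_card] at h
  exact Nat.modEq_zero_iff_dvd.1 (h.trans (congrArg (· % 5) (@Nat.card_of_isEmpty _ this)))

/-- The first arc of a closed walk of length five. -/
def firstDart (f : X.ClosedFiveWalk) : X.Dart := ⟨(f.1 0, f.1 1), f.2 0⟩

/-- An automorphism maps the walks starting with an arc to those starting with its image. -/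
def mapFiber (φ : X ≃g X) {d d' : X.Dart} (h1 : φ d.fst = d'.fst) (h2 : φ d.snd = d'.snd)
    (f : {f : X.ClosedFiveWalk // f.firstDart = d}) :
    {f : X.ClosedFiveWalk // f.firstDart = d'} :=
  ⟨⟨fun i => φ (f.1.1 i), fun i => φ.map_adj_iff.2 (f.1.2 i)⟩, by
    obtain ⟨f, rfl⟩ := f
    exact Dart.ext _ _ (Prod.ext h1 h2)⟩

lemma mapFiber_injective (φ : X ≃g X) {d d' : X.Dart} (h1 : φ d.fst = d'.fst)
    (h2 : φ d.snd = d'.snd) : Function.Injective (mapFiber φ h1 h2) := by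
  intro f g h
  ext i
  exact φ.injective (congrFun (congrArg (fun x => x.1.1) h) i)

lemma card_fiber_le_of_arcTransitive [Finite V] (hat : ArcTransitive X) (d d' : X.Dart) :
    Nat.card {f : X.ClosedFiveWalk // f.firstDart = d} ≤
      Nat.card {f : X.ClosedFiveWalk // f.firstDart = d'} := by
  obtain ⟨φ, h1, h2⟩ := hat d.adj d'.adj
  exact Nat.card_le_card_of_injective _ (mapFiber_injective φ h1 h2)

lemma card_fiber_le_four [Finite V] (hg : 5 ≤ X.egirth)
    (hcubic : ∀ v : V, Nat.card (X.neighborSet v) = 3) (d : X.Dart) :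
    Nat.card {f : X.ClosedFiveWalk // f.firstDart = d} ≤ 4 := by
  obtain ⟨⟨a, b⟩, hab : X.Adj a b⟩ := d
  have card_two : ∀ u v : V, X.Adj u v → Nat.card ↥(X.neighborSet u \ {v}) = 2 := fun u v h => by
    rw [Nat.card_coe_set_eq, Set.ncard_sdiff_singleton_of_mem (by exact h),
      ← Nat.card_coe_set_eq, hcubic]
  have key : ∀ f : {f : X.ClosedFiveWalk // f.firstDart = ⟨(a, b), hab⟩},
      f.1.1 0 = a ∧ f.1.1 1 = b := fun f =>
    ⟨congrArg (fun d : X.Dart => d.fst) f.2, congrArg (fun d : X.Dart => d.snd) f.2⟩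
  let F : {f : X.ClosedFiveWalk // f.firstDart = ⟨(a, b), hab⟩} →
      ↥(X.neighborSet b \ {a}) × ↥(X.neighborSet a \ {b}) := fun f =>
    (⟨f.1.1 2, by
      have e : X.Adj (f.1.1 1) (f.1.1 2) := f.1.2 1
      rw [(key f).2] at e
      refine ⟨e, fun h => ?_⟩
      have h : f.1.1 2 = f.1.1 0 := h.trans (key f).1.symm
      have h2 : X.Adj (f.1.1 2) (f.1.1 3) := f.1.2 2
      rw [h] at h2
      exact not_triangle_of_five_le_egirth hg h2 (f.1.2 3) (f.1.2 4)⟩,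
     ⟨f.1.1 4, by
      have e : X.Adj (f.1.1 4) (f.1.1 0) := f.1.2 4
      rw [(key f).1] at e
      refine ⟨e.symm, fun h => ?_⟩
      have h : f.1.1 4 = f.1.1 1 := h.trans (key f).2.symm
      have h2 : X.Adj (f.1.1 3) (f.1.1 4) := f.1.2 3
      rw [h] at h2
      exact not_triangle_of_five_le_egirth hg (f.1.2 1) (f.1.2 2) h2⟩)
  have hF : Function.Injective F := by
    intro f g h
    have h2 : f.1.1 2 = g.1.1 2 := congrArg (fun p => p.1.1) h
    have h4 : f.1.1 4 = g.1.1 4 := congrArg (fun p => p.2.1) h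
    have h0 : f.1.1 0 = g.1.1 0 := (key f).1.trans (key g).1.symm
    have h1 : f.1.1 1 = g.1.1 1 := (key f).2.trans (key g).2.symm
    have hne : f.1.1 2 ≠ f.1.1 4 := fun h => by
      have e : X.Adj (f.1.1 4) (f.1.1 0) := f.1.2 4
      rw [← h] at e
      exact not_triangle_of_five_le_egirth hg (f.1.2 0) (f.1.2 1) e
    have e1 : X.Adj (g.1.1 3) (g.1.1 4) := g.1.2 3
    have e2 : X.Adj (g.1.1 2) (g.1.1 3) := g.1.2 2
    rw [← h4] at e1
    rw [← h2] at e2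
    have h3 : f.1.1 3 = g.1.1 3 :=
      eq_of_common_neighbors_of_five_le_egirth hg hne (f.1.2 2) (f.1.2 3) e1.symm e2.symm
    ext i
    fin_cases i <;> assumption
  refine (Nat.card_le_card_of_injective F hF).trans ?_
  rw [Nat.card_prod, card_two b a hab.symm, card_two a b hab]

lemma nonempty_of_egirth_eq_five (hg : X.egirth = 5) : Nonempty X.ClosedFiveWalk := by
  have hac : ¬ X.IsAcyclic := fun h => by simp [egirth_eq_top.2 h] at hg
  obtain ⟨a, w, -, hw⟩ := exists_egirth_eq_length.2 hac
  have hlen : w.length = 5 := by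
    rw [hg] at hw
    exact_mod_cast hw.symm
  refine ⟨fun i => w.getVert i, fun i => ?_⟩
  have h := w.adj_getVert_succ (i := i) (by omega)
  have hend : w.getVert 5 = w.getVert 0 := by
    rw [← hlen, w.getVert_length, w.getVert_zero]
  fin_cases i <;> simpa [hend] using h

end ClosedFiveWalk

end SimpleGraph

/-- The order of a connected cubic arc-transitive simple graph of girth 5 is divisible
by 5. -/
theorem stmt15 {V : Type*} [Fintype V] (X : SimpleGraph V) (hconn : X.Connected)
    (hcubic : ∀ v : V, Nat.card (X.neighborSet v) = 3) (hat : ArcTransitive X)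
    (hg : X.egirth = 5) :
    5 ∣ Fintype.card V := by
  classical
  obtain ⟨f⟩ := SimpleGraph.ClosedFiveWalk.nonempty_of_egirth_eq_five hg
  set c := Nat.card {g : X.ClosedFiveWalk // g.firstDart = f.firstDart} with hc
  have hpos : 0 < c := by
    have : Nonempty {g : X.ClosedFiveWalk // g.firstDart = f.firstDart} := ⟨⟨f, rfl⟩⟩
    exact Nat.card_pos
  have hle : c ≤ 4 := SimpleGraph.ClosedFiveWalk.card_fiber_le_four hg.ge hcubic _
  have hdart : Fintype.card X.Dart = Fintype.card V * 3 := by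
    have hdeg : ∀ v, X.degree v = 3 := fun v => by
      rw [← X.card_neighborSet_eq_degree, ← Nat.card_eq_fintype_card, hcubic]
    simp [X.dart_card_eq_sum_degrees, hdeg]
  have hfib : ∀ d : X.Dart, Nat.card {g : X.ClosedFiveWalk // g.firstDart = d} = c := fun d =>
    (SimpleGraph.ClosedFiveWalk.card_fiber_le_of_arcTransitive hat _ _).antisymm
      (SimpleGraph.ClosedFiveWalk.card_fiber_le_of_arcTransitive hat _ _)
  have hcard : Nat.card X.ClosedFiveWalk = Fintype.card V * (3 * c) := by
    rw [← Nat.card_congr (Equiv.sigmaFiberEquiv SimpleGraph.ClosedFiveWalk.firstDart),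
      Nat.card_sigma]
    simp only [hfib, Finset.sum_const, Finset.card_univ, hdart, smul_eq_mul, mul_assoc]
  have hdvd := SimpleGraph.ClosedFiveWalk.five_dvd_card X
  rw [hcard] at hdvd
  refine Nat.Coprime.dvd_of_dvd_mul_right ?_ hdvd
  clear_value c
  interval_cases c <;> decide
end

section
/- Let X be a connected cubic arc-transitive simple graph of girth 5. Then X has a consistent 5-cycle: there exist a 5-cycle C = v₀v₁v₂v₃v₄ in X and an automorphism ρ of X of order 5 such that ρ(vᵢ) = vᵢ₊₁ (indices modulo 5) for all i. -/
namespace SimpleGraph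

variable {V : Type*} {X : SimpleGraph V}

/-- In a cubic graph two distinct neighbours of a vertex leave exactly one further neighbour. -/
theorem exists_third_neighbor (hcubic : ∀ v : V, Nat.card (X.neighborSet v) = 3) {v a b : V}
    (ha : X.Adj v a) (hb : X.Adj v b) (hab : a ≠ b) :
    ∃ c, X.Adj v c ∧ c ≠ a ∧ c ≠ b ∧ ∀ x, X.Adj v x → x = a ∨ x = b ∨ x = c := by
  have h : (X.neighborSet v).ncard = 3 := hcubic v
  obtain ⟨p, q, r, hpq, hpr, hqr, hS⟩ := Set.ncard_eq_three.mp h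
  have key : ∀ x, X.Adj v x ↔ x = p ∨ x = q ∨ x = r := fun x => by
    rw [← mem_neighborSet, hS]; simp
  have hc : (p ≠ a ∧ p ≠ b) ∨ (q ≠ a ∧ q ≠ b) ∨ (r ≠ a ∧ r ≠ b) := by grind
  simp only [key] at ha hb ⊢
  rcases hc with hc | hc | hc
  · exact ⟨p, by simp, hc.1, hc.2, by grind⟩
  · exact ⟨q, by simp, hc.1, hc.2, by grind⟩
  · exact ⟨r, by simp, hc.1, hc.2, by grind⟩

theorem eq_of_adj_of_cubic (hcubic : ∀ v : V, Nat.card (X.neighborSet v) = 3) {v a b c d : V}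
    (ha : X.Adj v a) (hb : X.Adj v b) (hab : a ≠ b) (hc : X.Adj v c) (hd : X.Adj v d)
    (hca : c ≠ a) (hcb : c ≠ b) (hda : d ≠ a) (hdb : d ≠ b) : c = d := by
  obtain ⟨e, -, -, -, h⟩ := exists_third_neighbor hcubic ha hb hab
  grind

theorem exists_neighbor_ne (hcubic : ∀ v : V, Nat.card (X.neighborSet v) = 3) (v a : V) :
    ∃ c, X.Adj v c ∧ c ≠ a := by
  have h : (X.neighborSet v).ncard = 3 := hcubic v
  obtain ⟨p, q, r, hpq, hpr, hqr, hS⟩ := Set.ncard_eq_three.mp h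
  have key : ∀ x, X.Adj v x ↔ x = p ∨ x = q ∨ x = r := fun x => by
    rw [← mem_neighborSet, hS]; simp
  by_cases hp : p = a
  · exact ⟨q, (key q).mpr (by simp), hp ▸ hpq.symm⟩
  · exact ⟨p, (key p).mpr (by simp), hp⟩

theorem not_adj_of_three_lt_egirth (hg : 3 < X.egirth) {a b c : V} (hab : X.Adj a b)
    (hbc : X.Adj b c) : ¬ X.Adj c a := by
  intro hca
  have hcyc : (Walk.cons hab (.cons hbc (.cons hca .nil))).IsCycle := by
    simp [Walk.isCycle_def, Walk.isTrail_def, hab.ne, hab.ne', hbc.ne, hca.ne, hca.ne']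
  have := hg.trans_le (egirth_le_length hcyc)
  simp at this

theorem eq_or_eq_of_four_lt_egirth (hg : 4 < X.egirth) {a b c d : V} (hab : X.Adj a b)
    (hbc : X.Adj b c) (hcd : X.Adj c d) (hda : X.Adj d a) : a = c ∨ b = d := by
  by_contra! h
  have hcyc : (Walk.cons hab (.cons hbc (.cons hcd (.cons hda .nil)))).IsCycle := by
    simp [Walk.isCycle_def, Walk.isTrail_def, hab.ne, hab.ne', hbc.ne, hcd.ne,
      hda.ne, hda.ne', h.1, h.2, h.1.symm]
  have := hg.trans_le (egirth_le_length hcyc)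
  simp at this

theorem exists_five_cycle (hg : X.egirth = 5) :
    ∃ v : ZMod 5 → V, Function.Injective v ∧ ∀ i, X.Adj (v i) (v (i + 1)) := by
  have hac : ¬ X.IsAcyclic := fun h => by
    rw [egirth_eq_top.mpr h] at hg; exact absurd hg (by decide)
  obtain ⟨a, w, hw, hl⟩ := exists_egirth_eq_length.mpr hac
  have h5 : w.length = 5 := by
    rw [hg] at hl; exact_mod_cast hl.symm
  refine ⟨fun i => w.getVert (ZMod.val i), ?_, ?_⟩
  · intro i j hij
    apply ZMod.val_injective 5
    refine hw.getVert_injOn' ?_ ?_ hij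
    · have := ZMod.val_lt i
      simp only [Set.mem_ofPred_eq]; omega
    · have := ZMod.val_lt j
      simp only [Set.mem_ofPred_eq]; omega
  · intro i
    have hi := w.adj_getVert_succ (i := ZMod.val i) (by rw [h5]; exact ZMod.val_lt i)
    by_cases h4 : i = 4
    · subst h4
      have hv : w.getVert (ZMod.val (4 : ZMod 5) + 1) = w.getVert (ZMod.val (4 + 1 : ZMod 5)) := by
        have h1 : ZMod.val (4 : ZMod 5) + 1 = w.length := by rw [h5]; rfl
        have h2 : ZMod.val (4 + 1 : ZMod 5) = 0 := rfl
        rw [h1, h2, Walk.getVert_length, Walk.getVert_zero]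
      change X.Adj (w.getVert _) (w.getVert _)
      rwa [← hv]
    · have : ZMod.val (i + 1) = ZMod.val i + 1 := by clear hi; decide +revert
      change X.Adj (w.getVert _) (w.getVert _)
      rwa [this]

/-- An automorphism fixing a vertex and all its neighbours is trivial if every 2-path
extends to exactly one 5-cycle. -/
theorem eq_self_of_unique_five_cycle (hconn : X.Connected)
    (hcubic : ∀ v : V, Nat.card (X.neighborSet v) = 3)
    (hex : ∀ a b c, X.Adj b a → X.Adj b c → a ≠ c →
      ∃ x y, X.Adj a x ∧ X.Adj c y ∧ X.Adj x y ∧ x ≠ b ∧ y ≠ b)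
    (huniq : ∀ a b c x y x' y', X.Adj b a → X.Adj b c → a ≠ c →
      X.Adj a x → X.Adj c y → X.Adj x y → x ≠ b → y ≠ b →
      X.Adj a x' → X.Adj c y' → X.Adj x' y' → x' ≠ b → y' ≠ b → x = x' ∧ y = y')
    (θ : X ≃g X) {r : V} (hr : θ r = r) (hrn : ∀ x, X.Adj r x → θ x = x) (z : V) : θ z = z := by
  have step : ∀ a b, X.Adj b a → (θ b = b ∧ ∀ x, X.Adj b x → θ x = x) →
      (θ a = a ∧ ∀ x, X.Adj a x → θ x = x) := by
    rintro a b hba ⟨hb, hbn⟩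
    have ha := hbn a hba
    refine ⟨ha, ?_⟩
    obtain ⟨c, hbc, hca⟩ := exists_neighbor_ne hcubic b a
    obtain ⟨x, y, hax, hcy, hxy, hxb, hyb⟩ := hex a b c hba hbc hca.symm
    have hc := hbn c hbc
    have hmap : ∀ {p q}, X.Adj p q → X.Adj (θ p) (θ q) := fun h => θ.map_adj_iff.mpr h
    have hne : ∀ {p q}, p ≠ q → θ p ≠ θ q := fun h => θ.injective.ne h
    have hx : x = θ x := (huniq a b c x y (θ x) (θ y) hba hbc hca.symm hax hcy hxy hxb hyb
      (by simpa [ha] using hmap hax) (by simpa [hc] using hmap hcy) (hmap hxy)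
      (by simpa [hb] using hne hxb) (by simpa [hb] using hne hyb)).1
    intro z hz
    by_cases hzb : z = b
    · rw [hzb, hb]
    by_cases hzx : z = x
    · rw [hzx, ← hx]
    refine eq_of_adj_of_cubic hcubic hba.symm hax hxb.symm (by simpa [ha] using hmap hz) hz
      (by simpa [hb] using hne hzb) ?_ hzb hzx
    rw [hx]; exact hne hzx
  have main : ∀ p q, X.Walk p q → (θ p = p ∧ ∀ x, X.Adj p x → θ x = x) →
      (θ q = q ∧ ∀ x, X.Adj q x → θ x = x) := by
    intro p q w
    induction w with
    | nil => exact id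
    | cons h _ ih => exact fun hp => ih (step _ _ h hp)
  exact (main r z (hconn.preconnected r z).some ⟨hr, hrn⟩).1

/-- Two of three 2-arcs of a cubic arc-transitive graph lie in one orbit; hence two successive
2-arcs of a 5-cycle do. -/
theorem exists_iso_succ (hcubic : ∀ v : V, Nat.card (X.neighborSet v) = 3)
    (hat : ArcTransitive X) {v : ZMod 5 → V} (hinj : Function.Injective v)
    (hadj : ∀ i, X.Adj (v i) (v (i + 1))) :
    ∃ i, ∃ φ : X ≃g X, φ (v i) = v (i + 1) ∧ φ (v (i + 1)) = v (i + 2) ∧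
      φ (v (i + 2)) = v (i + 3) := by
  let R : ZMod 5 → ZMod 5 → Prop := fun i j => ∃ φ : X ≃g X, φ (v i) = v j ∧
    φ (v (i + 1)) = v (j + 1) ∧ φ (v (i + 2)) = v (j + 2)
  have hsymm : ∀ i j, R i j → R j i := by
    rintro i j ⟨φ, h0, h1, h2⟩
    exact ⟨φ.symm, by simp [← h0], by simp [← h1], by simp [← h2]⟩
  have htrans : ∀ i j k, R i j → R j k → R i k := by
    rintro i j k ⟨φ, h0, h1, h2⟩ ⟨ψ, g0, g1, g2⟩
    exact ⟨φ.trans ψ, by simp [*], by simp [*], by simp [*]⟩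
  have hadj' : ∀ i, X.Adj (v (i + 1)) (v (i + 2)) := fun i => by
    have := hadj (i + 1)
    rwa [add_assoc, one_add_one_eq_two] at this
  have hne : ∀ i, v (i + 2) ≠ v i := fun i => hinj.ne (by decide +revert)
  have hpig : ∀ i j k, ¬ R i j → ¬ R k j → R i k := by
    intro i j k hij hkj
    obtain ⟨φ, h0, h1⟩ := hat (hadj i) (hadj j)
    obtain ⟨ψ, g0, g1⟩ := hat (hadj k) (hadj j)
    have h2 : φ (v (i + 2)) ≠ v (j + 2) := fun h => hij ⟨φ, h0, h1, h⟩
    have g2 : ψ (v (k + 2)) ≠ v (j + 2) := fun h => hkj ⟨ψ, g0, g1, h⟩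
    have heq : φ (v (i + 2)) = ψ (v (k + 2)) :=
      eq_of_adj_of_cubic hcubic (hadj j).symm (hadj' j) (hne j).symm
        (by rw [← h1]; exact φ.map_adj_iff.mpr (hadj' i))
        (by rw [← g1]; exact ψ.map_adj_iff.mpr (hadj' k))
        (by rw [← h0]; exact φ.injective.ne (hne i)) h2
        (by rw [← g0]; exact ψ.injective.ne (hne k)) g2
    refine ⟨φ.trans ψ.symm, ?_, ?_, ?_⟩
    · simp [h0, ← g0]
    · simp [h1, ← g1]
    · simp [heq]
  have hR : ∃ i, R i (i + 1) := by
    by_contra! h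
    have h02 : R 0 2 := hpig 0 1 2 (h 0) fun hh => h 1 (hsymm _ _ hh)
    have h24 : R 2 4 := hpig 2 3 4 (h 2) fun hh => h 3 (hsymm _ _ hh)
    exact h 4 (hsymm _ _ (htrans _ _ _ h02 h24))
  obtain ⟨i, φ, h0, h1, h2⟩ := hR
  refine ⟨i, φ, h0, ?_, ?_⟩
  · rw [h1, add_assoc, one_add_one_eq_two]
  · rw [h2]; congr 1; ring

/-- If `v` and `w` parametrize the outer and inner cycle of the generalized Petersen graph `G(5, 2)`,
the rotation of the outer cycle extends to an automorphism of order 5. -/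
theorem exists_rotation_of_petersen (hconn : X.Connected)
    (hcubic : ∀ v : V, Nat.card (X.neighborSet v) = 3)
    {v w : ZMod 5 → V} (hv : Function.Injective v) (hw : Function.Injective w)
    (hvw : ∀ i j, v i ≠ w j) (hvv' : ∀ i, X.Adj (v i) (v (i + 1)))
    (hvw' : ∀ i, X.Adj (v i) (w i)) (hww' : ∀ i, X.Adj (w i) (w (i + 2))) :
    ∃ ρ : Equiv.Perm V, (∀ x y : V, X.Adj (ρ x) (ρ y) ↔ X.Adj x y) ∧
      orderOf ρ = 5 ∧ ∀ i, ρ (v i) = v (i + 1) := by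
  have hvpred : ∀ i, X.Adj (v i) (v (i + 4)) := fun i => by
    have := (hvv' (i + 4)).symm
    rwa [show i + 4 + 1 = i from (by decide : ∀ j : ZMod 5, j + 4 + 1 = j) i] at this
  have hwpred : ∀ i, X.Adj (w i) (w (i + 3)) := fun i => by
    have := (hww' (i + 3)).symm
    rwa [show i + 3 + 2 = i from (by decide : ∀ j : ZMod 5, j + 3 + 2 = j) i] at this
  have hnv : ∀ i x, X.Adj (v i) x → x = v (i + 1) ∨ x = v (i + 4) ∨ x = w i := by
    intro i x hx
    by_contra! h
    exact h.2.2 (eq_of_adj_of_cubic hcubic (hvv' i) (hvpred i)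
      (hv.ne ((by decide : ∀ j : ZMod 5, j + 1 ≠ j + 4) i)) hx (hvw' i) h.1 h.2.1
      (hvw _ _).symm (hvw _ _).symm)
  have hnw : ∀ i x, X.Adj (w i) x → x = w (i + 2) ∨ x = w (i + 3) ∨ x = v i := by
    intro i x hx
    by_contra! h
    exact h.2.2 (eq_of_adj_of_cubic hcubic (hww' i) (hwpred i)
      (hw.ne ((by decide : ∀ j : ZMod 5, j + 2 ≠ j + 3) i)) hx (hvw' i).symm h.1 h.2.1
      (hvw _ _) (hvw _ _))
  have hsurj : ∀ z, (∃ i, z = v i) ∨ ∃ i, z = w i := by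
    have main : ∀ p q, X.Walk p q → ((∃ i, p = v i) ∨ ∃ i, p = w i) →
        ((∃ i, q = v i) ∨ ∃ i, q = w i) := by
      intro p q r
      induction r with
      | nil => exact id
      | cons h _ ih =>
        rintro (⟨i, rfl⟩ | ⟨i, rfl⟩)
        · rcases hnv i _ h with rfl | rfl | rfl
          exacts [ih (.inl ⟨_, rfl⟩), ih (.inl ⟨_, rfl⟩), ih (.inr ⟨_, rfl⟩)]
        · rcases hnw i _ h with rfl | rfl | rfl
          exacts [ih (.inr ⟨_, rfl⟩), ih (.inr ⟨_, rfl⟩), ih (.inl ⟨_, rfl⟩)]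
    exact fun z => main (v 0) z (hconn.preconnected _ _).some (.inl ⟨0, rfl⟩)
  let e : ZMod 5 ⊕ ZMod 5 ≃ V := Equiv.ofBijective (Sum.elim v w) ⟨hv.sumElim hw hvw, fun z => by
    rcases hsurj z with ⟨i, rfl⟩ | ⟨i, rfl⟩
    exacts [⟨.inl i, rfl⟩, ⟨.inr i, rfl⟩]⟩
  let ρ : Equiv.Perm V := e.permCongr (Equiv.sumCongr (Equiv.addRight 1) (Equiv.addRight 1))
  have hρv : ∀ i, ρ (v i) = v (i + 1) := fun i => by
    have : e.symm (v i) = .inl i := e.symm_apply_eq.mpr rfl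
    simp [ρ, Equiv.permCongr_apply, this]; rfl
  have hρw : ∀ i, ρ (w i) = w (i + 1) := fun i => by
    have : e.symm (w i) = .inr i := e.symm_apply_eq.mpr rfl
    simp [ρ, Equiv.permCongr_apply, this]; rfl
  have h5 : ∀ z, ρ (ρ (ρ (ρ (ρ z)))) = z := by
    intro z
    have h : ∀ i : ZMod 5, i + 1 + 1 + 1 + 1 + 1 = i := by decide
    rcases hsurj z with ⟨i, rfl⟩ | ⟨i, rfl⟩
    · simp only [hρv, h]
    · simp only [hρw, h]
  have hfwd : ∀ x y, X.Adj x y → X.Adj (ρ x) (ρ y) := by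
    intro x y hxy
    rcases hsurj x with ⟨i, rfl⟩ | ⟨i, rfl⟩
    · rcases hnv i _ hxy with rfl | rfl | rfl
      · simpa only [hρv] using hvv' (i + 1)
      · simpa only [hρv, add_right_comm] using hvpred (i + 1)
      · simpa only [hρv, hρw] using hvw' (i + 1)
    · rcases hnw i _ hxy with rfl | rfl | rfl
      · simpa only [hρw, add_right_comm] using hww' (i + 1)
      · simpa only [hρw, add_right_comm] using hwpred (i + 1)
      · simpa only [hρv, hρw] using (hvw' (i + 1)).symm
  refine ⟨ρ, fun x y => ⟨fun h => ?_, hfwd x y⟩, ?_, hρv⟩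
  · have := hfwd _ _ (hfwd _ _ (hfwd _ _ (hfwd _ _ h)))
    rwa [h5, h5] at this
  · have hρ : ρ ≠ 1 := fun h => by
      have h01 := hρv 0
      rw [h] at h01
      exact absurd (hv h01) (by decide)
    have : Fact (Nat.Prime 5) := ⟨by norm_num⟩
    exact orderOf_eq_prime (Equiv.ext h5) hρ

end SimpleGraph

open SimpleGraph in
/-- A connected cubic arc-transitive simple graph of girth 5 has a consistent 5-cycle:
there are a 5-cycle `v₀v₁v₂v₃v₄` and an automorphism `ρ` of order 5 with
`ρ(vᵢ) = vᵢ₊₁` for all `i`. -/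
theorem stmt16 {V : Type*} (X : SimpleGraph V) (hconn : X.Connected)
    (hcubic : ∀ v : V, Nat.card (X.neighborSet v) = 3) (hat : ArcTransitive X)
    (hg : X.egirth = 5) :
    ∃ v : ZMod 5 → V, Function.Injective v ∧ (∀ i, X.Adj (v i) (v (i + 1))) ∧
      ∃ ρ : Equiv.Perm V, (∀ x y : V, X.Adj (ρ x) (ρ y) ↔ X.Adj x y) ∧
        orderOf ρ = 5 ∧ ∀ i, ρ (v i) = v (i + 1) := by
  have h3 : ∀ {a b c}, X.Adj a b → X.Adj b c → ¬ X.Adj c a :=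
    not_adj_of_three_lt_egirth (by rw [hg]; decide)
  have h4 : ∀ {a b c d}, X.Adj a b → X.Adj b c → X.Adj c d → X.Adj d a → a = c ∨ b = d :=
    eq_or_eq_of_four_lt_egirth (by rw [hg]; decide)
  obtain ⟨v, hinj, hadj⟩ := exists_five_cycle hg
  -- Automorphisms act transitively on 2-paths, up to reversal.
  have htwo : ∀ {a b c a' b' c'}, X.Adj b a → X.Adj b c → a ≠ c → X.Adj b' a' → X.Adj b' c' →
      a' ≠ c' → ∃ φ : X ≃g X, φ b = b' ∧ (φ a = a' ∧ φ c = c' ∨ φ a = c' ∧ φ c = a') := by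
    intro a b c a' b' c' hba hbc hac hba' hbc' hac'
    obtain ⟨d, hd, hda, hdc, -⟩ := exists_third_neighbor hcubic hba hbc hac
    obtain ⟨d', hd', hda', hdc', hall⟩ := exists_third_neighbor hcubic hba' hbc' hac'
    obtain ⟨φ, hb, hφd⟩ := hat hd hd'
    have hA := hall (φ a) (by rw [← hb]; exact φ.map_adj_iff.mpr hba)
    have hC := hall (φ c) (by rw [← hb]; exact φ.map_adj_iff.mpr hbc)
    have h1 := φ.injective.ne hda
    have h2 := φ.injective.ne hdc
    have h3 := φ.injective.ne hac
    refine ⟨φ, hb, ?_⟩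
    grind
  have hadj' : ∀ {i j}, j = i + 1 → X.Adj (v i) (v j) := fun h => h ▸ hadj _
  have hex : ∀ a b c, X.Adj b a → X.Adj b c → a ≠ c →
      ∃ x y, X.Adj a x ∧ X.Adj c y ∧ X.Adj x y ∧ x ≠ b ∧ y ≠ b := by
    intro a b c hba hbc hac
    obtain ⟨φ, hb, h⟩ := htwo (hadj' (i := 0) (j := 1) rfl).symm (hadj' (i := 1) (j := 2) rfl)
      (hinj.ne (by decide)) hba hbc hac
    have hm : ∀ {p q}, X.Adj p q → X.Adj (φ p) (φ q) := fun h => φ.map_adj_iff.mpr h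
    have h04 := hm (hadj' (i := 4) (j := 0) rfl).symm
    have h23 := hm (hadj' (i := 2) (j := 3) rfl)
    have h34 := hm (hadj' (i := 3) (j := 4) rfl)
    have n4 : φ (v 4) ≠ φ (v 1) := φ.injective.ne (hinj.ne (by decide))
    have n3 : φ (v 3) ≠ φ (v 1) := φ.injective.ne (hinj.ne (by decide))
    rw [hb] at n3 n4
    rcases h with ⟨h0, h2⟩ | ⟨h0, h2⟩ <;> rw [h0] at h04 <;> rw [h2] at h23
    · exact ⟨_, _, h04, h23, h34.symm, n4, n3⟩
    · exact ⟨_, _, h23, h04, h34, n3, n4⟩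
  by_cases huniq : ∀ a b c x y x' y', X.Adj b a → X.Adj b c → a ≠ c →
      X.Adj a x → X.Adj c y → X.Adj x y → x ≠ b → y ≠ b →
      X.Adj a x' → X.Adj c y' → X.Adj x' y' → x' ≠ b → y' ≠ b → x = x' ∧ y = y'
  · obtain ⟨i, φ, h0, h1, h2⟩ := exists_iso_succ hcubic hat hinj hadj
    have hm : ∀ {p q}, X.Adj p q → X.Adj (φ p) (φ q) := fun h => φ.map_adj_iff.mpr h
    have hne : ∀ {j k}, j ≠ k → v (i + j) ≠ v (i + k) := fun h => hinj.ne (by simpa using h)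
    have ha : ∀ {j k}, k = j + 1 → X.Adj (v (i + j)) (v (i + k)) := fun h =>
      hadj' (by rw [h, add_assoc])
    rw [← add_zero i, add_assoc, zero_add] at h0
    have h40 := hm (ha (j := 4) (k := 0) rfl).symm
    have h23 := hm (ha (j := 2) (k := 3) rfl)
    have h34 := hm (ha (j := 3) (k := 4) rfl)
    have n4 : φ (v (i + 4)) ≠ φ (v (i + 1)) := φ.injective.ne (hne (by decide))
    have n3 : φ (v (i + 3)) ≠ φ (v (i + 1)) := φ.injective.ne (hne (by decide))
    rw [h0] at h40
    rw [h2] at h23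
    rw [h1] at n3 n4
    obtain ⟨h4', h3'⟩ := huniq (v (i + 1)) (v (i + 2)) (v (i + 3)) _ _ (v (i + 0)) (v (i + 4))
      (ha (j := 1) (k := 2) rfl).symm (ha rfl) (hne (by decide)) h40 h23 h34.symm n4 n3
      (ha (j := 0) (k := 1) rfl).symm (ha rfl) (ha (j := 4) (k := 0) rfl).symm
      (hne (by decide)) (hne (by decide))
    have hrot : ∀ j, φ (v (i + j)) = v (i + (j + 1)) := by
      intro j
      fin_cases j
      exacts [h0, h1, h2, h3', h4']
    have hrot' : ∀ j, φ (v j) = v (j + 1) := fun j => by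
      have := hrot (j - i)
      rwa [add_sub_cancel, ← add_assoc, add_sub_cancel] at this
    refine ⟨v, hinj, hadj, φ.toEquiv, fun x y => φ.map_adj_iff, ?_, hrot'⟩
    let θ : X ≃g X := φ.trans (φ.trans (φ.trans (φ.trans φ)))
    have hθ : ∀ j, θ (v j) = v j := fun j => by
      change φ (φ (φ (φ (φ (v j))))) = v j
      simp only [hrot']
      congr 1; decide +revert
    have hθn : ∀ x, X.Adj (v 0) x → θ x = x := by
      intro x hx
      by_cases hx1 : x = v 1
      · rw [hx1, hθ]
      by_cases hx4 : x = v 4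
      · rw [hx4, hθ]
      refine eq_of_adj_of_cubic hcubic (hadj' (i := 0) (j := 1) rfl)
        (hadj' (i := 4) (j := 0) rfl).symm (hinj.ne (by decide)) ?_ hx ?_ ?_ hx1 hx4
      · rw [← hθ 0]; exact θ.map_adj_iff.mpr hx
      · rw [← hθ 1]; exact θ.injective.ne hx1
      · rw [← hθ 4]; exact θ.injective.ne hx4
    have hφ : φ.toEquiv ≠ 1 := fun h => by
      have h01 : φ (v 0) = v 0 := congrArg (fun σ : Equiv.Perm V => σ (v 0)) h
      rw [hrot'] at h01
      exact absurd (hinj h01) (by decide)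
    have : Fact (Nat.Prime 5) := ⟨by norm_num⟩
    exact orderOf_eq_prime (Equiv.ext fun z =>
      eq_self_of_unique_five_cycle hconn hcubic hex huniq θ (hθ 0) hθn z) hφ
  · push Not at huniq
    obtain ⟨a, b, c, x, y, x', y', hba, hbc, hac, hax, hcy, hxy, hxb, hyb, hax', hcy', hxy', hxb',
      hyb', hne⟩ := huniq
    have hxx : x ≠ x' := fun h => by
      subst h
      rcases h4 hxy hcy.symm hcy' hxy'.symm with rfl | h
      · exact h3 hba hax hbc.symm
      · exact hne rfl h
    have hyy : y ≠ y' := fun h => by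
      subst h
      rcases h4 hxy.symm hax.symm hax' hxy' with rfl | h
      · exact h3 hbc hcy hba.symm
      · exact hxx h
    have hD : ∀ a' b' c', X.Adj b' a' → X.Adj b' c' → a' ≠ c' →
        ∀ z, X.Adj a' z → z ≠ b' → ∃ t, X.Adj c' t ∧ X.Adj z t ∧ t ≠ b' := by
      intro a' b' c' hba' hbc' hac' z hz hzb
      obtain ⟨φ, hb, h⟩ := htwo hba hbc hac hba' hbc' hac'
      have hm : ∀ {p q}, X.Adj p q → X.Adj (φ p) (φ q) := fun h => φ.map_adj_iff.mpr h
      have hn : ∀ {p q}, p ≠ q → φ p ≠ φ q := fun h => φ.injective.ne h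
      subst hb
      rcases h with ⟨rfl, rfl⟩ | ⟨rfl, rfl⟩
      · by_cases hzx : z = φ x
        · exact ⟨φ y, hm hcy, hzx ▸ hm hxy, hn hyb⟩
        · have : z = φ x' := eq_of_adj_of_cubic hcubic (hm hba).symm (hm hax) (hn hxb.symm) hz
            (hm hax') hzb hzx (hn hxb') (hn hxx.symm)
          exact ⟨φ y', hm hcy', this ▸ hm hxy', hn hyb'⟩
      · by_cases hzx : z = φ y
        · exact ⟨φ x, hm hax, hzx ▸ (hm hxy).symm, hn hxb⟩
        · have : z = φ y' := eq_of_adj_of_cubic hcubic (hm hbc).symm (hm hcy) (hn hyb.symm) hz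
            (hm hcy') hzb hzx (hn hyb') (hn hyy.symm)
          exact ⟨φ x', hm hax', this ▸ (hm hxy').symm, hn hxb'⟩
    have hpred : ∀ i, X.Adj (v i) (v (i + 4)) := fun i =>
      (hadj' (by decide +revert)).symm
    have hv2 : ∀ i, v i ≠ v (i + 2) := fun i => hinj.ne (by decide +revert)
    choose w hvw hw1 hw4 _ using fun i =>
      exists_third_neighbor hcubic (hadj i) (hpred i)
        (hinj.ne ((by decide : ∀ j : ZMod 5, j + 1 ≠ j + 4) i))
    have hvwne : ∀ i j, v i ≠ w j := by
      intro i j h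
      have hji : X.Adj (v j) (v i) := h ▸ hvw j
      have hcases : ∀ i j : ZMod 5, i = j ∨ i = j + 1 ∨ i = j + 4 ∨ i = j + 2 ∨ i = j + 3 := by
        decide
      rcases hcases i j with rfl | rfl | rfl | rfl | rfl
      · exact X.loopless.irrefl _ hji
      · exact hw1 _ h.symm
      · exact hw4 _ h.symm
      · exact h3 (hadj j) (hadj' (by ring)) hji.symm
      · exact h3 (hpred j) (hadj' (i := j + 3) (j := j + 4) (by ring)).symm hji.symm
    have hwinj : Function.Injective w := by
      have hs1 : ∀ i, w i ≠ w (i + 1) := fun i h =>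
        h3 (hadj i) (hvw (i + 1)) (h ▸ (hvw i).symm)
      have hs2 : ∀ i, w i ≠ w (i + 2) := fun i h => by
        rcases h4 (hadj i) (hadj' (j := i + 2) (by ring)) (hvw (i + 2)) (h ▸ (hvw i).symm) with h | h
        · exact hv2 i h
        · exact hvwne _ _ h
      intro i j h
      have hcases : ∀ i j : ZMod 5, i = j ∨ i = j + 1 ∨ j = i + 1 ∨ i = j + 2 ∨ j = i + 2 := by
        decide
      rcases hcases i j with h' | rfl | rfl | rfl | rfl
      · exact h'
      · exact absurd h.symm (hs1 _)
      · exact absurd h (hs1 _)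
      · exact absurd h.symm (hs2 _)
      · exact absurd h (hs2 _)
    have hww : ∀ i, X.Adj (w i) (w (i + 2)) := by
      intro i
      have e1 : X.Adj (v (i + 1)) (v (i + 2)) := hadj' (by ring)
      have e2 : X.Adj (v (i + 2)) (v (i + 3)) := hadj' (by ring)
      have e3 : X.Adj (v (i + 3)) (v (i + 4)) := hadj' (by ring)
      obtain ⟨t, hct, hwt, htb⟩ := hD (v i) (v (i + 1)) (v (i + 2)) (hadj i).symm e1
        (hv2 i) (w i) (hvw i) (hw1 i)
      have ht3 : t ≠ v (i + 3) := by
        rintro rfl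
        rcases h4 (hvw i) hwt e3 (hpred i).symm with h | h
        · exact (by decide : ∀ j : ZMod 5, j ≠ j + 3) i (hinj h)
        · exact hvwne _ _ h.symm
      have : t = w (i + 2) := eq_of_adj_of_cubic hcubic e1.symm e2
        (hinj.ne ((by decide : ∀ j : ZMod 5, j + 1 ≠ j + 3) i)) hct (hvw _) htb ht3
        (hvwne _ _).symm (hvwne _ _).symm
      exact this ▸ hwt
    exact ⟨v, hinj, hadj, exists_rotation_of_petersen hconn hcubic hinj hwinj hvwne hadj hvw hww⟩
end

section
/- Let X be a connected cubic simple graph in which every cycle-separating edge set has at least 6 edges, and let u and v be adjacent vertices of X. Then in the graph Y = X − {u,v} obtained by deleting u and v, every edge set F ⊆ E(Y) such that Y − F has at least two connected components containing cycles has at least 4 edges. -/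
/-- Reachable vertices lie on the same side of a vertex set that no edge crosses. -/
theorem SimpleGraph.Reachable.mem_iff_of_adj {V : Type*} {G : SimpleGraph V} {T : Set V}
    (hT : ∀ a b, G.Adj a b → a ∈ T → b ∈ T) {x y : V} (h : G.Reachable x y) (hx : x ∈ T) :
    y ∈ T := by
  obtain ⟨p⟩ := h
  induction p with
  | nil => exact hx
  | cons hab _ ih => exact ih (hT _ _ hab hx)

/-- In a cubic graph, the neighbours of `u` other than a given neighbour `v` form a
two-element finset. -/
theorem SimpleGraph.exists_finset_neighbors_ne {V : Type*} {X : SimpleGraph V} {u v : V}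
    (hu : Nat.card (X.neighborSet u) = 3) (huv : X.Adj u v) :
    ∃ A : Finset V, A.card = 2 ∧ ∀ w, w ∈ A ↔ X.Adj u w ∧ w ≠ v := by
  classical
  have hfin : (X.neighborSet u).Finite := Set.finite_of_ncard_ne_zero (by
    rw [← Nat.card_coe_set_eq, hu]; decide)
  refine ⟨hfin.toFinset.erase v, ?_, fun w => by simp [and_comm]⟩
  rw [Finset.card_erase_of_mem (by simpa using huv), ← Set.ncard_eq_toFinset_card _ hfin,
    ← Nat.card_coe_set_eq, hu]

open Classical in
/-- The edges of `F`, together with the edges joining `u` to the vertices of `A` in `P`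
and those joining `v` to the vertices of `B` in `P`. -/
noncomputable def extendedCut {V : Type*} {s : Set V} (F : Finset (Sym2 s)) (u v : V)
    (A B : Finset V) (P : Set V) : Finset (Sym2 V) :=
  F.image (Sym2.map Subtype.val) ∪
    ((A.filter (· ∈ P)).image (fun w => s(u, w)) ∪ (B.filter (· ∈ P)).image (fun w => s(v, w)))

open Classical in
theorem card_extendedCut_le {V : Type*} {s : Set V} (F : Finset (Sym2 s)) (u v : V)
    (A B : Finset V) (P : Set V) :
    (extendedCut F u v A B P).card ≤
      F.card + ((A.filter (· ∈ P)).card + (B.filter (· ∈ P)).card) :=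
  (Finset.card_union_le _ _).trans <| add_le_add Finset.card_image_le <|
    (Finset.card_union_le _ _).trans <| add_le_add Finset.card_image_le Finset.card_image_le

theorem mem_extendedCut {V : Type*} {s : Set V} {F : Finset (Sym2 s)} {u v : V}
    {A B : Finset V} {P : Set V} {e : Sym2 V} :
    e ∈ extendedCut F u v A B P ↔ (∃ f ∈ F, Sym2.map Subtype.val f = e) ∨
      (∃ w, (w ∈ A ∧ w ∈ P) ∧ s(u, w) = e) ∨ (∃ w, (w ∈ B ∧ w ∈ P) ∧ s(v, w) = e) := by
  simp only [extendedCut, Finset.mem_union, Finset.mem_image, Finset.mem_filter]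

/-- If `X` is a connected cubic simple graph in which every cycle-separating edge set
has at least 6 edges, and `u, v` are adjacent vertices, then in the graph
`Y = X - {u, v}` every edge set `F` such that `Y - F` has at least two connected
components containing cycles has at least 4 edges. -/
theorem stmt18 {V : Type*} (X : SimpleGraph V) (hconn : X.Connected)
    (hcubic : ∀ v : V, Nat.card (X.neighborSet v) = 3)
    (h6 : ∀ F : Finset (Sym2 V), ↑F ⊆ X.edgeSet → CycleSeparating X ↑F → 6 ≤ F.card)
    (u v : V) (huv : X.Adj u v) :
    ∀ F : Finset (Sym2 ↥(({u, v} : Set V)ᶜ)),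
      ↑F ⊆ (X.induce (({u, v} : Set V)ᶜ)).edgeSet →
      (∃ (x y : ↥(({u, v} : Set V)ᶜ))
          (p : ((X.induce (({u, v} : Set V)ᶜ)).deleteEdges ↑F).Walk x x)
          (q : ((X.induce (({u, v} : Set V)ᶜ)).deleteEdges ↑F).Walk y y),
        p.IsCycle ∧ q.IsCycle ∧
          ¬ ((X.induce (({u, v} : Set V)ᶜ)).deleteEdges ↑F).Reachable x y) →
      4 ≤ F.card := by
  classical
  rintro F hF ⟨x, y, p, q, hp, hq, hxy⟩
  obtain ⟨A, hA2, hA⟩ := SimpleGraph.exists_finset_neighbors_ne (hcubic u) huv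
  obtain ⟨B, hB2, hB⟩ := SimpleGraph.exists_finset_neighbors_ne (hcubic v) huv.symm
  have six_le (P T : Set V) (hxT : x.1 ∈ T) (hyT : y.1 ∉ T) (huvT : u ∈ T ↔ v ∈ T)
      (hP : ∀ w, w ∉ P → w ≠ u → w ≠ v → (w ∈ T ↔ u ∈ T))
      (hT : ∀ a b, ((X.induce (({u, v} : Set V)ᶜ)).deleteEdges ↑F).Adj a b →
        a.1 ∈ T → b.1 ∈ T) : 6 ≤ (extendedCut F u v A B P).card := by
    let φ : ((X.induce (({u, v} : Set V)ᶜ)).deleteEdges ↑F) →g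
        X.deleteEdges (extendedCut F u v A B P : Set (Sym2 V)) :=
      { toFun := Subtype.val
        map_rel' := by
          rintro ⟨a, ha⟩ ⟨b, hb⟩ hab
          simp only [Set.mem_compl_iff, Set.mem_insert_iff, Set.mem_singleton_iff,
            not_or] at ha hb
          rw [SimpleGraph.deleteEdges_adj] at hab ⊢
          refine ⟨hab.1, fun hmem => ?_⟩
          rw [Finset.mem_coe, mem_extendedCut] at hmem
          rcases hmem with ⟨f, hf, hfe⟩ | ⟨w, -, hw⟩ | ⟨w, -, hw⟩
          · rw [← Sym2.map_mk] at hfe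
            exact hab.2 (Sym2.map.injective Subtype.val_injective hfe ▸ hf)
          all_goals
            rw [Sym2.eq_iff] at hw
            grind }
    have hclosed : ∀ a b, (X.deleteEdges (extendedCut F u v A B P : Set (Sym2 V))).Adj a b →
        a ∈ T → b ∈ T := by
      intro a b hab haT
      rw [SimpleGraph.deleteEdges_adj, Finset.mem_coe, mem_extendedCut] at hab
      obtain ⟨hadj, hnot⟩ := hab
      push Not at hnot
      obtain ⟨h1, h2, h3⟩ := hnot
      have hne := hadj.ne
      have hsymm := hadj.symm
      by_cases ha : a ∈ ({u, v} : Set V)ᶜ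
      · by_cases hb : b ∈ ({u, v} : Set V)ᶜ
        · refine hT ⟨a, ha⟩ ⟨b, hb⟩ ?_ haT
          rw [SimpleGraph.deleteEdges_adj]
          exact ⟨hadj, fun h => h1 _ h rfl⟩
        · have h2' := h2 a
          have h3' := h3 a
          simp only [Set.mem_compl_iff, Set.mem_insert_iff, Set.mem_singleton_iff,
            not_or] at *
          grind
      · have h2' := h2 b
        have h3' := h3 b
        simp only [Set.mem_compl_iff, Set.mem_insert_iff, Set.mem_singleton_iff,
            not_or] at *
        grind
    have hsep : ¬ (X.deleteEdges (extendedCut F u v A B P : Set (Sym2 V))).Reachable x.1 y.1 :=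
      fun h => hyT (h.mem_iff_of_adj hclosed hxT)
    refine h6 _ ?_ ⟨fun h => hsep (h.preconnected _ _), x.1, y.1, p.map φ, q.map φ,
      hp.map Subtype.val_injective, hq.map Subtype.val_injective, hsep⟩
    intro e he
    rw [Finset.mem_coe, mem_extendedCut] at he
    rcases he with ⟨f, hf, rfl⟩ | ⟨w, ⟨hw, -⟩, rfl⟩ | ⟨w, ⟨hw, -⟩, rfl⟩
    · induction f with
      | _ a b => exact hF hf
    · exact ((hA w).1 hw).1
    · exact ((hB w).1 hw).1
  let S : Set V := Subtype.val '' {z | ((X.induce (({u, v} : Set V)ᶜ)).deleteEdges ↑F).Reachable x z}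
  have hS : ∀ z : ↥(({u, v} : Set V)ᶜ), z.1 ∈ S ↔
      ((X.induce (({u, v} : Set V)ᶜ)).deleteEdges ↑F).Reachable x z := fun z =>
    Subtype.val_injective.mem_set_image
  have hS' : ∀ w ∈ S, w ≠ u ∧ w ≠ v := by
    rintro _ ⟨z, -, rfl⟩
    exact not_or.1 z.2
  have hclosed : ∀ a b, ((X.induce (({u, v} : Set V)ᶜ)).deleteEdges ↑F).Adj a b →
      a.1 ∈ S → b.1 ∈ S := fun a b hab ha =>
    (hS b).2 (((hS a).1 ha).trans hab.reachable)
  have hxS : x.1 ∈ S := (hS x).2 (SimpleGraph.Reachable.refl x)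
  have hyS : y.1 ∉ S := fun h => hxy ((hS y).1 h)
  have huS : u ∉ S := fun h => (hS' u h).1 rfl
  have hvS : v ∉ S := fun h => (hS' v h).2 rfl
  have hcut := six_le S S hxS hyS (iff_of_false huS hvS)
    (fun w hw _ _ => iff_of_false hw huS) hclosed
  have hcut' := six_le Sᶜ (S ∪ {u, v}) (Or.inl hxS) (by
      rintro (h | h)
      exacts [hyS h, y.2 h]) (by simp) (fun w hw _ _ => by simp_all) (by
      rintro a b hab (h | h)
      exacts [Or.inl (hclosed a b hab h), (a.2 h).elim])
  have hle := hcut.trans (card_extendedCut_le F u v A B S)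
  have hle' := hcut'.trans (card_extendedCut_le F u v A B Sᶜ)
  have hAS := Finset.card_filter_add_card_filter_not (s := A) (· ∈ S)
  have hBS := Finset.card_filter_add_card_filter_not (s := B) (· ∈ S)
  simp only [Set.mem_compl_iff] at hle'
  omega
end

section
/- Let G be a finite group generated by an involution a and an element b of order s ≥ 3 such that ab has order 3, let H = ⟨ab⟩ (a subgroup of order 3), and suppose the three left cosets bH, b⁻¹H, ab²H are pairwise distinct. Let Y be the simple graph whose vertices are the left cosets of H in G, with xH adjacent to yH if and only if x⁻¹y ∈ HaH. Then Y is a cubic graph, and the action of G on the vertices of Y by left multiplication is an action by graph automorphisms that is transitive on the arcs (ordered pairs of adjacent vertices) of Y, with only the identity element of G fixing an arc. -/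
/-- The coset graph: vertices are the left cosets of `H` in `G`, with `xH` adjacent to
`yH` iff `x⁻¹ * y` lies in the double coset `HaH`. -/
def cosetGraph {G : Type*} [Group G] (H : Subgroup G) (a : G) : SimpleGraph (G ⧸ H) :=
  SimpleGraph.fromRel (fun c d => ∃ x y : G,
    (QuotientGroup.mk x : G ⧸ H) = c ∧ (QuotientGroup.mk y : G ⧸ H) = d ∧
    ∃ h₁ ∈ H, ∃ h₂ ∈ H, x⁻¹ * y = h₁ * a * h₂)

theorem cosetGraph_adj_iff {G : Type*} [Group G] {H : Subgroup G} {a : G}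
    (ha : a * a = 1) (haH : a ∉ H) (c d : G ⧸ H) :
    (cosetGraph H a).Adj c d ↔
      ∃ g : G, (QuotientGroup.mk g : G ⧸ H) = c ∧ (QuotientGroup.mk (g * a) : G ⧸ H) = d := by
  have key : ∀ c d : G ⧸ H, (∃ x y : G,
      (QuotientGroup.mk x : G ⧸ H) = c ∧ (QuotientGroup.mk y : G ⧸ H) = d ∧
      ∃ h₁ ∈ H, ∃ h₂ ∈ H, x⁻¹ * y = h₁ * a * h₂) →
      ∃ g : G, (QuotientGroup.mk g : G ⧸ H) = c ∧
        (QuotientGroup.mk (g * a) : G ⧸ H) = d := by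
    rintro _ _ ⟨x, y, rfl, rfl, h₁, m₁, h₂, m₂, e⟩
    refine ⟨x * h₁, QuotientGroup.mk_mul_of_mem x m₁, ?_⟩
    rw [← QuotientGroup.mk_mul_of_mem (x * h₁ * a) m₂, inv_mul_eq_iff_eq_mul.mp e]
    simp only [mul_assoc]
  rw [cosetGraph, SimpleGraph.fromRel_adj]
  constructor
  · rintro ⟨-, h | h⟩
    · exact key c d h
    · obtain ⟨g, hc, hd⟩ := key d c h
      exact ⟨g * a, hd, by rw [mul_assoc, ha, mul_one, hc]⟩
  · rintro ⟨g, rfl, rfl⟩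
    refine ⟨fun h => haH ?_, .inl ⟨g, g * a, rfl, rfl, 1, H.one_mem, 1, H.one_mem, by group⟩⟩
    simpa using QuotientGroup.eq.mp h

theorem injective_mk_mul_subgroup_mul {G : Type*} [Group G] {H : Subgroup G} {a : G}
    (hfree : ∀ u ∈ H, (QuotientGroup.mk (u * a) : G ⧸ H) = QuotientGroup.mk a → u = 1)
    (x : G) :
    Function.Injective fun h : H => (QuotientGroup.mk (x * h * a) : G ⧸ H) := by
  intro h k e
  have e' : (k : G)⁻¹ * h = 1 := by
    refine hfree _ (H.mul_mem (H.inv_mem k.2) h.2) ?_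
    have := congrArg (fun c : G ⧸ H => ((k : G)⁻¹ * x⁻¹) • c) e
    simpa [MulAction.Quotient.smul_mk, mul_assoc] using this
  exact Subtype.ext (inv_mul_eq_one.mp e').symm

theorem card_neighborSet_cosetGraph {G : Type*} [Group G] {H : Subgroup G} {a : G}
    (ha : a * a = 1) (haH : a ∉ H)
    (hfree : ∀ u ∈ H, (QuotientGroup.mk (u * a) : G ⧸ H) = QuotientGroup.mk a → u = 1)
    (c : G ⧸ H) : Nat.card ((cosetGraph H a).neighborSet c) = Nat.card H := by
  obtain ⟨x, rfl⟩ := QuotientGroup.mk_surjective c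
  have hrange : (cosetGraph H a).neighborSet (QuotientGroup.mk x) =
      Set.range fun h : H => (QuotientGroup.mk (x * h * a) : G ⧸ H) := by
    ext d
    rw [SimpleGraph.mem_neighborSet, cosetGraph_adj_iff ha haH]
    constructor
    · rintro ⟨g, hg, rfl⟩
      exact ⟨⟨x⁻¹ * g, QuotientGroup.eq.mp hg.symm⟩, by simp⟩
    · rintro ⟨h, rfl⟩
      exact ⟨x * h, QuotientGroup.mk_mul_of_mem x h.2, rfl⟩
  rw [hrange]
  exact Nat.card_range_of_injective (injective_mk_mul_subgroup_mul hfree x)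

/-- Let `G` be a finite group generated by an involution `a` and an element `b` of
order `s ≥ 3` with `ab` of order 3, let `H = ⟨ab⟩`, and suppose the cosets `bH`,
`b⁻¹H`, `ab²H` are pairwise distinct. Then the coset graph `Y` on `G ⧸ H` with
adjacency `xH ~ yH ↔ x⁻¹y ∈ HaH` is cubic, and left multiplication by `G` is an
action by graph automorphisms that is transitive on the arcs of `Y`, with only the
identity fixing an arc (i.e. the action of `G` on the arcs is regular). -/
theorem stmt19 {G : Type*} [Group G] [Fintype G] (a b : G) (s : ℕ)
    (hs : 3 ≤ s) (ha : orderOf a = 2) (hb : orderOf b = s) (hab : orderOf (a * b) = 3)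
    (hgen : Subgroup.closure ({a, b} : Set G) = ⊤)
    (H : Subgroup G) (hH : H = Subgroup.zpowers (a * b))
    (hdist : (QuotientGroup.mk b : G ⧸ H) ≠ QuotientGroup.mk b⁻¹ ∧
      (QuotientGroup.mk b : G ⧸ H) ≠ QuotientGroup.mk (a * b ^ 2) ∧
      (QuotientGroup.mk b⁻¹ : G ⧸ H) ≠ QuotientGroup.mk (a * b ^ 2)) :
    (∀ c : G ⧸ H, Nat.card ((cosetGraph H a).neighborSet c) = 3) ∧
      (∀ (g : G) (c d : G ⧸ H),
        (cosetGraph H a).Adj (g • c) (g • d) ↔ (cosetGraph H a).Adj c d) ∧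
      (∀ c d c' d' : G ⧸ H, (cosetGraph H a).Adj c d → (cosetGraph H a).Adj c' d' →
        ∃ g : G, g • c = c' ∧ g • d = d') ∧
      (∀ (g : G) (c d : G ⧸ H), (cosetGraph H a).Adj c d →
        g • c = c → g • d = d → g = 1) := by
  have haa : a * a = 1 := by rw [← pow_two, ← ha, pow_orderOf_eq_one]
  have ht : (a * b) ^ 3 = 1 := hab ▸ pow_orderOf_eq_one (a * b)
  have htH : a * b ∈ H := hH ▸ Subgroup.mem_zpowers _
  have hb' : b = a * (a * b) := by rw [← mul_assoc, haa, one_mul]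
  have h₀ : (QuotientGroup.mk b : G ⧸ H) = QuotientGroup.mk a := by
    rw [← QuotientGroup.mk_mul_of_mem a htH, ← hb']
  have h₁ : (QuotientGroup.mk (a * b ^ 2) : G ⧸ H) = QuotientGroup.mk (a * b * a) := by
    rw [← QuotientGroup.mk_mul_of_mem (a * b * a) htH, mul_assoc (a * b) a, ← hb', pow_two,
      mul_assoc]
  have h₂ : b⁻¹ = (a * b) ^ 2 * a := by
    rw [eq_comm, eq_inv_iff_mul_eq_one, mul_assoc, ← pow_succ, ht]
  have hfree : ∀ u ∈ H,
      (QuotientGroup.mk (u * a) : G ⧸ H) = QuotientGroup.mk a → u = 1 := by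
    classical
    intro u hu e
    rw [hH, ← (isOfFinOrder_of_finite (a * b)).mem_powers_iff_mem_zpowers,
      (isOfFinOrder_of_finite (a * b)).mem_powers_iff_mem_range_orderOf, hab] at hu
    simp only [Finset.mem_image, Finset.mem_range] at hu
    obtain ⟨n, hn, rfl⟩ := hu
    interval_cases n
    · exact pow_zero _
    · rw [pow_one, ← h₁, ← h₀] at e
      exact absurd e.symm hdist.2.1
    · rw [← h₂, ← h₀] at e
      exact absurd e.symm hdist.1
  have haH : a ∉ H := by
    intro h
    have := hfree a h (by rw [haa]; exact QuotientGroup.eq.mpr (by simpa using h))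
    simp [this] at ha
  refine ⟨fun c => ?_, fun g c d => ?_, fun c d c' d' => ?_, fun g c d => ?_⟩
  · rw [card_neighborSet_cosetGraph haa haH hfree, hH, Nat.card_zpowers, hab]
  · simp only [cosetGraph_adj_iff haa haH]
    constructor
    · rintro ⟨x, hx, hy⟩
      refine ⟨g⁻¹ * x, ?_, ?_⟩
      · rw [← inv_smul_smul g c, ← hx]; rfl
      · rw [← inv_smul_smul g d, ← hy, mul_assoc]; rfl
    · rintro ⟨x, rfl, rfl⟩
      exact ⟨g * x, rfl, by rw [mul_assoc]; rfl⟩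
  · simp only [cosetGraph_adj_iff haa haH]
    rintro ⟨x, rfl, rfl⟩ ⟨y, rfl, rfl⟩
    exact ⟨y * x⁻¹, by simp [MulAction.Quotient.smul_mk],
      by simp [MulAction.Quotient.smul_mk, mul_assoc]⟩
  · rw [cosetGraph_adj_iff haa haH]
    rintro ⟨x, rfl, rfl⟩ hc hd
    have hu : x⁻¹ * g * x ∈ H := by
      have := QuotientGroup.eq.mp hc.symm
      simpa [mul_assoc] using this
    have hua := congrArg (fun c : G ⧸ H => x⁻¹ • c) hd
    have := hfree _ hu (by simpa [MulAction.Quotient.smul_mk, mul_assoc] using hua)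
    rwa [mul_assoc, inv_mul_eq_one, eq_comm, mul_eq_right] at this
end
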